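/- For every S-scheme x : X → S, the category Comp_S(x) — whose objects are the compactifications of x, and whose morphisms i' → i are the morphisms of compactifications (f, g) : i' → i such that the identity morphism of X is the base change of g along j_i — is a nonempty cofiltered category: it is nonempty, every pair of objects admits a span over them, and for every parallel pair of morphisms there is a morphism equalizing them. -/

import Mathlib

open CategoryTheory AlgebraicGeometry CategoryTheory.Limits

/-- A compactification of an `S`-scheme `X` (an object of `Over S`): a closed immersion
`i : Z ↪ P` of proper `S`-schemes together with a complementary open immersion `j : X ↪ P`,
i.e. the set-theoretic image of `j` is the complement of the set-theoretic image of `i`. -/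
structure Compactification {S : Scheme.{0}} (X : Over S) where
  /-- the boundary -/
  Z : Over S
  /-- the ambient proper `S`-scheme -/
  P : Over S
  properZ : IsProper Z.hom
  properP : IsProper P.hom
  /-- the closed immersion `Z ↪ P` -/
  i : Z ⟶ P
  closed_i : IsClosedImmersion i.left
  /-- the complementary open immersion `X ↪ P` -/
  j : X ⟶ P
  open_j : IsOpenImmersion j.left
  compl : Set.range j.left.base = (Set.range i.left.base)ᶜ

/-- A morphism of compactifications `(f, g) : i → l`: morphisms `f : Z ⟶ W` and `g : P ⟶ Q`
of `S`-schemes such that `g ∘ i = l ∘ f` and the induced morphism `Z → W ×_Q P` to the fibre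
product is surjective. -/
structure CompMor {S : Scheme.{0}} {X Y : Over S} (C : Compactification X)
    (D : Compactification Y) where
  /-- the morphism on boundaries -/
  f : C.Z ⟶ D.Z
  /-- the morphism on ambient schemes -/
  g : C.P ⟶ D.P
  comm : C.i.left ≫ g.left = f.left ≫ D.i.left
  surj : Function.Surjective (pullback.lift f.left C.i.left comm.symm).base

/-- `h : X ⟶ Y` is the base change of `g : C.P ⟶ D.P` along `j_l = D.j`: the square with top
arrow `C.j : X ↪ C.P`, bottom arrow `D.j : Y ↪ D.P`, left arrow `h` and right arrow `g`
commutes and is Cartesian. -/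
def IsBaseChangeOf {S : Scheme.{0}} {X Y : Over S} (C : Compactification X)
    (D : Compactification Y) (g : C.P ⟶ D.P) (h : X ⟶ Y) : Prop :=
  IsPullback C.j.left h.left g.left D.j.left

universe u v

namespace NagataAux

open TopologicalSpace nonZeroDivisors

variable {X Y Z T : Scheme.{u}}

lemma ideal_comap_openImmersion (j : X ⟶ Y) [IsOpenImmersion j] (I : Y.IdealSheafData)
    (U : Y.affineOpens) (D : X.affineOpens) (h : D.1 ≤ j ⁻¹ᵁ U.1) :
    (I.comap j).ideal D = (I.ideal U).map (j.appLE U.1 D.1 h).hom := by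
  rw [Scheme.IdealSheafData.ideal_comap_of_isOpenImmersion]
  have hle : j ''ᵁ D.1 ≤ U.1 := by
    rintro _ ⟨x, hx, rfl⟩
    exact h hx
  rw [← I.map_ideal (U := ⟨j ''ᵁ D.1, D.2.image_of_isOpenImmersion j⟩) (V := U) hle]
  have h2 := Ideal.map_symm (j.appIso D.1).symm.commRingCatIsoToRingEquiv
    (I := Ideal.map (Y.presheaf.map (homOfLE hle).op).hom (I.ideal U))
  refine h2.symm.trans ?_
  have h3 : j.appLE U.1 D.1 h = Y.presheaf.map (homOfLE hle).op ≫ (j.appIso D.1).hom := by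
    rw [Scheme.Hom.appIso_hom', Scheme.Hom.map_appLE]
  rw [h3, CommRingCat.hom_comp, ← Ideal.map_map]
  rfl

lemma ideal_comap_top [IsAffine X] [IsAffine Y] (f : X ⟶ Y) (I : Y.IdealSheafData) :
    (I.comap f).ideal ⟨⊤, isAffineOpen_top X⟩ =
      (I.ideal ⟨⊤, isAffineOpen_top Y⟩).map f.appTop.hom := by
  apply le_antisymm
  · set K := Scheme.IdealSheafData.equivOfIsAffine.symm
      ((I.ideal ⟨⊤, isAffineOpen_top Y⟩).map f.appTop.hom) with hK
    have hK' : K.ideal ⟨⊤, isAffineOpen_top X⟩ = (I.ideal ⟨⊤, isAffineOpen_top Y⟩).map f.appTop.hom :=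
      Scheme.IdealSheafData.equivOfIsAffine.apply_symm_apply _
    rw [← hK']
    have : I.comap f ≤ K := by
      rw [← Scheme.IdealSheafData.le_map_iff_comap_le]
      apply Scheme.IdealSheafData.le_of_isAffine
      rw [Scheme.IdealSheafData.ideal_map _ _ _ (isAffineOpen_top X)]
      rw [← Ideal.map_le_iff_le_comap]
      exact hK'.ge
    exact this _
  · rw [Ideal.map_le_iff_le_comap]
    have : I ≤ (I.comap f).map f := Scheme.IdealSheafData.le_map_comap _ _
    have := this ⟨⊤, isAffineOpen_top Y⟩
    rwa [Scheme.IdealSheafData.ideal_map _ _ _ (isAffineOpen_top X)] at this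

lemma ideal_comap (f : X ⟶ Y) (I : Y.IdealSheafData)
    (U : Y.affineOpens) (D : X.affineOpens) (h : D.1 ≤ f ⁻¹ᵁ U.1) :
    (I.comap f).ideal D = (I.ideal U).map (f.appLE U.1 D.1 h).hom := by
  have : IsAffine D.1 := D.2
  have : IsAffine U.1 := U.2
  have e1 : (I.comap f).comap D.1.ι = (I.comap U.1.ι).comap (f.resLE U.1 D.1 h) := by
    rw [← Scheme.IdealSheafData.comap_comp, ← Scheme.IdealSheafData.comap_comp]
    simp
  have e2 := congr(($e1).ideal ⟨⊤, isAffineOpen_top _⟩)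
  have e3 := ideal_comap_openImmersion D.1.ι (I.comap f) D ⟨⊤, isAffineOpen_top _⟩ (by simp)
  have e4 := ideal_comap_top (f.resLE U.1 D.1 h) (I.comap U.1.ι)
  have e5 := ideal_comap_openImmersion U.1.ι I U ⟨⊤, isAffineOpen_top _⟩ (by simp)
  have e6 : Function.Bijective (D.1.ι.appLE D.1 ⊤ (by simp)).hom := by
    have : IsIso (D.1.ι.appLE D.1 ⊤ (by simp)) := by
      rw [Scheme.Opens.ι_appLE]
      have : IsIso (homOfLE (D.1.ι_image_top.le)) := ⟨homOfLE D.1.ι_image_top.ge, rfl, rfl⟩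
      exact inferInstanceAs (IsIso (X.presheaf.map (homOfLE (D.1.ι_image_top.le)).op))
    exact ConcreteCategory.bijective_of_isIso _
  have e7 : f.appLE U.1 D.1 h ≫ D.1.ι.appLE D.1 ⊤ (by simp) =
      U.1.ι.appLE U.1 ⊤ (by simp) ≫ (f.resLE U.1 D.1 h).appTop := by
    have a1 := Scheme.Hom.appLE_comp_appLE D.1.ι f U.1 D.1 ⊤ h (by simp)
    have a2 := Scheme.Hom.appLE_comp_appLE (f.resLE U.1 D.1 h) U.1.ι U.1 ⊤ ⊤ (by simp) le_rfl
    have a3 : (f.resLE U.1 D.1 h).appTop = (f.resLE U.1 D.1 h).appLE ⊤ ⊤ le_rfl :=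
      (Scheme.Hom.appLE_eq_app _).symm
    rw [a3]
    refine a1.trans (Eq.trans ?_ a2.symm)
    simp only [Scheme.Hom.resLE_comp_ι]
  rw [e4, e5, Ideal.map_map, ← CommRingCat.hom_comp, ← e7, CommRingCat.hom_comp, ← Ideal.map_map] at e2
  rw [e3] at e2
  have := congr(Ideal.comap (D.1.ι.appLE D.1 ⊤ (by simp)).hom $e2)
  rwa [Ideal.comap_map_of_bijective _ e6, Ideal.comap_map_of_bijective _ e6] at this

lemma iSup_affine_le_eq_top {f : X ⟶ Y} :
    (⨆ i : {p : X.affineOpens × Y.affineOpens // p.1.1 ≤ f ⁻¹ᵁ p.2.1}, i.1.1.1) = ⊤ := by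
  refine top_le_iff.mp fun x _ ↦ ?_
  obtain ⟨_, ⟨U, hU, rfl⟩, hxU, -⟩ := Y.isBasis_affineOpens.exists_subset_of_mem_open
    (Set.mem_univ (f x)) isOpen_univ
  obtain ⟨_, ⟨V, hV, rfl⟩, hxV, hVU⟩ := X.isBasis_affineOpens.exists_subset_of_mem_open
    (show x ∈ f ⁻¹ᵁ U from hxU) (f ⁻¹ᵁ U).isOpen
  exact Opens.mem_iSup.mpr ⟨⟨⟨⟨V, hV⟩, ⟨U, hU⟩⟩, hVU⟩, hxV⟩

lemma comap_mul (f : X ⟶ Y) (I J : Y.IdealSheafData) :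
    (I * J).comap f = I.comap f * J.comap f := by
  refine Scheme.IdealSheafData.ext_of_iSup_eq_top _ (iSup_affine_le_eq_top (f := f)) ?_
  rintro ⟨⟨D, U⟩, h⟩
  rw [Scheme.IdealSheafData.ideal_mul, Pi.mul_apply]
  simp only [ideal_comap f _ U D h]
  rw [Scheme.IdealSheafData.ideal_mul, Pi.mul_apply, Ideal.map_mul]

/-- An ideal sheaf is invertible if it is locally generated by a nonzerodivisor. -/
def IsInv (J : T.IdealSheafData) : Prop :=
  ∀ t : T, ∃ D : T.affineOpens, t ∈ D.1 ∧ ∃ s ∈ Γ(T, D.1)⁰, J.ideal D = Ideal.span {s}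

lemma res_mem_nonZeroDivisors {f : X ⟶ Y} [Flat f] {U : Y.affineOpens} {D : X.affineOpens}
    (h : D.1 ≤ f ⁻¹ᵁ U.1) {s : Γ(Y, U.1)} (hs : s ∈ Γ(Y, U.1)⁰) :
    (f.appLE U.1 D.1 h).hom s ∈ Γ(X, D.1)⁰ := by
  have := f.flat_appLE U.2 D.2 h
  algebraize [(f.appLE U.1 D.1 h).hom]
  have := Module.Flat.isSMulRegular_of_nonZeroDivisors (M := Γ(X, D.1)) hs
  rw [mem_nonZeroDivisors_iff_right]
  intro x hx
  apply this
  dsimp only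
  rw [Algebra.smul_def, smul_zero, mul_comm]
  exact hx

lemma isInv_comap_of_flat {J : Y.IdealSheafData} (hJ : IsInv J) (f : X ⟶ Y) [Flat f] :
    IsInv (J.comap f) := by
  intro x
  obtain ⟨U, hxU, s, hs, e⟩ := hJ (f x)
  obtain ⟨_, ⟨V, hV, rfl⟩, hxV, hVU⟩ := X.isBasis_affineOpens.exists_subset_of_mem_open
    (show x ∈ f ⁻¹ᵁ U.1 from hxU) (f ⁻¹ᵁ U.1).isOpen
  refine ⟨⟨V, hV⟩, hxV, _, res_mem_nonZeroDivisors (U := U) (D := ⟨V, hV⟩) hVU hs, ?_⟩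
  rw [ideal_comap f J U ⟨V, hV⟩ hVU, e, Ideal.map_span, Set.image_singleton]

lemma IsInv.top : IsInv (⊤ : T.IdealSheafData) := by
  intro t
  obtain ⟨_, ⟨V, hV, rfl⟩, hxV, hVU⟩ := T.isBasis_affineOpens.exists_subset_of_mem_open
    (Set.mem_univ t) isOpen_univ
  exact ⟨⟨V, hV⟩, hxV, 1, one_mem _, by simp⟩

lemma isInv_of_comap_openImmersion {J : Y.IdealSheafData}
    (H : ∀ y : Y, ∃ (X : Scheme.{u}) (j : X ⟶ Y) (_ : IsOpenImmersion j) (x : X),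
      j x = y ∧ IsInv (J.comap j)) : IsInv J := by
  intro y
  obtain ⟨X, j, _, x, rfl, h⟩ := H y
  obtain ⟨D, hxD, s, hs, e⟩ := h x
  let U : Y.affineOpens := ⟨j ''ᵁ D.1, D.2.image_of_isOpenImmersion j⟩
  refine ⟨U, ⟨x, hxD, rfl⟩, (j.appIso D.1).inv.hom s, ?_, ?_⟩
  · have h1 := (ConcreteCategory.bijective_of_isIso (j.appIso D.1).hom)
    rw [mem_nonZeroDivisors_iff_right] at hs ⊢
    intro z hz
    apply h1.1
    rw [map_zero]
    apply hs
    have := congr((j.appIso D.1).hom $hz)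
    rw [map_zero, map_mul] at this
    rw [← this]
    congr 1
    exact congr($((j.appIso D.1).inv_hom_id.symm) s)
  · rw [Scheme.IdealSheafData.ideal_comap_of_isOpenImmersion] at e
    have h1 := (ConcreteCategory.bijective_of_isIso (j.appIso D.1).inv)
    rw [← Ideal.map_comap_of_surjective _ h1.2 (J.ideal U)]
    refine (congrArg _ e).trans ?_
    rw [Ideal.map_span, Set.image_singleton]

/-- Restriction of sections between affine opens, as a ring homomorphism. -/
noncomputable abbrev res {D D' : X.affineOpens} (h : D' ≤ D) : Γ(X, D.1) →+* Γ(X, D'.1) :=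
  (X.presheaf.map (homOfLE h).op).hom

lemma res_mem_nonZeroDivisors' {D D' : X.affineOpens} (h : D' ≤ D) {s : Γ(X, D.1)}
    (hs : s ∈ Γ(X, D.1)⁰) : res h s ∈ Γ(X, D'.1)⁰ := by
  have := res_mem_nonZeroDivisors (f := 𝟙 X) (U := D) (D := D') h hs
  have e : (𝟙 X : X ⟶ X).appLE D.1 D'.1 h = X.presheaf.map (homOfLE h).op := by
    simp only [Scheme.Hom.appLE, Scheme.Hom.id_app]
    exact Category.id_comp _
  rwa [e] at this

lemma ideal_res {J : X.IdealSheafData} {D D' : X.affineOpens} (h : D' ≤ D) {s : Γ(X, D.1)}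
    (e : J.ideal D = Ideal.span {s}) : J.ideal D' = Ideal.span {res h s} := by
  rw [← J.map_ideal h, e, Ideal.map_span, Set.image_singleton]

/-- Among generators of an invertible ideal, one generates near a given point. -/
lemma exists_generator {J : X.IdealSheafData} {D : X.affineOpens} {s : Γ(X, D.1)}
    (hs : s ∈ Γ(X, D.1)⁰) (e : J.ideal D = Ideal.span {s}) {G : Set Γ(X, D.1)}
    (hG : J.ideal D = Ideal.span G) {x : X} (hx : x ∈ D.1) :
    ∃ g ∈ G, ∃ c : Γ(X, D.1), x ∈ X.basicOpen c ∧ g = s * c ∧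
      J.ideal (X.affineBasicOpen c) = Ideal.span {res (X.affineBasicOpen_le c) g} := by
  have h1 : ∀ g : G, ∃ c, g.1 = s * c := fun g ↦ by
    have : g.1 ∈ Ideal.span {s} := e ▸ hG ▸ Ideal.subset_span g.2
    obtain ⟨c, hc⟩ := Ideal.mem_span_singleton.mp this
    exact ⟨c, hc⟩
  choose c hc using h1
  have h2 : Ideal.span (Set.range c) = ⊤ := by
    rw [Ideal.eq_top_iff_one]
    have h3 : Ideal.span {s} * Ideal.span (Set.range c) = Ideal.span G := by
      rw [Ideal.span_mul_span']
      congr 1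
      ext y
      simp only [Set.singleton_mul, Set.mem_image, Set.mem_range, exists_exists_eq_and]
      constructor
      · rintro ⟨g, rfl⟩; rw [← hc]; exact g.2
      · intro hy; exact ⟨⟨y, hy⟩, (hc ⟨y, hy⟩).symm⟩
    have : s ∈ Ideal.span {s} * Ideal.span (Set.range c) := by
      rw [h3, ← hG, e]; exact Ideal.mem_span_singleton_self s
    obtain ⟨y, hy, hy'⟩ := Ideal.mem_span_singleton_mul.mp this
    have : y = 1 := by
      have h0 : s * (y - 1) = 0 := by rw [mul_sub, hy', mul_one, sub_self]
      exact sub_eq_zero.mp (mul_left_mem_nonZeroDivisors_eq_zero_iff hs |>.mp h0)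
    rwa [← this]
  have h4 : ∃ g : G, x ∈ X.basicOpen (c g) := by
    by_contra hcon
    push Not at hcon
    let p := (D.2.primeIdealOf ⟨x, hx⟩)
    have : Ideal.span (Set.range c) ≤ p.asIdeal := by
      rw [Ideal.span_le]
      rintro _ ⟨g, rfl⟩
      by_contra hg
      apply hcon g
      have := D.2.fromSpec_primeIdealOf ⟨x, hx⟩
      have h5 : p ∈ D.2.fromSpec ⁻¹ᵁ (X.basicOpen (c g)) := by
        rw [D.2.fromSpec_preimage_basicOpen]; exact hg
      have h6 : D.2.fromSpec p ∈ X.basicOpen (c g) := h5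
      rwa [this] at h6
    rw [h2] at this
    exact p.2.ne_top (top_le_iff.mp this)
  obtain ⟨g, hg⟩ := h4
  refine ⟨g, g.2, c g, hg, hc g, ?_⟩
  rw [ideal_res (X.affineBasicOpen_le (c g)) e, hc g, map_mul]
  refine (Ideal.span_singleton_mul_right_unit ?_ _).symm
  exact X.toRingedSpace.isUnit_res_basicOpen (c g)

lemma IsInv.exists_le {J : X.IdealSheafData} (hJ : IsInv J) {x : X} {W : X.Opens} (hx : x ∈ W) :
    ∃ D : X.affineOpens, x ∈ D.1 ∧ D.1 ≤ W ∧ ∃ s ∈ Γ(X, D.1)⁰, J.ideal D = Ideal.span {s} := by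
  obtain ⟨D, hxD, s, hs, e⟩ := hJ x
  obtain ⟨_, ⟨V, hV, rfl⟩, hxV, hVU⟩ := X.isBasis_affineOpens.exists_subset_of_mem_open
    (show x ∈ (W ⊓ D.1 : X.Opens) from ⟨hx, hxD⟩) (W ⊓ D.1).isOpen
  have h : (⟨V, hV⟩ : X.affineOpens) ≤ D := fun y hy ↦ (hVU hy).2
  exact ⟨⟨V, hV⟩, hxV, fun y hy ↦ (hVU hy).1, res h s, res_mem_nonZeroDivisors' h hs,
    ideal_res h e⟩

lemma IsInv.of_mul_left {I J : X.IdealSheafData} (h : IsInv (I * J)) : IsInv I := by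
  intro x
  obtain ⟨D, hxD, s, hs, e⟩ := h x
  have hG : (I * J).ideal D = Ideal.span {g | ∃ a ∈ I.ideal D, ∃ b ∈ J.ideal D, a * b = g} := by
    rw [Scheme.IdealSheafData.ideal_mul, Pi.mul_apply]
    nth_rw 1 [← Ideal.span_eq (I.ideal D), ← Ideal.span_eq (J.ideal D)]
    rw [Ideal.span_mul_span']
    congr 1
  obtain ⟨_, ⟨a, ha, b, hb, rfl⟩, c, hxc, hg, e'⟩ := exists_generator hs e hG hxD
  set D' := X.affineBasicOpen c
  have hle : D' ≤ D := X.affineBasicOpen_le c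
  have hc : IsUnit (res hle c) := X.toRingedSpace.isUnit_res_basicOpen c
  have hab : res hle (a * b) ∈ Γ(X, D'.1)⁰ := by
    rw [hg, map_mul]
    exact mul_mem (res_mem_nonZeroDivisors' hle hs) hc.mem_nonZeroDivisors
  rw [map_mul] at hab
  obtain ⟨ha', hb'⟩ := mul_mem_nonZeroDivisors.mp hab
  refine ⟨D', hxc, res hle a, ha', le_antisymm ?_ ?_⟩
  · intro z hz
    have hz' : z * res hle b ∈ (I * J).ideal D' := by
      rw [Scheme.IdealSheafData.ideal_mul, Pi.mul_apply]
      refine Ideal.mul_mem_mul hz ?_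
      rw [← J.map_ideal hle]
      exact Ideal.mem_map_of_mem _ hb
    rw [e'] at hz'
    obtain ⟨y, hy⟩ := Ideal.mem_span_singleton.mp hz'
    refine Ideal.mem_span_singleton.mpr ⟨y, ?_⟩
    rw [map_mul] at hy
    have h0 : (z - res hle a * y) * res hle b = 0 := by
      rw [sub_mul, hy]; ring
    exact sub_eq_zero.mp ((mul_right_mem_nonZeroDivisors_eq_zero_iff hb').mp h0)
  · rw [Ideal.span_singleton_le_iff_mem, ← I.map_ideal hle]
    exact Ideal.mem_map_of_mem _ ha

lemma IsInv.of_mul_right {I J : X.IdealSheafData} (h : IsInv (I * J)) : IsInv J :=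
  IsInv.of_mul_left (mul_comm I J ▸ h)

/-- Two morphisms to a relatively separated scheme agree if they agree after composing with a
scheme-theoretically dominant morphism. -/
lemma ext_of_ker_eq_bot {f g : X ⟶ Y} (s : Y ⟶ Z) [IsSeparated s] (h : f ≫ s = g ≫ s)
    (i : T ⟶ X) (hi : i.ker = ⊥) (hU : i ≫ f = i ≫ g) : f = g := by
  let X' : Over Z := Over.mk (f ≫ s)
  let Y' : Over Z := Over.mk s
  let U' : Over Z := Over.mk (i ≫ f ≫ s)
  let f' : X' ⟶ Y' := Over.homMk f
  let g' : X' ⟶ Y' := Over.homMk g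
  let i' : U' ⟶ X' := Over.homMk i
  have : IsSeparated (Y'.hom) := ‹_›
  have : IsIso (equalizer.ι f' g').left := by
    apply IsClosedImmersion.isIso_iff_ker_eq_bot.mpr
    rw [eq_bot_iff, ← hi]
    have : i = (equalizer.lift (f := f') (g := g') i' (by ext; exact hU)).left ≫
        (equalizer.ι f' g').left := by
      rw [← Over.comp_left, equalizer.lift_ι]; rfl
    rw [this]
    exact Scheme.Hom.le_ker_comp _ _
  have h1 := congr(($(equalizer.condition f' g')).left)
  simp only [Over.comp_left] at h1
  exact (cancel_epi _).mp h1

/-- The complement of the support of an ideal sheaf. -/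
noncomputable def away (J : X.IdealSheafData) : X.Opens := J.support.compl

lemma mem_away {J : X.IdealSheafData} {x : X} : x ∈ away J ↔ x ∉ J.support := Iff.rfl

lemma away_inf_of_ideal_eq {J : X.IdealSheafData} {D : X.affineOpens} {s : Γ(X, D.1)}
    (e : J.ideal D = Ideal.span {s}) : away J ⊓ D.1 = X.basicOpen s := by
  ext x
  by_cases hx : x ∈ D.1
  · have : x ∈ away J ↔ _ := (Scheme.IdealSheafData.mem_support_iff_of_mem (I := J) hx).not
    have h2 : x ∈ (away J ⊓ D.1 : X.Opens) ↔ x ∈ away J := ⟨fun h ↦ h.1, fun h ↦ ⟨h, hx⟩⟩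
    rw [e] at this
    change x ∈ (away J ⊓ D.1 : X.Opens) ↔ x ∈ X.basicOpen s
    rw [h2, this]
    simp [Scheme.zeroLocus_span, Scheme.zeroLocus_singleton]
  · exact iff_of_false (fun h ↦ hx h.2) (fun h ↦ hx (X.basicOpen_le s h))

lemma IsInv.ker_ι {J : X.IdealSheafData} (hJ : IsInv J) {W : X.Opens} (hW : away J ≤ W) :
    W.ι.ker = ⊥ := by
  choose D hxD s hs e using hJ
  refine Scheme.IdealSheafData.ext_of_iSup_eq_top D
    (top_le_iff.mp fun x _ ↦ Opens.mem_iSup.mpr ⟨x, hxD x⟩) fun i ↦ ?_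
  rw [Scheme.IdealSheafData.ideal_bot, Pi.bot_apply, eq_bot_iff]
  refine (Scheme.Hom.ideal_ker_le _ _).trans fun a ha ↦ ?_
  have h1 : X.basicOpen (s i) ≤ W := by
    rw [← away_inf_of_ideal_eq (e i)]; exact inf_le_left.trans hW
  have h2 : X.presheaf.map (homOfLE (X.basicOpen_le (s i))).op a = 0 := by
    have h3 : (W.ι.app (D i).1) a = 0 := ha
    rw [Scheme.Opens.ι_app] at h3
    have hle : X.basicOpen (s i) ≤ W.ι ''ᵁ W.ι ⁻¹ᵁ (D i).1 := by
      intro y hy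
      exact ⟨⟨y, h1 hy⟩, X.basicOpen_le (s i) hy, rfl⟩
    have h5 : X.presheaf.map (homOfLE (X.basicOpen_le (s i))).op =
        X.presheaf.map (homOfLE (W.ι.image_preimage_le (D i).1)).op ≫
          X.presheaf.map (homOfLE hle).op := by
      rw [← Functor.map_comp]; rfl
    rw [h5, ConcreteCategory.comp_apply]
    exact (congrArg _ h3).trans (map_zero (X.presheaf.map (homOfLE hle).op).hom)
  have h4 := (D i).2.isLocalization_basicOpen (s i)
  obtain ⟨⟨_, n, rfl⟩, hn⟩ := (IsLocalization.map_eq_zero_iff (.powers (s i))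
    Γ(X, X.basicOpen (s i)) a).mp h2
  exact (mul_left_mem_nonZeroDivisors_eq_zero_iff (pow_mem (hs i) n)).mp hn

lemma IsInv.hom_ext {J : X.IdealSheafData} (hJ : IsInv J) {f g : X ⟶ Y} (s : Y ⟶ Z)
    [IsSeparated s] (h : f ≫ s = g ≫ s) {W : X.Opens} (hW : away J ≤ W)
    (hU : W.ι ≫ f = W.ι ≫ g) : f = g :=
  ext_of_ker_eq_bot s h W.ι (hJ.ker_ι hW) hU

lemma IsInv.dense [IsLocallyNoetherian X] {J : X.IdealSheafData} (hJ : IsInv J) :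
    Dense (away J : Set X) := by
  have h1 := hJ.ker_ι le_rfl
  have := Scheme.Hom.support_ker (away J).ι
  rw [h1, Scheme.IdealSheafData.support_bot, Scheme.Opens.range_ι] at this
  exact dense_iff_closure_eq.mpr this.symm

end NagataAux

namespace NagataAux

open TopologicalSpace nonZeroDivisors Polynomial

section Rees

variable {R : Type v} {C : Type u} [CommRing R] [CommRing C] [Algebra R C] (M : Submodule R C)

/-- The graded subalgebra of `C[X]` whose `i`-th coefficients lie in `M ^ i`. -/
def rees : Subalgebra R C[X] where
  carrier := { f | ∀ i, f.coeff i ∈ M ^ i }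
  mul_mem' hf hg i := by
    rw [coeff_mul]
    apply Submodule.sum_mem
    rintro ⟨j, k⟩ e
    rw [← Finset.HasAntidiagonal.mem_antidiagonal.mp e, pow_add]
    exact Submodule.mul_mem_mul (hf j) (hg k)
  add_mem' hf hg i := by
    rw [coeff_add]
    exact Submodule.add_mem _ (hf i) (hg i)
  algebraMap_mem' r i := by
    rw [IsScalarTower.algebraMap_apply R C C[X], Polynomial.algebraMap_apply, coeff_C]
    split_ifs with h
    · subst h
      simp
    · simp

variable {M} in
lemma monomial_mem_rees {n : ℕ} {c : C} (hc : c ∈ M ^ n) : monomial n c ∈ rees M := by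
  intro i
  rw [coeff_monomial]
  split_ifs with h
  · exact h ▸ hc
  · exact zero_mem _

lemma monomial_mem_adjoin {n : ℕ} {c : C} (hc : c ∈ M ^ n) :
    monomial n c ∈ Algebra.adjoin R
      (Submodule.map ((monomial 1 : C →ₗ[C] C[X]).restrictScalars R) M : Set C[X]) := by
  induction n generalizing c with
  | zero =>
    obtain ⟨r, rfl⟩ := Submodule.mem_one.mp hc
    exact Subalgebra.algebraMap_mem _ r
  | succ n hn =>
    rw [pow_succ'] at hc
    refine Submodule.mul_induction_on hc ?_ ?_
    · intro r hr s hs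
      rw [add_comm n 1, ← monomial_mul_monomial]
      exact Subalgebra.mul_mem _ (Algebra.subset_adjoin (Set.mem_image_of_mem _ hr)) (hn hs)
    · intro x y hx hy
      rw [map_add]
      exact Subalgebra.add_mem _ hx hy

lemma adjoin_eq_rees : Algebra.adjoin R
    (Submodule.map ((monomial 1 : C →ₗ[C] C[X]).restrictScalars R) M : Set C[X]) = rees M := by
  apply le_antisymm
  · apply Algebra.adjoin_le _
    rintro _ ⟨r, hr, rfl⟩
    exact monomial_mem_rees (by rwa [pow_one])
  · intro p hp
    rw [p.as_sum_support]
    apply Subalgebra.sum_mem _ _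
    rintro i -
    exact monomial_mem_adjoin _ (hp i)

variable {M} in
lemma finiteType_rees (hM : M.FG) : Algebra.FiniteType R (rees M) := by
  refine ⟨(rees M).fg_top.mpr ?_⟩
  classical
  obtain ⟨s, hs⟩ := hM
  rw [← adjoin_eq_rees, ← hs]
  use s.image (monomial 1)
  rw [Finset.coe_image, Submodule.map_span, Algebra.adjoin_span]
  rfl

/-- The degree `n` part. -/
noncomputable def reesGr (n : ℕ) : Submodule R (rees M) :=
  (LinearMap.range ((monomial n : C →ₗ[C] C[X]).restrictScalars R)).comap (rees M).val.toLinearMap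

variable {M}

lemma mem_reesGr {n : ℕ} {p : rees M} : p ∈ reesGr M n ↔ monomial n (p.1.coeff n) = p.1 := by
  constructor
  · rintro ⟨c, hc⟩
    have hc' : monomial n c = p.1 := hc
    rw [← hc', coeff_monomial, if_pos rfl]
  · intro h
    exact ⟨_, h⟩

/-- The monomial `c X ^ n` of the Rees algebra. -/
noncomputable def mon (n : ℕ) (c : C) (hc : c ∈ M ^ n) : rees M :=
  ⟨monomial n c, monomial_mem_rees hc⟩

lemma mon_mem (n : ℕ) (c : C) (hc : c ∈ M ^ n) : mon n c hc ∈ reesGr M n := ⟨c, rfl⟩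

lemma mon_coeff {n : ℕ} {p : rees M} (hp : p ∈ reesGr M n) : mon n (p.1.coeff n) (p.2 n) = p :=
  Subtype.ext (mem_reesGr.mp hp)

instance : SetLike.GradedMonoid (reesGr M) where
  one_mem := ⟨1, rfl⟩
  mul_mem i j p q hp hq := by
    obtain ⟨a, ha⟩ := hp
    obtain ⟨b, hb⟩ := hq
    refine ⟨a * b, ?_⟩
    have ha' : monomial i a = p.1 := ha
    have hb' : monomial j b = q.1 := hb
    change monomial (i + j) (a * b) = p.1 * q.1
    rw [← ha', ← hb', monomial_mul_monomial]

lemma coeff_coeAddMonoidHom (x : DirectSum ℕ fun i ↦ reesGr M i) (n : ℕ) :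
    (DirectSum.coeAddMonoidHom (reesGr M) x).1.coeff n = (x n).1.1.coeff n := by
  induction x using DirectSum.induction_on with
  | zero => simp
  | of i p =>
    rw [DirectSum.coeAddMonoidHom_of]
    by_cases h : i = n
    · subst h
      rw [DirectSum.of_eq_same]
    · rw [DirectSum.of_eq_of_ne _ _ _ (Ne.symm h), ← mem_reesGr.mp p.2, coeff_monomial, if_neg h]
      rfl
  | add x y hx hy =>
    rw [map_add, DirectSum.add_apply]
    exact (coeff_add _ _ _).trans ((congrArg₂ _ hx hy).trans (coeff_add _ _ _).symm)

lemma isInternal_reesGr : DirectSum.IsInternal (reesGr M) := by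
  constructor
  · intro x y hxy
    ext n : 2
    have h := coeff_coeAddMonoidHom x n
    rw [hxy, coeff_coeAddMonoidHom y n] at h
    apply Subtype.ext
    rw [← mem_reesGr.mp (x n).2, ← mem_reesGr.mp (y n).2, h]
  · intro p
    have h : p = ∑ n ∈ p.1.support, mon n (p.1.coeff n) (p.2 n) := by
      apply Subtype.ext
      conv_lhs => rw [p.1.as_sum_support]
      rw [AddSubmonoidClass.coe_finsetSum]
      rfl
    rw [h]
    refine ⟨∑ n ∈ p.1.support, DirectSum.of (fun i ↦ reesGr M i) n
      ⟨mon n (p.1.coeff n) (p.2 n), mon_mem _ _ _⟩, ?_⟩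
    rw [map_sum]
    exact Finset.sum_congr rfl fun n _ ↦ DirectSum.coeAddMonoidHom_of _ _ _

noncomputable instance : DirectSum.Decomposition (reesGr M) :=
  isInternal_reesGr.chooseDecomposition

noncomputable instance : GradedAlgebra (reesGr M) where

/-- The fraction `c X ^ n / (s X) ^ n`. -/
noncomputable def frac {s : C} (hs : s ∈ M ^ 1) (n : ℕ) (c : C) (hc : c ∈ M ^ n) :
    HomogeneousLocalization.Away (reesGr M) (mon 1 s hs) :=
  HomogeneousLocalization.Away.mk (reesGr M) (mon_mem 1 s hs) n (mon n c hc)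
    (by rw [nsmul_one]; exact mon_mem n c hc)

lemma frac_surjective {s : C} (hs : s ∈ M ^ 1)
    (x : HomogeneousLocalization.Away (reesGr M) (mon 1 s hs)) :
    ∃ n c hc, frac hs n c hc = x := by
  obtain ⟨n, a, ha, rfl⟩ := HomogeneousLocalization.Away.mk_surjective (reesGr M) (mon_mem 1 s hs) x
  have ha' : a ∈ reesGr M n := by simpa using ha
  refine ⟨n, a.1.coeff n, a.2 n, ?_⟩
  unfold frac
  congr 1
  exact mon_coeff ha'

lemma mon_mul_mon {m n : ℕ} {c d : C} (hc : c ∈ M ^ m) (hd : d ∈ M ^ n) :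
    mon m c hc * mon n d hd =
      mon (m + n) (c * d) (by rw [pow_add]; exact Submodule.mul_mem_mul hc hd) :=
  Subtype.ext (monomial_mul_monomial _ _ _ _)

lemma mon_pow {m : ℕ} {c : C} (hc : c ∈ M ^ m) (k : ℕ) :
    mon m c hc ^ k =
      mon (m * k) (c ^ k) (by rw [pow_mul]; exact Submodule.pow_mem_pow _ hc k) :=
  Subtype.ext (monomial_pow _ _ _)

lemma frac_mul_frac {s : C} (hs : s ∈ M ^ 1) {m n : ℕ} {c d : C} (hc : c ∈ M ^ m)
    (hd : d ∈ M ^ n) : frac hs m c hc * frac hs n d hd =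
      frac hs (m + n) (c * d) (by rw [pow_add]; exact Submodule.mul_mem_mul hc hd) := by
  apply HomogeneousLocalization.val_injective
  rw [HomogeneousLocalization.val_mul]
  unfold frac
  simp only [HomogeneousLocalization.Away.val_mk, Localization.mk_mul, mon_mul_mon]
  congr 1
  exact Subtype.ext (pow_add _ _ _).symm

lemma frac_eq_of_eq {s : C} (hs : s ∈ M ^ 1) {m n : ℕ} {c d : C} (hc : c ∈ M ^ m)
    (hd : d ∈ M ^ n) (h : s ^ n * c = s ^ m * d) : frac hs m c hc = frac hs n d hd := by
  apply HomogeneousLocalization.val_injective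
  unfold frac
  simp only [HomogeneousLocalization.Away.val_mk]
  rw [Localization.mk_eq_mk_iff, Localization.r_iff_exists]
  refine ⟨1, ?_⟩
  simp only [mon_pow, mon_mul_mon, OneMemClass.coe_one, one_mul]
  apply Subtype.ext
  change (monomial (n + m) : C →ₗ[C] C[X]) _ = monomial (m + n) _
  rw [h, add_comm n m]

lemma exists_of_frac_eq {s : C} (hs : s ∈ M ^ 1) {m n : ℕ} {c d : C} (hc : c ∈ M ^ m)
    (hd : d ∈ M ^ n) (h : frac hs m c hc = frac hs n d hd) :
    ∃ k, s ^ k * (s ^ n * c) = s ^ k * (s ^ m * d) := by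
  have h1 := congrArg HomogeneousLocalization.val h
  unfold frac at h1
  simp only [HomogeneousLocalization.Away.val_mk] at h1
  rw [Localization.mk_eq_mk_iff, Localization.r_iff_exists] at h1
  obtain ⟨⟨_, k, rfl⟩, h2⟩ := h1
  simp only [mon_pow, mon_mul_mon] at h2
  have h3 := congrArg Subtype.val h2
  refine ⟨k, ?_⟩
  have h4 : (monomial (1 * k + (1 * n + m)) : C →ₗ[C] C[X]) (s ^ k * (s ^ n * c)) =
      (monomial (1 * k + (1 * m + n)) : C →ₗ[C] C[X]) (s ^ k * (s ^ m * d)) := h3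
  rw [show 1 * k + (1 * m + n) = 1 * k + (1 * n + m) by omega] at h4
  exact monomial_injective _ h4

lemma pow_dvd_of_mem {D : Type*} [CommRing D] (φ : C →+* D) {s : C}
    (hd : ∀ c ∈ M, φ s ∣ φ c) {n : ℕ} {c : C} (hc : c ∈ M ^ n) : φ s ^ n ∣ φ c := by
  induction n generalizing c with
  | zero => simp
  | succ n ih =>
    rw [pow_succ'] at hc
    refine Submodule.mul_induction_on hc ?_ ?_
    · intro a ha b hb
      rw [map_mul, pow_succ']
      exact mul_dvd_mul (hd a ha) (ih hb)
    · intro x y hx hy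
      rw [map_add]
      exact dvd_add hx hy

/-- The universal property of the charts of the Rees algebra. -/
lemma exists_chart_hom {D : Type*} [CommRing D] (φ : C →+* D) {s : C} (hs : s ∈ M ^ 1)
    (hφ : φ s ∈ D⁰) (hd : ∀ c ∈ M, φ s ∣ φ c) :
    ∃ χ : HomogeneousLocalization.Away (reesGr M) (mon 1 s hs) →+* D,
      ∀ n c hc, φ s ^ n * χ (frac hs n c hc) = φ c := by
  let L := Localization.Away (φ s)
  have hinj : Function.Injective (algebraMap D L) :=
    IsLocalization.injective L (Submonoid.powers_le.mpr hφ)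
  let e : rees M →+* L := (eval₂RingHom ((algebraMap D L).comp φ)
    (IsLocalization.Away.invSelf (φ s))).comp (rees M).subtype
  have he (n c hc) : e (mon n c hc) =
      algebraMap D L (φ c) * IsLocalization.Away.invSelf (φ s) ^ n := by
    simp [e, mon]
  have hinv : algebraMap D L (φ s) * IsLocalization.Away.invSelf (φ s) = 1 :=
    IsLocalization.Away.mul_invSelf _
  have hu : IsUnit (e (mon 1 s hs)) := by
    rw [he, pow_one, hinv]
    exact isUnit_one
  let l := (Localization.awayLift e (mon 1 s hs) hu).comp
    { toFun := HomogeneousLocalization.val (𝒜 := reesGr M) (x := .powers (mon 1 s hs))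
      map_one' := HomogeneousLocalization.val_one
      map_mul' := HomogeneousLocalization.val_mul
      map_zero' := HomogeneousLocalization.val_zero
      map_add' := HomogeneousLocalization.val_add }
  have hl (n c hc) : algebraMap D L (φ s) ^ n * l (frac hs n c hc) = algebraMap D L (φ c) := by
    have h1 : l (frac hs n c hc) = Localization.awayLift e (mon 1 s hs) hu
      (Localization.mk (mon n c hc) ⟨mon 1 s hs ^ n, n, rfl⟩) := rfl
    have h2 : l (frac hs n c hc) = e (mon n c hc) := by
      rw [h1, Localization.mk_eq_mk', Localization.awayLift, IsLocalization.Away.lift]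
      rw [IsLocalization.lift_mk'_spec]
      change _ = e (mon 1 s hs ^ n) * _
      rw [map_pow, he 1 s, pow_one, hinv, one_pow, one_mul]
    rw [h2, he, mul_left_comm, ← mul_pow, hinv, one_pow, mul_one]
  have hrange (x) : l x ∈ (algebraMap D L).range := by
    obtain ⟨n, c, hc, rfl⟩ := frac_surjective hs x
    obtain ⟨y, hy⟩ := pow_dvd_of_mem φ hd hc
    refine ⟨y, ?_⟩
    have h1 := hl n c hc
    rw [hy, map_mul, map_pow] at h1
    have hu2 : IsUnit (algebraMap D L (φ s) ^ n) :=
      (IsUnit.of_mul_eq_one _ hinv).pow n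
    exact (hu2.mul_left_cancel h1).symm
  let E : D ≃+* (algebraMap D L).range := RingEquiv.ofBijective (algebraMap D L).rangeRestrict
    ⟨fun a b h ↦ hinj (congrArg Subtype.val h), (algebraMap D L).rangeRestrict_surjective⟩
  have hE (z) : algebraMap D L (E.symm z) = z.1 := congrArg Subtype.val (E.apply_symm_apply z)
  refine ⟨E.symm.toRingHom.comp (l.codRestrict _ hrange), fun n c hc ↦ hinj ?_⟩
  rw [map_mul, map_pow, ← hl n c hc]
  congr 1
  exact hE _

end Rees

section Charts

variable {R C : Type u} [CommRing R] [CommRing C] [Algebra R C] {M : Submodule R C}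

lemma adjoin_zero_eq_top {G : Set (rees M)} (h : Algebra.adjoin R G = ⊤) :
    Algebra.adjoin (reesGr M 0) G = ⊤ := by
  refine eq_top_iff.mpr fun x hx' ↦ ?_
  clear hx'
  have hx : x ∈ Algebra.adjoin R G := h ▸ Algebra.mem_top
  induction hx using Algebra.adjoin_induction with
  | mem x hx => exact Algebra.subset_adjoin hx
  | algebraMap r => exact Subalgebra.algebraMap_mem _ (algebraMap R (reesGr M 0) r)
  | add x y _ _ hx hy => exact add_mem hx hy
  | mul x y _ _ hx hy => exact mul_mem hx hy

lemma finiteType_zero (hM : M.FG) : Algebra.FiniteType (reesGr M 0) (rees M) := by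
  obtain ⟨s, hs⟩ := (finiteType_rees hM).out
  exact ⟨s, adjoin_zero_eq_top hs⟩

lemma isProper_toSpecZero (hM : M.FG) : IsProper (Proj.toSpecZero (reesGr M)) := by
  have := finiteType_zero hM
  infer_instance

/-- The coordinate ring of the chart of the Proj of the Rees algebra on which `s X` is
invertible. -/
noncomputable def ChartRing {s : C} (hs : s ∈ M ^ 1) : CommRingCat.{u} :=
  .of (HomogeneousLocalization.Away (reesGr M) (mon 1 s hs))

/-- The element `c / s ^ n` of a chart. -/
noncomputable def fr {s : C} (hs : s ∈ M ^ 1) (n : ℕ) (c : C) (hc : c ∈ M ^ n) : ChartRing hs :=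
  frac hs n c hc

lemma fr_surjective {s : C} (hs : s ∈ M ^ 1) (x : ChartRing hs) :
    ∃ (n : ℕ) (c : C) (hc : c ∈ M ^ n), fr hs n c hc = x :=
  frac_surjective hs x

lemma fr_mul_fr {s : C} (hs : s ∈ M ^ 1) {m n : ℕ} {c d : C} (hc : c ∈ M ^ m)
    (hd : d ∈ M ^ n) : fr hs m c hc * fr hs n d hd =
      fr hs (m + n) (c * d) (pow_add M m n ▸ Submodule.mul_mem_mul hc hd) :=
  frac_mul_frac hs hc hd

lemma fr_eq_of_eq {s : C} (hs : s ∈ M ^ 1) {m n : ℕ} {c d : C} (hc : c ∈ M ^ m)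
    (hd : d ∈ M ^ n) (h : s ^ n * c = s ^ m * d) : fr hs m c hc = fr hs n d hd :=
  frac_eq_of_eq hs hc hd h

lemma exists_of_fr_eq {s : C} (hs : s ∈ M ^ 1) {m n : ℕ} {c d : C} (hc : c ∈ M ^ m)
    (hd : d ∈ M ^ n) (h : fr hs m c hc = fr hs n d hd) :
    ∃ k, s ^ k * (s ^ n * c) = s ^ k * (s ^ m * d) :=
  exists_of_frac_eq hs hc hd h

lemma exists_chartRing_hom {D : Type*} [CommRing D] (φ : C →+* D) {s : C} (hs : s ∈ M ^ 1)
    (hφ : φ s ∈ D⁰) (hd : ∀ c ∈ M, φ s ∣ φ c) :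
    ∃ χ : ChartRing hs →+* D, ∀ n c hc, φ s ^ n * χ (fr hs n c hc) = φ c :=
  exists_chart_hom φ hs hφ hd

/-- The chart of the Proj of the Rees algebra on which `s X` is invertible. -/
noncomputable def chart {s : C} (hs : s ∈ M ^ 1) : Spec (ChartRing hs) ⟶ Proj (reesGr M) :=
  Proj.awayι (reesGr M) (mon 1 s hs) (mon_mem 1 s hs) one_pos

instance {s : C} (hs : s ∈ M ^ 1) : IsOpenImmersion (chart hs) :=
  inferInstanceAs (IsOpenImmersion (Proj.awayι (reesGr M) (mon 1 s hs) (mon_mem 1 s hs) one_pos))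

lemma opensRange_chart {s : C} (hs : s ∈ M ^ 1) :
    (chart hs).opensRange = Proj.basicOpen (reesGr M) (mon 1 s hs) :=
  Proj.opensRange_awayι (reesGr M) (mon 1 s hs) (mon_mem 1 s hs) one_pos

lemma exists_mem_chart (x : Proj (reesGr M)) :
    ∃ (s : C) (hs : s ∈ M ^ 1), x ∈ (chart hs).opensRange := by
  have h := Proj.iSup_basicOpen_eq_top' (reesGr M) (fun s : {s : C // s ∈ M ^ 1} ↦ mon 1 s.1 s.2)
    (fun s ↦ ⟨1, mon_mem _ _ _⟩) (by
      have h1 : Algebra.adjoin R (Set.range fun s : {s : C // s ∈ M ^ 1} ↦ mon 1 s.1 s.2) = ⊤ := by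
        apply Subalgebra.map_injective (f := (rees M).val) Subtype.val_injective
        rw [AlgHom.map_adjoin, Algebra.map_top, Subalgebra.range_val]
        conv_rhs => rw [← adjoin_eq_rees]
        congr 1
        ext p
        constructor
        · rintro ⟨_, ⟨s, rfl⟩, rfl⟩
          exact ⟨s.1, by simpa using s.2, rfl⟩
        · rintro ⟨s, hs, rfl⟩
          exact ⟨_, ⟨⟨s, by simpa using hs⟩, rfl⟩, rfl⟩
      exact adjoin_zero_eq_top h1)
  obtain ⟨s, hs⟩ := Opens.mem_iSup.mp (h.ge (Opens.mem_top x))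
  refine ⟨s.1, s.2, ?_⟩
  rw [opensRange_chart]
  exact hs

lemma chart_preimage {s t : C} (hs : s ∈ M ^ 1) (ht : t ∈ M ^ 1) :
    chart hs ⁻¹ᵁ (chart ht).opensRange = PrimeSpectrum.basicOpen (fr hs 1 t ht) := by
  rw [opensRange_chart]
  refine (Proj.awayι_preimage_basicOpen _ (mon_mem 1 s hs) one_pos
    (mon_mem 1 t ht) one_pos).trans ?_
  refine congrArg PrimeSpectrum.basicOpen (?_ : _ = frac hs 1 t ht)
  apply HomogeneousLocalization.val_injective
  unfold frac
  simp

variable (M) in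
/-- The structure homomorphism onto the degree zero part of the Rees algebra. -/
noncomputable def zeroHom : CommRingCat.of R ⟶ .of (reesGr M 0) :=
  CommRingCat.ofHom (algebraMap R (reesGr M 0))

lemma zeroHom_surjective : Function.Surjective (zeroHom M).hom := by
  intro x
  obtain ⟨r, hr⟩ := Submodule.mem_one.mp (x.1.2 0)
  refine ⟨r, ?_⟩
  apply Subtype.ext
  rw [← mon_coeff x.2]
  apply Subtype.ext
  change _ = monomial 0 _
  rw [← hr]
  rfl

variable (M) in
/-- The projection of the Proj of the Rees algebra to the base. -/
noncomputable def projBase : Proj (reesGr M) ⟶ Spec (.of (R)) :=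
  Proj.toSpecZero (reesGr M) ≫ Spec.map (zeroHom M)

lemma isProper_projBase (hM : M.FG) : IsProper (projBase M) := by
  have := isProper_toSpecZero hM
  have : IsClosedImmersion (Spec.map (zeroHom M)) :=
    IsClosedImmersion.spec_of_surjective _ zeroHom_surjective
  unfold projBase
  infer_instance

/-- The structure homomorphism of a chart. -/
noncomputable def chartBase {s : C} (hs : s ∈ M ^ 1) :
    CommRingCat.of R ⟶ ChartRing hs :=
  zeroHom M ≫ CommRingCat.ofHom (HomogeneousLocalization.fromZeroRingHom (reesGr M) _)

lemma chart_projBase {s : C} (hs : s ∈ M ^ 1) :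
    chart hs ≫ projBase M = Spec.map (chartBase hs) := by
  refine (Proj.awayι_toSpecZero_assoc (reesGr M) (mon 1 s hs) (mon_mem 1 s hs) one_pos _).trans ?_
  exact (Spec.map_comp _ _).symm

lemma chartBase_apply {s : C} (hs : s ∈ M ^ 1) (r : R) :
    (chartBase hs).hom r = fr hs 0 (algebraMap R C r) (Submodule.algebraMap_mem r) := by
  apply HomogeneousLocalization.val_injective
  unfold fr frac
  rw [HomogeneousLocalization.Away.val_mk]
  change Localization.mk _ _ = _
  congr 1

end Charts

end NagataAux

namespace NagataAux

open TopologicalSpace nonZeroDivisors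

section Affine

variable {A : Type u} [CommRing A] {I : Submodule A A}

lemma mem_pow_zero (a : A) : a ∈ I ^ 0 := Submodule.algebraMap_mem a

lemma chartBase_apply_self {s : A} (hs : s ∈ I ^ 1) (a : A) :
    (chartBase hs).hom a = fr hs 0 a (mem_pow_zero a) :=
  chartBase_apply hs a

lemma chartBase_mul_fr {s : A} (hs : s ∈ I ^ 1) {n : ℕ} {c : A} (hc : c ∈ I ^ n) :
    (chartBase hs).hom s ^ n * fr hs n c hc = (chartBase hs).hom c := by
  rw [← map_pow, chartBase_apply_self, chartBase_apply_self, fr_mul_fr]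
  apply fr_eq_of_eq
  rw [pow_zero, one_mul, zero_add]

lemma chartBase_dvd {s : A} (hs : s ∈ I ^ 1) {c : A} (hc : c ∈ I) :
    (chartBase hs).hom s ∣ (chartBase hs).hom c :=
  ⟨fr hs 1 c (by rwa [pow_one]), by
    have h := chartBase_mul_fr hs (n := 1) (c := c) (by rwa [pow_one])
    rw [pow_one] at h
    exact h.symm⟩

lemma chartBase_mem_nonZeroDivisors {s : A} (hs : s ∈ I ^ 1) :
    (chartBase hs).hom s ∈ (ChartRing hs)⁰ := by
  refine mem_nonZeroDivisors_iff_right.mpr fun x hx ↦ ?_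
  obtain ⟨n, c, hc, rfl⟩ := fr_surjective hs x
  have h0 : (0 : ChartRing hs) =
      fr hs 0 0 (zero_mem _) := by
    rw [← chartBase_apply_self, map_zero]
  rw [chartBase_apply_self, fr_mul_fr, h0] at hx
  obtain ⟨k, hk⟩ := exists_of_fr_eq hs _ _ hx
  rw [h0]
  have h1 : s ^ (k + 1) * c = 0 := by
    simp only [pow_zero, one_mul, mul_zero] at hk
    rw [← hk]; ring
  have h2 : fr hs n c hc = fr hs (k + 1 + n) (s ^ (k + 1) * c) (by
      rw [pow_add]
      refine Submodule.mul_mem_mul ?_ hc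
      simpa using Submodule.pow_mem_pow _ hs (k + 1)) := by
    apply fr_eq_of_eq; ring
  rw [h2]
  apply fr_eq_of_eq
  rw [h1]
  simp

lemma range_lift_le {C : Type u} [CommRing C] (φ : A →+* C) {s : A} (hs : s ∈ I ^ 1)
    (hφ : φ s ∈ C⁰) (hd : ∀ c ∈ I, φ s ∣ φ c) (g : Spec (.of C) ⟶ Proj (reesGr I))
    (hg : g ≫ projBase I = Spec.map (CommRingCat.ofHom φ)) :
    g ⁻¹ᵁ (chart hs).opensRange = ⊤ := by
  refine top_le_iff.mp fun y _ ↦ ?_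
  obtain ⟨t, ht, hy⟩ := exists_mem_chart (g y)
  obtain ⟨_, ⟨_, ⟨h, rfl⟩, rfl⟩, hyh, hle⟩ := PrimeSpectrum.isBasis_basic_opens.exists_subset_of_mem_open
    (show y ∈ g ⁻¹ᵁ (chart ht).opensRange from hy) (g ⁻¹ᵁ (chart ht).opensRange).isOpen
  let Ch := Localization.Away h
  let j : Spec (.of Ch) ⟶ Spec (.of C) := Spec.map (CommRingCat.ofHom (algebraMap C Ch))
  have hjr : Set.range j = ((PrimeSpectrum.basicOpen h : Opens (PrimeSpectrum C)) :
      Set (PrimeSpectrum C)) :=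
    PrimeSpectrum.localization_away_comap_range Ch h
  have hrange : Set.range (j ≫ g) ⊆ Set.range (chart ht) := by
    rintro _ ⟨z, rfl⟩
    rw [Scheme.Hom.comp_apply]
    exact hle (hjr ▸ ⟨z, rfl⟩)
  let k := IsOpenImmersion.lift (chart ht) (j ≫ g) hrange
  have hk : k ≫ chart ht = j ≫ g := IsOpenImmersion.lift_fac _ _ _
  obtain ⟨ψ, hψ⟩ := Spec.map_surjective k
  have hψφ : ψ.hom.comp (chartBase ht).hom = (algebraMap C Ch).comp φ := by
    have h1 : k ≫ chart ht ≫ projBase I = j ≫ Spec.map (CommRingCat.ofHom φ) := by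
      rw [← hg, reassoc_of% hk]
    rw [chart_projBase, ← hψ] at h1
    simp only [j, ← Spec.map_comp] at h1
    exact congrArg CommRingCat.Hom.hom (Spec.map_injective h1)
  have hψφ' (a) : ψ.hom ((chartBase ht).hom a) = algebraMap C Ch (φ a) := RingHom.congr_fun hψφ a
  have hu : IsUnit (ψ.hom (fr ht 1 s hs)) := by
    have ht' : t ∈ I := by simpa using ht
    obtain ⟨c, hc⟩ := hd t ht'
    have h1 : algebraMap C Ch (φ t) * ψ.hom (fr ht 1 s hs) = algebraMap C Ch (φ s) := by
      rw [← hψφ', ← hψφ', ← map_mul]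
      congr 1
      have := chartBase_mul_fr ht hs
      rwa [pow_one] at this
    have h2 : algebraMap C Ch (φ s) ∈ Ch⁰ :=
      IsLocalization.map_nonZeroDivisors_le (Submonoid.powers h) Ch ⟨_, hφ, rfl⟩
    refine IsUnit.of_mul_eq_one (algebraMap C Ch c) ?_
    rw [hc, map_mul] at h1
    have h3 : (ψ.hom (fr ht 1 s hs) * algebraMap C Ch c - 1) * algebraMap C Ch (φ s) = 0 := by
      linear_combination h1
    exact sub_eq_zero.mp ((mul_right_mem_nonZeroDivisors_eq_zero_iff h2).mp h3)
  obtain ⟨z, rfl⟩ : y ∈ Set.range j := hjr ▸ hyh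
  have h4 : g (j z) = chart ht (k z) := by
    rw [← Scheme.Hom.comp_apply, ← Scheme.Hom.comp_apply, hk]
  change g (j z) ∈ (chart hs).opensRange
  rw [h4]
  change k z ∈ chart ht ⁻¹ᵁ (chart hs).opensRange
  rw [chart_preimage ht hs, ← hψ]
  intro h5
  exact z.2.ne_top (Ideal.eq_top_of_isUnit_mem _ h5 hu)

lemma existsUnique_lift_spec {C : Type u} [CommRing C] (φ : A →+* C) {s : A} (hs : s ∈ I)
    (hφ : φ s ∈ C⁰) (hd : ∀ c ∈ I, φ s ∣ φ c) :
    ∃! g : Spec (.of C) ⟶ Proj (reesGr I), g ≫ projBase I = Spec.map (CommRingCat.ofHom φ) := by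
  have hs' : s ∈ I ^ 1 := by rwa [pow_one]
  obtain ⟨χ, hχ⟩ := exists_chartRing_hom φ hs' hφ hd
  refine ⟨Spec.map (CommRingCat.ofHom χ) ≫ chart hs', ?_, fun g hg ↦ ?_⟩
  · change (Spec.map (CommRingCat.ofHom χ) ≫ chart hs') ≫ projBase I = _
    rw [Category.assoc, chart_projBase, ← Spec.map_comp]
    congr 1
    apply CommRingCat.hom_ext
    ext a
    have := hχ 0 a (mem_pow_zero a)
    rw [pow_zero, one_mul] at this
    rw [CommRingCat.hom_comp, RingHom.comp_apply, chartBase_apply_self]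
    exact this
  · have hr := range_lift_le φ hs' hφ hd g hg
    have hr' : Set.range g ⊆ Set.range (chart hs') := by
      rintro _ ⟨z, rfl⟩
      exact (hr.ge (Opens.mem_top z) : z ∈ g ⁻¹ᵁ (chart hs').opensRange)
    let k := IsOpenImmersion.lift (chart hs') g hr'
    have hk : k ≫ chart hs' = g := IsOpenImmersion.lift_fac _ _ _
    obtain ⟨ψ, hψ⟩ := Spec.map_surjective k
    rw [← hk]
    congr 1
    rw [← hψ]
    congr 1
    have h1 : ψ.hom.comp (chartBase hs').hom = φ := by
      have h1 : k ≫ chart hs' ≫ projBase I = Spec.map (CommRingCat.ofHom φ) := by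
        rw [← hg, reassoc_of% hk]
      rw [chart_projBase, ← hψ] at h1
      simp only [← Spec.map_comp] at h1
      exact congrArg CommRingCat.Hom.hom (Spec.map_injective h1)
    ext x
    obtain ⟨n, c, hc, rfl⟩ := fr_surjective hs' x
    have h2 : φ s ^ n * ψ.hom (fr hs' n c hc) = φ c := by
      rw [← h1, RingHom.comp_apply, RingHom.comp_apply, ← map_pow, ← map_mul, chartBase_mul_fr hs' hc]
    have h3 : (ψ.hom (fr hs' n c hc) - χ (fr hs' n c hc)) * φ s ^ n = 0 := by
      linear_combination h2 - hχ n c hc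
    exact sub_eq_zero.mp ((mul_right_mem_nonZeroDivisors_eq_zero_iff (pow_mem hφ n)).mp h3)

end Affine

end NagataAux

namespace NagataAux

open TopologicalSpace nonZeroDivisors IsLocalRing

variable {X Y Z T : Scheme.{u}}

/-- The ideal of global sections of an ideal sheaf on a spectrum. -/
noncomputable def glob {R : CommRingCat.{u}} (J : (Spec R).IdealSheafData) : Ideal R :=
  (J.ideal ⟨⊤, isAffineOpen_top _⟩).map (Scheme.ΓSpecIso R).hom.hom

section glob

variable {R C : CommRingCat.{u}}

lemma glob_mul (I J : (Spec R).IdealSheafData) : glob (I * J) = glob I * glob J :=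
  Ideal.map_mul _ _ _

lemma glob_sup (I J : (Spec R).IdealSheafData) : glob (I ⊔ J) = glob I ⊔ glob J :=
  Ideal.map_sup _ _ _

lemma glob_mono {I J : (Spec R).IdealSheafData} (h : I ≤ J) : glob I ≤ glob J :=
  Ideal.map_mono (h _)

lemma glob_top : glob (⊤ : (Spec R).IdealSheafData) = ⊤ := Ideal.map_top _

lemma bijective_ΓSpecIso : Function.Bijective (Scheme.ΓSpecIso R).hom.hom :=
  ConcreteCategory.bijective_of_isIso (Scheme.ΓSpecIso R).hom

lemma le_of_glob_le {I J : (Spec R).IdealSheafData} (h : glob I ≤ glob J) : I ≤ J := by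
  apply Scheme.IdealSheafData.le_of_isAffine
  have := Ideal.comap_mono (f := (Scheme.ΓSpecIso R).hom.hom) h
  unfold glob at this
  rwa [Ideal.comap_map_of_bijective _ bijective_ΓSpecIso,
    Ideal.comap_map_of_bijective _ bijective_ΓSpecIso] at this

lemma glob_injective {I J : (Spec R).IdealSheafData} (h : glob I = glob J) : I = J :=
  (le_of_glob_le h.le).antisymm (le_of_glob_le h.ge)

lemma glob_surjective (I : Ideal R) : ∃ J : (Spec R).IdealSheafData, glob J = I := by
  refine ⟨Scheme.IdealSheafData.equivOfIsAffine.symm (I.comap (Scheme.ΓSpecIso R).hom.hom), ?_⟩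
  unfold glob
  rw [← Scheme.IdealSheafData.equivOfIsAffine_apply, OrderRingIso.apply_symm_apply]
  exact Ideal.map_comap_of_surjective _ bijective_ΓSpecIso.2 _

lemma ideal_top_eq_glob (J : (Spec R).IdealSheafData) :
    J.ideal ⟨⊤, isAffineOpen_top _⟩ = (glob J).map (Scheme.ΓSpecIso R).inv.hom := by
  unfold glob
  rw [Ideal.map_map, ← CommRingCat.hom_comp, Iso.hom_inv_id]
  exact (Ideal.map_id _).symm

lemma glob_comap (f : Spec R ⟶ X) (J : X.IdealSheafData) (U : X.affineOpens)
    (h : ⊤ ≤ f ⁻¹ᵁ U.1) :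
    glob (J.comap f) = (J.ideal U).map (f.appLE U.1 ⊤ h ≫ (Scheme.ΓSpecIso R).hom).hom := by
  unfold glob
  rw [ideal_comap f J U ⟨⊤, isAffineOpen_top _⟩ h, Ideal.map_map]
  rfl

lemma glob_comap_map (φ : R ⟶ C) (J : (Spec R).IdealSheafData) :
    glob (J.comap (Spec.map φ)) = (glob J).map φ.hom := by
  unfold glob
  rw [ideal_comap_top, Ideal.map_map, Ideal.map_map, ← CommRingCat.hom_comp,
    ← CommRingCat.hom_comp, Scheme.ΓSpecIso_naturality]

lemma glob_comap_fromSpec (J : X.IdealSheafData) (D : X.affineOpens) :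
    glob (J.comap D.2.fromSpec) = J.ideal D := by
  have h : (⊤ : (Spec Γ(X, D.1)).Opens) ≤ D.2.fromSpec ⁻¹ᵁ D.1 := D.2.fromSpec_preimage_self.ge
  rw [glob_comap _ _ D h]
  have e : D.2.fromSpec.appLE D.1 ⊤ h ≫ (Scheme.ΓSpecIso Γ(X, D.1)).hom = 𝟙 _ := by
    rw [Scheme.Hom.appLE, D.2.fromSpec_app_self, Category.assoc, Category.assoc,
      ← Functor.map_comp_assoc]
    rw [Iso.inv_comp_eq, Category.comp_id]
    refine Eq.trans (congrArg (· ≫ _) ?_) (Category.id_comp _)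
    exact (Spec Γ(X, D.1)).presheaf.map_id _
  rw [e]
  exact Ideal.map_id _

end glob

lemma isInv_spec {R : CommRingCat.{u}} {J : (Spec R).IdealSheafData} {s : R} (hs : s ∈ (R : Type u)⁰)
    (h : glob J = Ideal.span {s}) : IsInv J := by
  intro t
  refine ⟨⟨⊤, isAffineOpen_top _⟩, trivial, (Scheme.ΓSpecIso R).inv.hom s, ?_, ?_⟩
  · have : Function.Bijective (Scheme.ΓSpecIso R).inv.hom :=
      ConcreteCategory.bijective_of_isIso (Scheme.ΓSpecIso R).inv
    let e : R ≃+* Γ(Spec R, ⊤) := RingEquiv.ofBijective (Scheme.ΓSpecIso R).inv.hom this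
    exact (MulEquivClass.map_nonZeroDivisors e) ▸ ⟨s, hs, rfl⟩
  · rw [ideal_top_eq_glob, h, Ideal.map_span, Set.image_singleton]

/-- An ideal sheaf whose pullback is invertible is locally generated by a given section. -/
lemma IsInv.exists_spec {A : CommRingCat.{u}} {J : (Spec A).IdealSheafData} {f : T ⟶ Spec A}
    (hJ : IsInv (J.comap f)) (t : T) :
    ∃ (C : CommRingCat.{u}) (j : Spec C ⟶ T) (_ : IsOpenImmersion j) (φ : A ⟶ C) (s : A),
      t ∈ j.opensRange ∧ j ≫ f = Spec.map φ ∧ s ∈ glob J ∧ φ.hom s ∈ (C : Type u)⁰ ∧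
      (glob J).map φ.hom = Ideal.span {φ.hom s} := by
  obtain ⟨D, ht, s, hs, e⟩ := hJ t
  obtain ⟨φ, hφ⟩ := Spec.map_surjective (D.2.fromSpec ≫ f)
  have h1 : (J.comap f).ideal D = (glob J).map φ.hom := by
    rw [← glob_comap_fromSpec, ← Scheme.IdealSheafData.comap_comp, ← hφ, glob_comap_map]
  obtain ⟨_, ⟨a, ha, rfl⟩, c, htc, hc, e'⟩ := exists_generator hs e h1 ht
  let D' := T.affineBasicOpen c
  have hle := T.affineBasicOpen_le c
  let ψ := φ ≫ CommRingCat.ofHom (res hle)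
  have hψ : D'.2.fromSpec ≫ f = Spec.map ψ := by
    rw [Spec.map_comp, hφ, ← Category.assoc]
    congr 1
    exact (D.2.map_fromSpec D'.2 _).symm
  refine ⟨_, D'.2.fromSpec, D'.2.isOpenImmersion_fromSpec, ψ, a, ?_, hψ, ha, ?_, ?_⟩
  · exact (IsAffineOpen.opensRange_fromSpec D'.2).ge htc
  · change res hle (φ.hom a) ∈ _
    rw [hc, map_mul]
    refine mul_mem (res_mem_nonZeroDivisors' hle hs) ?_
    exact (T.toRingedSpace.isUnit_res_basicOpen c).mem_nonZeroDivisors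
  · rw [← glob_comap_map, ← hψ, Scheme.IdealSheafData.comap_comp, glob_comap_fromSpec, e']
    rfl

lemma hom_ext_of_local {f g : X ⟶ Y} (H : ∀ x : X, ∃ (T : Scheme.{u}) (j : T ⟶ X)
    (_ : IsOpenImmersion j), x ∈ j.opensRange ∧ j ≫ f = j ≫ g) : f = g := by
  choose T j hj hx h using H
  exact Scheme.Cover.hom_ext (.mkOfCovers X T j fun x ↦ ⟨x, hx x⟩) _ _ h

lemma exists_glue {T : X → Scheme.{u}} (j : ∀ x, T x ⟶ X) [∀ x, IsOpenImmersion (j x)]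
    (hx : ∀ x, x ∈ (j x).opensRange) (f : ∀ x, T x ⟶ Y)
    (hf : ∀ x y, pullback.fst (j x) (j y) ≫ f x = pullback.snd _ _ ≫ f y) :
    ∃ F : X ⟶ Y, ∀ x, j x ≫ F = f x :=
  ⟨Scheme.Cover.glueMorphisms (.mkOfCovers X T j fun x ↦ ⟨x, hx x⟩) f hf,
    Scheme.Cover.ι_glueMorphisms (.mkOfCovers X T j fun x ↦ ⟨x, hx x⟩) f hf⟩

/-- Unique lifts can be constructed locally. -/
lemma existsUnique_lift_of_local (b : Y ⟶ X) (P : ∀ {T : Scheme.{u}}, (T ⟶ X) → Prop)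
    (hP : ∀ {T T' : Scheme.{u}} (f : T ⟶ X) (j : T' ⟶ T) [IsOpenImmersion j], P f → P (j ≫ f))
    (H : ∀ {T : Scheme.{u}} (f : T ⟶ X), P f → ∀ t : T, ∃ (T' : Scheme.{u}) (j : T' ⟶ T)
      (_ : IsOpenImmersion j), t ∈ j.opensRange ∧ ∃! g : T' ⟶ Y, g ≫ b = j ≫ f)
    {T : Scheme.{u}} (f : T ⟶ X) (hf : P f) : ∃! g : T ⟶ Y, g ≫ b = f := by
  have huniq : ∀ {T : Scheme.{u}} (f : T ⟶ X), P f → ∀ g₁ g₂ : T ⟶ Y, g₁ ≫ b = f → g₂ ≫ b = f →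
      g₁ = g₂ := by
    intro T f hf g₁ g₂ h₁ h₂
    refine hom_ext_of_local fun t ↦ ?_
    obtain ⟨T', j, hj, ht, g, -, hu⟩ := H f hf t
    refine ⟨T', j, hj, ht, ?_⟩
    rw [hu (j ≫ g₁) (by simp only [Category.assoc, h₁]),
      hu (j ≫ g₂) (by simp only [Category.assoc, h₂])]
  choose T' j hj ht g hg hu using H f hf
  have hg' (t) : g t ≫ b = j t ≫ f := hg t
  obtain ⟨G, hG⟩ := exists_glue j ht g fun x y ↦ by
    refine huniq ((pullback.fst (j x) (j y) ≫ j x) ≫ f) (hP _ _ hf) _ _ ?_ ?_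
    · rw [Category.assoc, Category.assoc, hg']
    · rw [pullback.condition, Category.assoc, Category.assoc, hg']
  refine ⟨G, ?_, fun G' hG' ↦ huniq f hf _ _ hG' ?_⟩
  all_goals
    refine hom_ext_of_local fun t ↦ ⟨_, j t, hj t, ht t, ?_⟩
    rw [reassoc_of% hG, hg']

/-- `b` is the blow-up of `X` along the ideal sheaf `J`. -/
def IsBlowup (b : Y ⟶ X) (J : X.IdealSheafData) : Prop :=
  IsInv (J.comap b) ∧
    ∀ {T : Scheme.{u}} (f : T ⟶ X), IsInv (J.comap f) → ∃! g : T ⟶ Y, g ≫ b = f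

lemma IsBlowup.of_isIso_comp {b : Y ⟶ X} {J : Z.IdealSheafData} (e : X ⟶ Z) [IsIso e]
    (h : IsBlowup b (J.comap e)) : IsBlowup (b ≫ e) J := by
  refine ⟨by rw [Scheme.IdealSheafData.comap_comp]; exact h.1, fun {T} f hf ↦ ?_⟩
  obtain ⟨g, hg, hu⟩ := h.2 (f ≫ inv e) (by
    rwa [← Scheme.IdealSheafData.comap_comp, Category.assoc, IsIso.inv_hom_id, Category.comp_id])
  refine ⟨g, ?_, fun g' hg' ↦ hu _ ?_⟩
  · change g ≫ b ≫ e = f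
    rw [← Category.assoc, hg, Category.assoc, IsIso.inv_hom_id, Category.comp_id]
  · change g' ≫ b = f ≫ inv e
    rw [← hg']
    simp

lemma isBlowup_projBase {A : CommRingCat.{u}} (J : (Spec A).IdealSheafData) :
    IsBlowup (projBase (R := A) (C := A) (glob J)) J := by
  constructor
  · refine isInv_of_comap_openImmersion fun y ↦ ?_
    obtain ⟨s, hs, x, hx⟩ := exists_mem_chart (M := (glob J : Submodule A A)) y
    refine ⟨_, chart hs, inferInstance, x, hx, ?_⟩
    rw [← Scheme.IdealSheafData.comap_comp, chart_projBase]
    refine isInv_spec (chartBase_mem_nonZeroDivisors hs) ?_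
    rw [glob_comap_map]
    apply le_antisymm
    · rw [Ideal.map_le_iff_le_comap]
      exact fun c hc ↦ Ideal.mem_span_singleton.mpr (chartBase_dvd hs hc)
    · rw [Ideal.span_singleton_le_iff_mem]
      exact Ideal.mem_map_of_mem _ (by simpa using hs)
  · intro T f hf
    refine existsUnique_lift_of_local _ (fun {T} f ↦ IsInv (J.comap f)) (fun f j _ h ↦ ?_)
      (fun {T} f hf t ↦ ?_) f hf
    · rw [Scheme.IdealSheafData.comap_comp]
      exact isInv_comap_of_flat h j
    · obtain ⟨C, j, hj, φ, s, ht, hφ, hs, hs0, e⟩ := hf.exists_spec t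
      refine ⟨Spec C, j, hj, ht, ?_⟩
      rw [hφ]
      refine existsUnique_lift_spec φ.hom hs hs0 fun c hc ↦ ?_
      rw [← Ideal.mem_span_singleton, ← e]
      exact Ideal.mem_map_of_mem _ hc

lemma exists_isBlowup_of_isAffine [IsAffine X] [IsLocallyNoetherian X] (J : X.IdealSheafData) :
    ∃ (Y : Scheme.{u}) (b : Y ⟶ X), IsProper b ∧ IsBlowup b J := by
  have h1 := isBlowup_projBase (J.comap X.isoSpec.inv)
  have : IsNoetherianRing Γ(X, ⊤) :=
    IsLocallyNoetherian.component_noetherian ⟨⊤, isAffineOpen_top X⟩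
  have h2 : IsProper (projBase (R := Γ(X, ⊤)) (C := Γ(X, ⊤)) (glob (J.comap X.isoSpec.inv))) :=
    isProper_projBase (IsNoetherian.noetherian _)
  refine ⟨_, projBase (R := Γ(X, ⊤)) (C := Γ(X, ⊤)) (glob (J.comap X.isoSpec.inv)) ≫ X.isoSpec.inv,
    ?_, h1.of_isIso_comp X.isoSpec.inv⟩
  exact MorphismProperty.comp_mem _ _ _ h2 inferInstance

/-- Blow-ups commute with restriction to opens. -/
lemma IsBlowup.of_isPullback {b : Y ⟶ X} {J : X.IdealSheafData} (h : IsBlowup b J)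
    {X' Y' : Scheme.{u}} {b' : Y' ⟶ X'} {j : X' ⟶ X} {j' : Y' ⟶ Y} [IsOpenImmersion j]
    (hp : IsPullback j' b' b j) : IsBlowup b' (J.comap j) := by
  have : IsOpenImmersion j' := MorphismProperty.of_isPullback hp.flip inferInstance
  refine ⟨?_, fun {T} f hf ↦ ?_⟩
  · rw [← Scheme.IdealSheafData.comap_comp, ← hp.w, Scheme.IdealSheafData.comap_comp]
    exact isInv_comap_of_flat h.1 j'
  · rw [← Scheme.IdealSheafData.comap_comp] at hf
    obtain ⟨g, hg, hu⟩ := h.2 _ hf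
    refine ⟨hp.lift g f hg, hp.lift_snd _ _ _, fun g' hg' ↦ hp.hom_ext ?_ ?_⟩
    · rw [hp.lift_fst]
      refine hu _ ?_
      have hg'' : g' ≫ b' = f := hg'
      change (g' ≫ j') ≫ b = _
      rw [Category.assoc, hp.w, reassoc_of% hg'']
    · rw [hp.lift_snd]; exact hg'

lemma IsBlowup.isPullback_of_comp {b : Y ⟶ X} {J : X.IdealSheafData} (h : IsBlowup b J)
    {X' Y' : Scheme.{u}} {b' : Y' ⟶ X'} {j : X' ⟶ X} [IsOpenImmersion j]
    (h' : IsBlowup b' (J.comap j)) {j' : Y' ⟶ Y} (hj' : j' ≫ b = b' ≫ j) :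
    IsPullback j' b' b j := by
  have h1 := h.of_isPullback (IsPullback.of_hasPullback b j)
  obtain ⟨α, hα, -⟩ := h1.2 b' h'.1
  obtain ⟨β, hβ, -⟩ := h'.2 (pullback.snd b j) h1.1
  have hα : α ≫ pullback.snd b j = b' := hα
  have hβ : β ≫ b' = pullback.snd b j := hβ
  have e1 : α ≫ β = 𝟙 _ :=
    (h'.2 b' h'.1).unique (y₁ := α ≫ β) (y₂ := 𝟙 _) (by rw [Category.assoc, hβ, hα]) (by simp)
  have e2 : β ≫ α = 𝟙 _ :=
    (h1.2 _ h1.1).unique (y₁ := β ≫ α) (y₂ := 𝟙 _) (by rw [Category.assoc, hα, hβ]) (by simp)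
  have e3 : α ≫ pullback.fst b j = j' := by
    refine (h.2 (b' ≫ j) ?_).unique ?_ hj'
    · rw [Scheme.IdealSheafData.comap_comp]; exact h'.1
    · rw [Category.assoc, pullback.condition, reassoc_of% hα]
  exact IsPullback.of_iso_pullback ⟨hj'⟩ ⟨α, β, e1, e2⟩ e3 hα

lemma IsBlowup.existsUnique_map {J : X.IdealSheafData} {A : X.affineOpens → Scheme.{u}}
    {b : ∀ U : X.affineOpens, A U ⟶ U.1} (hb : ∀ U : X.affineOpens, IsBlowup (b U) (J.comap U.1.ι))
    {U V : X.affineOpens} (h : U ≤ V) : ∃! g : A U ⟶ A V, g ≫ b V = b U ≫ X.homOfLE h := by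
  refine (hb V).2 _ ?_
  rw [← Scheme.IdealSheafData.comap_comp, Category.assoc, Scheme.homOfLE_ι,
    Scheme.IdealSheafData.comap_comp]
  exact (hb U).1

/-- The gluing data for blow-ups on affine opens. -/
noncomputable def blowupGluing {J : X.IdealSheafData} {A : X.affineOpens → Scheme.{u}}
    {b : ∀ U : X.affineOpens, A U ⟶ U.1} (hb : ∀ U : X.affineOpens, IsBlowup (b U) (J.comap U.1.ι)) :
    X.directedAffineCover.RelativeGluingData where
  functor :=
    { obj := A
      map := fun {U V} h ↦ (IsBlowup.existsUnique_map hb (leOfHom h)).choose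
      map_id := fun U ↦ (IsBlowup.existsUnique_map hb (le_refl U)).unique
        (IsBlowup.existsUnique_map hb (le_refl U)).choose_spec.1
        (by simp only [Category.id_comp]; exact ((congrArg _ (X.homOfLE_rfl U.1)).trans
          (Category.comp_id _)).symm)
      map_comp := fun {U V W} h h' ↦
        (IsBlowup.existsUnique_map hb (leOfHom (h ≫ h'))).unique
        (IsBlowup.existsUnique_map hb (leOfHom (h ≫ h'))).choose_spec.1 (by
          have e1 := (IsBlowup.existsUnique_map hb (leOfHom h)).choose_spec.1
          have e2 := (IsBlowup.existsUnique_map hb (leOfHom h')).choose_spec.1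
          dsimp only at e1 e2
          rw [Category.assoc, e2, reassoc_of% e1, Scheme.homOfLE_homOfLE]) }
  natTrans :=
    { app := b
      naturality := fun {U V} h ↦ (IsBlowup.existsUnique_map hb (leOfHom h)).choose_spec.1 }
  equifibered := fun {U V} h ↦ by
    have e1 := (IsBlowup.existsUnique_map hb (leOfHom h)).choose_spec.1
    refine IsBlowup.isPullback_of_comp (j := X.homOfLE (leOfHom h)) (hb V) ?_ e1
    rw [← Scheme.IdealSheafData.comap_comp, Scheme.homOfLE_ι]
    exact hb U

lemma exists_isPullback_blowup {J : X.IdealSheafData} {A : X.affineOpens → Scheme.{u}}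
    {b : ∀ U : X.affineOpens, A U ⟶ U.1} (hb : ∀ U : X.affineOpens, IsBlowup (b U) (J.comap U.1.ι)) :
    ∃ (Y : Scheme.{u}) (β : Y ⟶ X) (i : ∀ U, A U ⟶ Y),
      ∀ U, IsPullback (i U) (b U) β U.1.ι := by
  have : Small.{u} X.directedAffineCover.I₀ := inferInstanceAs (Small.{u} X.affineOpens)
  exact ⟨_, (blowupGluing hb).toBase, fun U ↦ colimit.ι (blowupGluing hb).functor U,
    fun U ↦ ((blowupGluing hb).isPullback_natTrans_ι_toBase U).flip⟩

/-- Blow-ups exist. -/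
theorem exists_isBlowup [IsLocallyNoetherian X] (J : X.IdealSheafData) :
    ∃ (Y : Scheme.{u}) (b : Y ⟶ X), IsProper b ∧ IsBlowup b J := by
  have H (U : X.affineOpens) : ∃ (A : Scheme.{u}) (b : A ⟶ U.1), IsProper b ∧
      IsBlowup b (J.comap U.1.ι) := by
    have : IsAffine U.1 := U.2
    exact exists_isBlowup_of_isAffine _
  choose A b hp hb using H
  obtain ⟨Y, β, i, hi⟩ := exists_isPullback_blowup hb
  have hio (U) : IsOpenImmersion (i U) := MorphismProperty.of_isPullback (hi U).flip inferInstance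
  have hcov (y : Y) : ∃ U : X.affineOpens, y ∈ (i U).opensRange := by
    obtain ⟨U, hU, hy, -⟩ := exists_isAffineOpen_mem_and_subset (U := ⊤) (x := β y) trivial
    refine ⟨⟨U, hU⟩, ?_⟩
    obtain ⟨z, hz, -⟩ := Scheme.exists_preimage_of_isPullback (hi ⟨U, hU⟩) y ⟨β y, hy⟩ rfl
    exact ⟨z, hz⟩
  refine ⟨Y, β, ?_, isInv_of_comap_openImmersion fun y ↦ ?_, fun {T} f hf ↦ ?_⟩
  · refine IsZariskiLocalAtTarget.of_openCover X.directedAffineCover fun U ↦ ?_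
    have := (hi U).isoPullback_hom_snd
    have h2 : IsProper ((hi U).isoPullback.inv ≫ b U) := by
      have := hp U
      infer_instance
    rwa [IsPullback.isoPullback_inv_snd] at h2
  · obtain ⟨U, z, hz⟩ := hcov y
    refine ⟨A U, i U, hio U, z, hz, ?_⟩
    rw [← Scheme.IdealSheafData.comap_comp, (hi U).w, Scheme.IdealSheafData.comap_comp]
    exact (hb U).1
  · refine existsUnique_lift_of_local _ (fun {T} f ↦ IsInv (J.comap f)) (fun f j _ h ↦ ?_)
      (fun {T} f hf t ↦ ?_) f hf
    · rw [Scheme.IdealSheafData.comap_comp]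
      exact isInv_comap_of_flat h j
    · obtain ⟨U, hU, hy, -⟩ := exists_isAffineOpen_mem_and_subset (U := ⊤) (x := f t) trivial
      refine ⟨_, (f ⁻¹ᵁ U).ι, inferInstance, by simpa using hy, ?_⟩
      obtain ⟨g, hg, hu⟩ := (hb ⟨U, hU⟩).2 (f ∣_ U) (by
        rw [← Scheme.IdealSheafData.comap_comp, morphismRestrict_ι,
          Scheme.IdealSheafData.comap_comp]
        exact isInv_comap_of_flat hf _)
      have hg : g ≫ b ⟨U, hU⟩ = f ∣_ U := hg
      refine ⟨g ≫ i ⟨U, hU⟩, ?_, fun g' hg' ↦ ?_⟩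
      · change (g ≫ i ⟨U, hU⟩) ≫ β = _
        rw [Category.assoc, (hi ⟨U, hU⟩).w, reassoc_of% hg, morphismRestrict_ι]
      · have hg' : g' ≫ β = (f ⁻¹ᵁ U).ι ≫ f := hg'
        rw [← morphismRestrict_ι] at hg'
        rw [← (hi ⟨U, hU⟩).lift_fst _ _ hg']
        congr 1
        exact hu _ ((hi ⟨U, hU⟩).lift_snd _ _ hg')

lemma comap_map_eq (j : X ⟶ Y) [IsOpenImmersion j] [QuasiCompact j] (J : X.IdealSheafData) :
    (J.map j).comap j = J := by
  refine le_antisymm (Scheme.IdealSheafData.comap_map_le J j) ?_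
  refine Scheme.IdealSheafData.le_def.mpr fun D ↦ ?_
  have hD : j ⁻¹ᵁ (j ''ᵁ D.1) = D.1 := j.preimage_image_eq D.1
  have hD' : IsAffineOpen (j ⁻¹ᵁ (j ''ᵁ D.1)) := by rw [hD]; exact D.2
  rw [Scheme.IdealSheafData.ideal_comap_of_isOpenImmersion,
    Scheme.IdealSheafData.ideal_map _ _ _ hD']
  intro a ha
  rw [Ideal.mem_comap, Ideal.mem_comap]
  have hle : (⟨_, hD'⟩ : X.affineOpens) ≤ D := hD.le
  have key : (j.app (j ''ᵁ D.1)).hom ((j.appIso D.1).inv.hom a) = res hle a := by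
    have := congr($(j.appIso_inv_app D.1) a)
    exact this
  have h2 : res hle a ∈ J.ideal ⟨_, hD'⟩ := by
    have h3 : (J.ideal D).map (X.presheaf.map (homOfLE hle).op).hom = _ := J.map_ideal hle
    rw [← h3]
    exact Ideal.mem_map_of_mem _ ha
  exact key ▸ h2

lemma comap_eq_top {J : Y.IdealSheafData} (f : X ⟶ Y) (h : ∀ x, f x ∉ J.support) :
    J.comap f = ⊤ := by
  rw [← Scheme.IdealSheafData.support_eq_bot_iff, Scheme.IdealSheafData.support_comap]
  exact SetLike.ext fun x ↦ ⟨fun hx ↦ (h x hx).elim, fun hx ↦ hx.elim⟩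

lemma notMem_support_map {J : X.IdealSheafData} {j : X ⟶ Y} [QuasiCompact j] {u : Z ⟶ Y}
    [IsOpenImmersion u] (h : ∀ x ∈ J.support, j x ∉ Set.range u) (z : Z) :
    u z ∉ (J.map j).support := by
  rw [Scheme.IdealSheafData.support_map]
  change u z ∉ closure (j '' J.support)
  intro hz
  obtain ⟨_, h1, x, hx, rfl⟩ := mem_closure_iff.mp hz u.opensRange u.opensRange.isOpen ⟨z, rfl⟩
  exact h x hx h1

lemma isBlowup_id : IsBlowup (𝟙 X) ⊤ := by
  refine ⟨?_, fun f _ ↦ ⟨f, Category.comp_id f, fun g hg ↦ (Category.comp_id g).symm.trans hg⟩⟩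
  rw [Scheme.IdealSheafData.comap_top]
  exact IsInv.top

lemma IsBlowup.exists_lift_openImmersion {b : Y ⟶ X} {J : X.IdealSheafData} (h : IsBlowup b J)
    (u : Z ⟶ X) [IsOpenImmersion u] (hu : J.comap u = ⊤) :
    ∃ u' : Z ⟶ Y, IsOpenImmersion u' ∧ u' ≫ b = u := by
  obtain ⟨u', hu', -⟩ := h.2 u (hu ▸ IsInv.top)
  have hu' : u' ≫ b = u := hu'
  have h1 : IsPullback u' (𝟙 Z) b u :=
    h.isPullback_of_comp (hu ▸ isBlowup_id) (hu'.trans (Category.id_comp u).symm)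
  exact ⟨u', MorphismProperty.of_isPullback h1.flip inferInstance, hu'⟩

lemma exists_admissible_blowup [IsLocallyNoetherian X] (j : Y ⟶ X) [IsOpenImmersion j]
    [QuasiCompact j] (u : Z ⟶ X) [IsOpenImmersion u] (I : Y.IdealSheafData)
    (h : ∀ x ∈ I.support, j x ∉ Set.range u) :
    ∃ (X' Y' : Scheme.{u}) (β : X' ⟶ X) (j' : Y' ⟶ X') (β' : Y' ⟶ Y) (u' : Z ⟶ X'),
      IsProper β ∧ IsOpenImmersion u' ∧ u' ≫ β = u ∧ IsPullback j' β' β j ∧ IsBlowup β' I := by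
  obtain ⟨X', β, hβ, hb⟩ := exists_isBlowup (I.map j)
  obtain ⟨u', hu', e⟩ := hb.exists_lift_openImmersion u
    (comap_eq_top u (notMem_support_map h))
  have hp := IsPullback.of_hasPullback β j
  refine ⟨X', _, β, pullback.fst β j, pullback.snd β j, u', hβ, hu', e, hp, ?_⟩
  have := hb.of_isPullback hp
  rwa [comap_map_eq] at this

section points

lemma exists_valuativeCommSq (f : X ⟶ Y) {x : X} {y : Y} (h : f x ⤳ y) :
    ∃ q : ValuativeCommSq f, q.i₂ (closedPoint q.R) = y := by
  let ψ : Y.presheaf.stalk y ⟶ X.residueField x :=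
    Y.presheaf.stalkSpecializes h ≫ f.stalkMap x ≫ X.residue x
  obtain ⟨A, hA, hA_local⟩ := exists_factor_valuationRing ψ.hom
  let φ : Y.presheaf.stalk y ⟶ .of A := CommRingCat.ofHom (ψ.hom.codRestrict _ hA)
  have w : X.fromSpecResidueField x ≫ f =
      Spec.map (CommRingCat.ofHom (algebraMap A (X.residueField x))) ≫
        Spec.map φ ≫ Y.fromSpecStalk y := by
    rw [Scheme.fromSpecResidueField, Category.assoc, ← Scheme.SpecMap_stalkMap_fromSpecStalk,
      ← Scheme.SpecMap_stalkSpecializes_fromSpecStalk h]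
    simp_rw [← Spec.map_comp_assoc]
    rfl
  refine ⟨{ R := A, K := X.residueField x, commSq := ⟨w⟩, .. }, ?_⟩
  change (Spec.map φ ≫ Y.fromSpecStalk y) (closedPoint A) = y
  have : Spec.map φ (closedPoint A) = closedPoint (Y.presheaf.stalk y) :=
    comap_closedPoint (S := A) (ψ.hom.codRestrict A.toSubring hA)
  exact (Scheme.Hom.comp_apply _ _ _).trans
    ((congrArg _ this).trans (Y.fromSpecStalk_closedPoint))

lemma exists_specializes_of_mem_closure [NoetherianSpace X] (f : X ⟶ Y) {y : Y}
    (hy : y ∈ closure (Set.range f)) : ∃ x : X, f x ⤳ y := by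
  obtain ⟨S, hS, hc, hi, e⟩ := NoetherianSpace.exists_finite_set_isClosed_irreducible
    (isClosed_univ (X := X))
  rw [← Set.image_univ, e, Set.sUnion_eq_biUnion, Set.image_iUnion₂, hS.closure_biUnion] at hy
  obtain ⟨t, ht, hy⟩ := Set.mem_iUnion₂.mp hy
  obtain ⟨x, hx⟩ := QuasiSober.sober (hi t ht) (hc t ht)
  refine ⟨x, specializes_iff_mem_closure.mpr (closure_minimal ?_ isClosed_closure hy)⟩
  rintro _ ⟨x', hx', rfl⟩
  exact ((specializes_iff_mem_closure.mpr (hx.symm ▸ hx')).map f.continuous).mem_closure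

lemma exists_valuativeCommSq_of_mem_closure [NoetherianSpace X] (f : X ⟶ Y) {y : Y}
    (hy : y ∈ closure (Set.range f)) :
    ∃ q : ValuativeCommSq f, q.i₂ (closedPoint q.R) = y :=
  exists_valuativeCommSq f (exists_specializes_of_mem_closure f hy).choose_spec

end points

section pull

variable {R : Type u} [CommRing R]

/-- The ideal generated by the pullback of an ideal sheaf along a morphism from an affine scheme. -/
noncomputable def pull (g : Spec (.of R) ⟶ X) (I : X.IdealSheafData) : Ideal R :=
  glob (R := .of R) (I.comap g)

variable (g : Spec (.of R) ⟶ X)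

lemma pull_sup (I J : X.IdealSheafData) : pull g (I ⊔ J) = pull g I ⊔ pull g J := by
  unfold pull
  rw [Scheme.IdealSheafData.comap_sup]
  exact glob_sup _ _

lemma pull_mul (I J : X.IdealSheafData) : pull g (I * J) = pull g I * pull g J := by
  unfold pull
  rw [comap_mul]
  exact glob_mul _ _

lemma pull_mono {I J : X.IdealSheafData} (h : I ≤ J) : pull g I ≤ pull g J :=
  glob_mono (Scheme.IdealSheafData.comap_mono _ h)

lemma pull_comp (f : X ⟶ Y) (J : Y.IdealSheafData) : pull (g ≫ f) J = pull g (J.comap f) := by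
  unfold pull
  rw [Scheme.IdealSheafData.comap_comp]

lemma pull_map {C : Type u} [CommRing C] (φ : R →+* C) (I : X.IdealSheafData) :
    pull (Spec.map (CommRingCat.ofHom φ) ≫ g) I = (pull g I).map φ := by
  unfold pull
  rw [Scheme.IdealSheafData.comap_comp, glob_comap_map]
  rfl

lemma pull_eq_top {I : X.IdealSheafData} (h : ∀ x, g x ∉ I.support) : pull g I = ⊤ := by
  unfold pull
  rw [comap_eq_top g h]
  exact glob_top

lemma pull_top : pull g ⊤ = ⊤ :=
  pull_eq_top g fun _ h ↦ h

lemma pull_specMap_fromSpec (D : X.affineOpens) (φ : Γ(X, D.1) →+* R) (I : X.IdealSheafData) :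
    pull (Spec.map (CommRingCat.ofHom φ) ≫ D.2.fromSpec) I = (I.ideal D).map φ := by
  unfold pull
  rw [Scheme.IdealSheafData.comap_comp, glob_comap_map, glob_comap_fromSpec]
  rfl

lemma notMem_support_of_pull_eq_top {I : X.IdealSheafData} (h : pull g I = ⊤) (x) :
    g x ∉ I.support := by
  have : I.comap g = ⊤ := glob_injective (h.trans (glob_top (R := .of R)).symm)
  rw [← Scheme.IdealSheafData.support_eq_bot_iff, Scheme.IdealSheafData.support_comap] at this
  exact fun hx ↦ (SetLike.ext_iff.mp this x).mp hx

lemma pull_eq_top_iff [IsLocalRing R] {I : X.IdealSheafData} :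
    pull g I = ⊤ ↔ g (closedPoint R) ∉ I.support := by
  refine ⟨fun h ↦ notMem_support_of_pull_eq_top g h _, fun h ↦ pull_eq_top g fun x hx ↦ h ?_⟩
  exact ((specializes_closedPoint x).map g.continuous).mem_closed I.support.isClosed hx

lemma pull_eq_bot_iff [IsDomain R] {K : Type u} [Field K] [Algebra R K] [IsFractionRing R K]
    {i : Spec (.of K) ⟶ X} (hi : i = Spec.map (CommRingCat.ofHom (algebraMap R K)) ≫ g)
    {I : X.IdealSheafData} : pull g I = ⊥ ↔ i (closedPoint K) ∈ I.support := by
  rw [← not_iff_not, ← pull_eq_top_iff, hi, pull_map]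
  constructor
  · intro h
    refine (Ideal.eq_bot_or_top _).resolve_left fun h' ↦ h ?_
    rwa [Ideal.map_eq_bot_iff_of_injective (IsFractionRing.injective R K)] at h'
  · intro h h'
    rw [h', Ideal.map_bot] at h
    exact bot_ne_top h

lemma range_subset_of_closedPoint_mem [IsLocalRing R] {U : X.Opens}
    (h : g (closedPoint R) ∈ U) : Set.range g ⊆ U := by
  rintro _ ⟨x, rfl⟩
  exact ((specializes_closedPoint x).map g.continuous).mem_open U.isOpen h

lemma exists_factor [IsLocalRing R] (D : X.affineOpens) (h : g (closedPoint R) ∈ D.1) :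
    ∃ φ : Γ(X, D.1) →+* R, g = Spec.map (CommRingCat.ofHom φ) ≫ D.2.fromSpec := by
  have hr := range_subset_of_closedPoint_mem g h
  rw [← D.2.range_fromSpec] at hr
  have := D.2.isOpenImmersion_fromSpec
  refine ⟨(Spec.preimage (IsOpenImmersion.lift D.2.fromSpec g hr)).hom, ?_⟩
  rw [CommRingCat.ofHom_hom, Spec.map_preimage, IsOpenImmersion.lift_fac]

/-- The locus where two ideal sheaves agree. -/
def eqLocus (I J : X.IdealSheafData) : X.Opens :=
  ⨆ D : { D : X.affineOpens // I.ideal D = J.ideal D }, D.1.1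

lemma mem_eqLocus {I J : X.IdealSheafData} {x : X} :
    x ∈ eqLocus I J ↔ ∃ D : X.affineOpens, x ∈ D.1 ∧ I.ideal D = J.ideal D := by
  rw [eqLocus, Opens.mem_iSup]
  exact ⟨fun ⟨D, h⟩ ↦ ⟨D.1, h, D.2⟩, fun ⟨D, h, h'⟩ ↦ ⟨⟨D, h'⟩, h⟩⟩

lemma mem_eqLocus_of_notMem_support {I J : X.IdealSheafData} {x : X} (h : x ∉ I.support)
    (h' : x ∉ J.support) : x ∈ eqLocus I J := by
  obtain ⟨U, hU, hy, hD⟩ := exists_isAffineOpen_mem_and_subset (U := away I ⊓ away J) ⟨h, h'⟩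
  refine mem_eqLocus.mpr ⟨⟨U, hU⟩, hy, ?_⟩
  have key {L : X.IdealSheafData} (hL : U ≤ away L) : L.ideal ⟨U, hU⟩ = ⊤ := by
    rw [← glob_comap_fromSpec, comap_eq_top, glob_top]
    intro x
    refine hL ?_
    change _ ∈ (U : Set X)
    rw [← hU.range_fromSpec]
    exact ⟨x, rfl⟩
  rw [key fun x hx ↦ (hD hx).1, key fun x hx ↦ (hD hx).2]

lemma mem_support_iff_of_mem_eqLocus {I J : X.IdealSheafData} {x : X} (h : x ∈ eqLocus I J) :
    x ∈ I.support ↔ x ∈ J.support := by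
  obtain ⟨D, hx, e⟩ := mem_eqLocus.mp h
  rw [Scheme.IdealSheafData.mem_support_iff_of_mem hx,
    Scheme.IdealSheafData.mem_support_iff_of_mem hx, e]

lemma IsInv.pull_le_of_notMem_eqLocus [IsLocalRing R] {I J : X.IdealSheafData} (hJ : IsInv J)
    (hle : I ≤ J) (h : g (closedPoint R) ∉ eqLocus I J) :
    pull g I ≤ maximalIdeal R * pull g J := by
  obtain ⟨D, hD, s, hs, e⟩ := hJ (g (closedPoint R))
  obtain ⟨φ, hφ⟩ := exists_factor g D hD
  have h1 : pull g I = (I.ideal D).map φ := by rw [hφ, pull_specMap_fromSpec]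
  have h2 : pull g J = (J.ideal D).map φ := by rw [hφ, pull_specMap_fromSpec]
  rw [h1, h2, e, Ideal.map_le_iff_le_comap]
  intro a ha
  have haJ := hle D ha
  rw [e, Ideal.mem_span_singleton] at haJ
  obtain ⟨c, rfl⟩ := haJ
  rw [Ideal.mem_comap, map_mul, mul_comm (φ s)]
  refine Ideal.mul_mem_mul ?_ (Ideal.mem_map_of_mem _ (Ideal.mem_span_singleton_self s))
  by_contra hc
  refine h (mem_eqLocus.mpr ⟨X.affineBasicOpen c, ?_, ?_⟩)
  · have : IsUnit (φ c) := by simpa using hc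
    change g (closedPoint R) ∈ X.basicOpen c
    have h3 : closedPoint R ∈ g ⁻¹ᵁ X.basicOpen c := by
      rw [hφ, Scheme.Hom.comp_preimage, D.2.fromSpec_preimage_basicOpen]
      change φ c ∉ maximalIdeal R
      simpa using hc
    exact h3
  · refine le_antisymm (hle _) ?_
    rw [ideal_res (X.affineBasicOpen_le c) e, Ideal.span_singleton_le_iff_mem]
    have h4 : res (X.affineBasicOpen_le c) (s * c) ∈ I.ideal (X.affineBasicOpen c) := by
      have h3 : (I.ideal D).map _ = _ := I.map_ideal (X.affineBasicOpen_le c)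
      rw [← h3]
      exact Ideal.mem_map_of_mem _ ha
    have hu : IsUnit (res (X.affineBasicOpen_le c) c) :=
      RingedSpace.isUnit_res_basicOpen _ c
    rw [map_mul] at h4
    exact (Ideal.mul_unit_mem_iff_mem _ hu).mp h4

end pull

section conn

/-- The closed point of the spectrum of a local ring, as a point of the scheme. -/
def cp (R : Type u) [CommRing R] [IsLocalRing R] : Spec (.of R) := closedPoint R

lemma specializes_cp {R : Type u} [CommRing R] [IsLocalRing R] (x : Spec (.of R)) : x ⤳ cp R :=
  specializes_closedPoint x

variable {S P Q W : Scheme.{u}}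

/-- Two points `x` and `y` are connected if they are simultaneous specializations of a point of `W`
along a valuation ring. -/
def Conn (p : P ⟶ S) (q : Q ⟶ S) (f : W ⟶ P) (g : W ⟶ Q) (x : P) (y : Q) : Prop :=
  ∃ (R : Type u) (_ : CommRing R) (_ : IsDomain R) (_ : ValuationRing R) (K : Type u) (_ : Field K)
    (_ : Algebra R K) (_ : IsFractionRing R K) (i : Spec (.of K) ⟶ W) (a : Spec (.of R) ⟶ P)
    (b : Spec (.of R) ⟶ Q), i ≫ f = Spec.map (CommRingCat.ofHom (algebraMap R K)) ≫ a ∧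
      i ≫ g = Spec.map (CommRingCat.ofHom (algebraMap R K)) ≫ b ∧ a ≫ p = b ≫ q ∧
      a (cp R) = x ∧ b (cp R) = y

variable {p : P ⟶ S} {q : Q ⟶ S} {f : W ⟶ P} {g : W ⟶ Q} {x : P} {y : Q}

lemma Conn.symm (h : Conn p q f g x y) : Conn q p g f y x := by
  obtain ⟨R, _, _, _, K, _, _, _, i, a, b, h1, h2, h3, h4, h5⟩ := h
  exact ⟨R, ‹_›, ‹_›, ‹_›, K, ‹_›, ‹_›, ‹_›, i, b, a, h2, h1, h3.symm, h5, h4⟩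

lemma Conn.map {P' Q' : Scheme.{u}} {p' : P' ⟶ S} {q' : Q' ⟶ S} (h : Conn p q f g x y)
    (β : P ⟶ P') (γ : Q ⟶ Q') (hβ : β ≫ p' = p) (hγ : γ ≫ q' = q) {f' : W ⟶ P'} {g' : W ⟶ Q'}
    (hf : f ≫ β = f') (hg : g ≫ γ = g') : Conn p' q' f' g' (β x) (γ y) := by
  subst hβ hγ hf hg
  obtain ⟨R, _, _, _, K, _, _, _, i, a, b, h1, h2, h3, rfl, rfl⟩ := h
  refine ⟨R, ‹_›, ‹_›, ‹_›, K, ‹_›, ‹_›, ‹_›, i, a ≫ β, b ≫ γ, ?_, ?_, ?_, ?_, ?_⟩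
  · rw [reassoc_of% h1]
  · rw [reassoc_of% h2]
  · simpa using h3
  · rw [Scheme.Hom.comp_apply]
  · rw [Scheme.Hom.comp_apply]

lemma conn_iff [NoetherianSpace W] (h : f ≫ p = g ≫ q) :
    Conn p q f g x y ↔ ∃ z ∈ closure (Set.range (pullback.lift f g h)),
      pullback.fst p q z = x ∧ pullback.snd p q z = y := by
  constructor
  · rintro ⟨R, _, _, _, K, _, _, _, i, a, b, h1, h2, h3, rfl, rfl⟩
    have e : i ≫ pullback.lift f g h = Spec.map (CommRingCat.ofHom (algebraMap R K)) ≫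
        pullback.lift a b h3 := by
      apply pullback.hom_ext <;> simpa only [Category.assoc, pullback.lift_fst, pullback.lift_snd]
    refine ⟨pullback.lift a b h3 (cp R), ?_, ?_, ?_⟩
    · refine (specializes_cp (R := R) (Spec.map (CommRingCat.ofHom (algebraMap R K)) (cp K))).map (pullback.lift a b h3).continuous |>.mem_closed isClosed_closure
        (subset_closure ⟨i (cp K), ?_⟩)
      have := congr($e (cp K))
      rwa [Scheme.Hom.comp_apply, Scheme.Hom.comp_apply] at this
    · rw [← Scheme.Hom.comp_apply, pullback.lift_fst]
    · rw [← Scheme.Hom.comp_apply, pullback.lift_snd]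
  · rintro ⟨z, hz, rfl, rfl⟩
    obtain ⟨c, hc⟩ := exists_valuativeCommSq_of_mem_closure _ hz
    obtain ⟨R, K, i₁, i₂, ⟨w⟩⟩ := c
    refine ⟨R, ‹_›, ‹_›, ‹_›, K, ‹_›, ‹_›, ‹_›, i₁, i₂ ≫ pullback.fst p q,
      i₂ ≫ pullback.snd p q, ?_, ?_, ?_, ?_, ?_⟩
    · rw [← reassoc_of% w, pullback.lift_fst]
    · rw [← reassoc_of% w, pullback.lift_snd]
    · simp [pullback.condition]
    · rw [Scheme.Hom.comp_apply]; exact congrArg _ hc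
    · rw [Scheme.Hom.comp_apply]; exact congrArg _ hc

lemma isClosed_conn [NoetherianSpace W] (h : f ≫ p = g ≫ q) [UniversallyClosed q] {T : Set Q}
    (hT : IsClosed T) : IsClosed { x | ∃ y ∈ T, Conn p q f g x y } := by
  have : { x | ∃ y ∈ T, Conn p q f g x y } =
      pullback.fst p q '' (closure (Set.range (pullback.lift f g h)) ∩ pullback.snd p q ⁻¹' T) := by
    ext x
    simp only [Set.mem_ofPred_eq, conn_iff h, Set.mem_image, Set.mem_inter_iff, Set.mem_preimage]
    constructor
    · rintro ⟨y, hy, z, hz, h1, rfl⟩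
      exact ⟨z, ⟨hz, hy⟩, h1⟩
    · rintro ⟨z, ⟨hz, hy⟩, h1⟩
      exact ⟨_, hy, z, hz, h1, rfl⟩
  rw [this]
  exact (pullback.fst p q).isClosedMap _
    (isClosed_closure.inter (hT.preimage (pullback.snd p q).continuous))

/-- A morphism from the spectrum of a valuation ring is determined by its generic point. -/
lemma ext_of_valuationRing {R K : Type u} [CommRing R] [IsDomain R] [ValuationRing R] [Field K]
    [Algebra R K] [IsFractionRing R K] (q : Q ⟶ S) [IsSeparated q] {b b' : Spec (.of R) ⟶ Q}
    (h : b ≫ q = b' ≫ q) (h' : Spec.map (CommRingCat.ofHom (algebraMap R K)) ≫ b =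
      Spec.map (CommRingCat.ofHom (algebraMap R K)) ≫ b') : b = b' := by
  let c : ValuativeCommSq q := { R := R, K := K, commSq := ⟨show _ = _ ≫ b ≫ q by
    rw [← Category.assoc]⟩, .. }
  have := IsSeparated.valuativeCriterion (f := q) c
  have := Subsingleton.elim (α := c.commSq.LiftStruct) ⟨b, rfl, rfl⟩ ⟨b', h'.symm, h.symm⟩
  exact congr($(this).l)

lemma exists_lift_of_valuationRing {R K : Type u} [CommRing R] [IsDomain R] [ValuationRing R]
    [Field K] [Algebra R K] [IsFractionRing R K] (q : Q ⟶ S) [UniversallyClosed q]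
    (i : Spec (.of K) ⟶ Q) (b : Spec (.of R) ⟶ S)
    (h : i ≫ q = Spec.map (CommRingCat.ofHom (algebraMap R K)) ≫ b) :
    ∃ c : Spec (.of R) ⟶ Q, Spec.map (CommRingCat.ofHom (algebraMap R K)) ≫ c = i ∧ c ≫ q = b := by
  have : ValuativeCriterion.Existence q := by
    have : (ValuativeCriterion.Existence ⊓ @QuasiCompact) q := by
      rw [← UniversallyClosed.eq_valuativeCriterion]
      infer_instance
    exact this.1
  obtain ⟨⟨l, h1, h2⟩⟩ := this { R := R, K := K, commSq := ⟨h⟩, .. }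
  exact ⟨l, h1, h2⟩

/-- Points connected to a point of an open subscheme on which the correspondence is a graph. -/
lemma Conn.eq_of_graph [IsSeparated q] {G : Scheme.{u}} (j : G ⟶ P) [IsOpenImmersion j] (r : G ⟶ Q)
    (hr : r ≫ q = j ≫ p) {t : W ⟶ G} (htf : t ≫ j = f) (htg : t ≫ r = g) {z : G}
    (h : Conn p q f g (j z) y) : r z = y := by
  obtain ⟨R, _, _, _, K, _, _, _, i, a, b, h1, h2, h3, h4, rfl⟩ := h
  have ha : Set.range a ⊆ Set.range j :=
    range_subset_of_closedPoint_mem a (U := j.opensRange) ⟨z, h4.symm⟩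
  obtain ⟨a', rfl⟩ : ∃ a' : Spec (.of R) ⟶ G, a' ≫ j = a :=
    ⟨IsOpenImmersion.lift j a ha, IsOpenImmersion.lift_fac ..⟩
  have hz : a' (cp R) = z := by
    apply j.isOpenEmbedding.injective
    rwa [Scheme.Hom.comp_apply] at h4
  have : a' ≫ r = b := by
    refine ext_of_valuationRing q (K := K) (by rw [← h3, Category.assoc, hr, Category.assoc]) ?_
    rw [← h2, ← htg, ← Category.assoc, ← Category.assoc]
    congr 1
    rw [← cancel_mono j, Category.assoc, Category.assoc, htf, h1]
  rw [← this, ← hz, Scheme.Hom.comp_apply]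

lemma conn_of_mem_closure [NoetherianSpace W] {G : Scheme.{u}} (j : G ⟶ P) (r : G ⟶ Q)
    (hr : r ≫ q = j ≫ p) {t : W ⟶ G} (htf : t ≫ j = f) (htg : t ≫ r = g) {z : G}
    (h : z ∈ closure (Set.range t)) : Conn p q f g (j z) (r z) := by
  obtain ⟨c, rfl⟩ := exists_valuativeCommSq_of_mem_closure _ h
  obtain ⟨R, K, i₁, i₂, ⟨w⟩⟩ := c
  refine ⟨R, ‹_›, ‹_›, ‹_›, K, ‹_›, ‹_›, ‹_›, i₁, i₂ ≫ j,
      i₂ ≫ r, ?_, ?_, ?_, ?_, ?_⟩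
  · rw [← htf, reassoc_of% w]
  · rw [← htg, reassoc_of% w]
  · simp [hr]
  · rw [Scheme.Hom.comp_apply]; rfl
  · rw [Scheme.Hom.comp_apply]; rfl

end conn

lemma isNoetherian_of_finiteType (f : X ⟶ Y) [LocallyOfFiniteType f] [QuasiCompact f]
    [IsNoetherian Y] : IsNoetherian X := by
  have := LocallyOfFiniteType.isLocallyNoetherian f
  have : CompactSpace X := QuasiCompact.compactSpace_of_compactSpace f
  constructor

lemma exists_affineOpen_mem (x : X) : ∃ D : X.affineOpens, x ∈ D.1 := by
  obtain ⟨U, hU, hy, -⟩ := exists_isAffineOpen_mem_and_subset (U := (⊤ : X.Opens)) (x := x) trivial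
  exact ⟨⟨U, hU⟩, hy⟩

lemma exists_pow_le [IsNoetherian X] {I J : X.IdealSheafData} (h : J.support ≤ I.support) :
    ∃ n, n ≠ 0 ∧ I ^ n ≤ J := by
  obtain ⟨s, hs, e⟩ := isCompact_iff_finite_and_eq_biUnion_affineOpens (X := X) (U := ⊤).mp
    isCompact_univ
  have hI : I ≤ J.radical := by
    rw [← Scheme.IdealSheafData.vanishingIdeal_support]
    exact Scheme.IdealSheafData.le_support_iff_le_vanishingIdeal.mp h
  have key (D : X.affineOpens) : ∃ n, I.ideal D ^ n ≤ J.ideal D := by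
    have := IsLocallyNoetherian.component_noetherian D
    exact Ideal.exists_pow_le_of_le_radical_of_fg (hI D) (IsNoetherian.noetherian _)
  choose n hn using key
  refine ⟨hs.toFinset.sup n + 1, by simp, ?_⟩
  refine Scheme.IdealSheafData.le_of_iSup_eq_top (fun i : s ↦ i.1) ?_ fun i ↦ ?_
  · rw [iSup_subtype, e]
  · rw [Scheme.IdealSheafData.ideal_pow]
    refine (Ideal.pow_le_pow_right ?_).trans (hn i.1)
    exact (Finset.le_sup (f := n) (hs.mem_toFinset.mpr i.2)).trans (Nat.le_succ _)

section pull

variable {R : Type u} [CommRing R] (g : Spec (.of R) ⟶ X)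

lemma pull_pow (I : X.IdealSheafData) (n : ℕ) : pull g (I ^ n) = pull g I ^ n := by
  induction n with
  | zero =>
    rw [pow_zero, pow_zero, Ideal.one_eq_top]
    exact pull_top g
  | succ n ih => rw [pow_succ, pow_succ, pull_mul, ih]

lemma pull_fg [IsLocalRing R] [IsLocallyNoetherian X] (I : X.IdealSheafData) : (pull g I).FG := by
  obtain ⟨D, hD⟩ := exists_affineOpen_mem (g (closedPoint R))
  obtain ⟨φ, hφ⟩ := exists_factor g D hD
  rw [hφ, pull_specMap_fromSpec]
  have := IsLocallyNoetherian.component_noetherian D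
  exact Ideal.FG.map (IsNoetherian.noetherian _) _

end pull

lemma eq_bot_of_le_maximalIdeal_mul {R : Type*} [CommRing R] [IsLocalRing R] {I : Ideal R}
    (hI : I.FG) (h : I ≤ maximalIdeal R * I) : I = ⊥ :=
  Submodule.eq_bot_of_le_smul_of_le_jacobson_bot _ _ hI h (maximalIdeal_le_jacobson _)

lemma le_total_ideal {R : Type*} [CommRing R] [IsDomain R] [ValuationRing R] (I J : Ideal R) :
    I ≤ J ∨ J ≤ I :=
  (ValuationRing.iff_ideal_total.mp ‹_›).total I J

lemma false_of_le_maximalIdeal_mul {R : Type*} [CommRing R] [IsDomain R] [ValuationRing R]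
    {B C D : Ideal R} (hB : B.FG) (hC : C.FG) (hD : D.FG) (hB0 : B ≠ ⊥) (hC0 : C ≠ ⊥) (hD0 : D ≠ ⊥)
    (h : C ≤ maximalIdeal R * (C ⊔ D ^ 2)) (hBD : D ≤ B) (hBDC : B * D ≤ C) : False := by
  rcases le_total_ideal (D ^ 2) C with h' | h'
  · rw [sup_eq_left.mpr h'] at h
    exact hC0 (eq_bot_of_le_maximalIdeal_mul hC h)
  · rw [sup_eq_right.mpr h'] at h
    have : B * D = ⊥ := by
      refine eq_bot_of_le_maximalIdeal_mul (hB.mul hD) ((hBDC.trans h).trans ?_)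
      rw [pow_two]
      exact Ideal.mul_mono_right (Ideal.mul_mono_left hBD)
    rw [Ideal.mul_eq_bot] at this
    tauto

/-- The blow-up of `a ⊔ b ^ 2`. -/
lemma exists_blowup_locus {P U : Scheme.{u}} [IsLocallyNoetherian P] (u : U ⟶ P) [IsOpenImmersion u]
    (a b : P.IdealSheafData) (hb : ∀ x, u x ∉ b.support) :
    ∃ (P₁ : Scheme.{u}) (β : P₁ ⟶ P) (u₁ : U ⟶ P₁) (F : Set P₁), IsProper β ∧ IsOpenImmersion u₁ ∧
      u₁ ≫ β = u ∧ IsClosed F ∧ (∀ x, u₁ x ∈ F ↔ u x ∈ a.support) ∧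
      ∀ (R : Type u) [CommRing R] [IsLocalRing R] (α : Spec (.of R) ⟶ P₁), α (cp R) ∈ F →
        pull (α ≫ β) a ≤ maximalIdeal R * (pull (α ≫ β) a ⊔ pull (α ≫ β) b ^ 2) := by
  obtain ⟨P₁, β, hβ, hbl⟩ := exists_isBlowup (a ⊔ b ^ 2)
  have hsup : (a ⊔ b ^ 2).support = a.support ⊓ b.support := by
    rw [Scheme.IdealSheafData.support_sup, Scheme.IdealSheafData.support_pow _ _ two_ne_zero]
  have hn (x) : u x ∉ (a ⊔ b ^ 2).support := by
    rw [hsup]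
    exact fun h ↦ hb x h.2
  obtain ⟨u₁, hu₁, e⟩ := hbl.exists_lift_openImmersion u (comap_eq_top _ hn)
  have hs (I : P.IdealSheafData) (x) : u₁ x ∈ (I.comap β).support ↔ u x ∈ I.support := by
    rw [Scheme.IdealSheafData.support_comap, ← e, Scheme.Hom.comp_apply]
    rfl
  refine ⟨P₁, β, u₁, (eqLocus (a.comap β) ((a ⊔ b ^ 2).comap β) : Set P₁)ᶜ, hβ, hu₁, e,
    (Opens.isOpen _).isClosed_compl, fun x ↦ ?_, ?_⟩
  · rw [Set.mem_compl_iff, not_iff_comm]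
    constructor
    · intro h
      exact mem_eqLocus_of_notMem_support (fun h' ↦ h ((hs _ _).mp h'))
        (fun h' ↦ hn _ ((hs _ _).mp h'))
    · intro h h'
      exact hn x ((hs _ _).mp ((mem_support_iff_of_mem_eqLocus h).mp ((hs _ _).mpr h')))
  · intro R _ _ α hα
    have := IsInv.pull_le_of_notMem_eqLocus α hbl.1
      (Scheme.IdealSheafData.comap_mono (f := β) le_sup_left) hα
    rwa [← pull_comp, ← pull_comp, pull_sup, pull_pow] at this

section separate

variable {S P Q U V W : Scheme.{u}}

/-- The ideal sheaf of the complement of an open immersion. -/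
noncomputable def complIdeal (u : U ⟶ P) [IsOpenImmersion u] : P.IdealSheafData :=
  Scheme.IdealSheafData.vanishingIdeal u.opensRange.compl

lemma mem_support_complIdeal (u : U ⟶ P) [IsOpenImmersion u] {x : P} :
    x ∈ (complIdeal u).support ↔ x ∉ Set.range u := by
  rw [← SetLike.mem_coe, complIdeal, Scheme.IdealSheafData.coe_support_vanishingIdeal]
  rfl

lemma mem_range_comp_iff (w : W ⟶ U) (u : U ⟶ P) [IsOpenImmersion u] (x : U) :
    u x ∈ Set.range (w ≫ u) ↔ x ∈ Set.range w := by
  constructor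
  · rintro ⟨y, hy⟩
    rw [Scheme.Hom.comp_apply] at hy
    exact ⟨y, u.isOpenEmbedding.injective hy⟩
  · rintro ⟨y, rfl⟩
    exact ⟨y, Scheme.Hom.comp_apply ..⟩

lemma exists_separate [IsNoetherian S] (p : P ⟶ S) (q : Q ⟶ S) [IsProper p] [IsProper q]
    (u : U ⟶ P) (v : V ⟶ Q) (wU : W ⟶ U) (wV : W ⟶ V) [IsOpenImmersion u] [IsOpenImmersion v]
    [IsOpenImmersion wU] [IsOpenImmersion wV] (h : (wU ≫ u) ≫ p = (wV ≫ v) ≫ q)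
    (hW : ∀ a b, Conn p q (wU ≫ u) (wV ≫ v) (u a) (v b) → a ∈ Set.range wU ∧ b ∈ Set.range wV) :
    ∃ (P₁ Q₁ : Scheme.{u}) (β : P₁ ⟶ P) (γ : Q₁ ⟶ Q) (u₁ : U ⟶ P₁) (v₁ : V ⟶ Q₁)
      (F : Set P₁) (T : Set Q₁), IsProper β ∧ IsProper γ ∧ IsOpenImmersion u₁ ∧ IsOpenImmersion v₁ ∧
      u₁ ≫ β = u ∧ v₁ ≫ γ = v ∧ IsClosed F ∧ IsClosed T ∧ (∀ a, u₁ a ∈ F ↔ a ∉ Set.range wU) ∧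
      (∀ b, v₁ b ∈ T ↔ b ∉ Set.range wV) ∧
      ∀ x y, (x ∈ F ∧ y ∈ T ∨ x ∈ F ∧ y ∈ Set.range v₁ ∨ x ∈ Set.range u₁ ∧ y ∈ T) →
        ¬ Conn (β ≫ p) (γ ≫ q) (wU ≫ u₁) (wV ≫ v₁) x y := by
  have := isNoetherian_of_finiteType p
  have := isNoetherian_of_finiteType q
  have := isNoetherian_of_finiteType (wU ≫ u)
  have := isNoetherian_of_finiteType (pullback.fst p q)
  let a := complIdeal (wU ≫ u)
  let c := complIdeal (wV ≫ v)
  let m := Scheme.IdealSheafData.vanishingIdeal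
    ⟨closure (Set.range (pullback.lift _ _ h)), isClosed_closure⟩
  let e := (complIdeal u).comap (pullback.fst p q) * (complIdeal v).comap (pullback.snd p q)
  have key (z) (hz : z ∈ m.support)
      (hz' : z ∈ (a.comap (pullback.fst p q)).support ∨ z ∈ (c.comap (pullback.snd p q)).support) :
      z ∈ e.support := by
    rw [← SetLike.mem_coe, Scheme.IdealSheafData.coe_support_vanishingIdeal] at hz
    rw [Scheme.IdealSheafData.support_mul, Scheme.IdealSheafData.support_comap,
      Scheme.IdealSheafData.support_comap]
    rw [Scheme.IdealSheafData.support_comap, Scheme.IdealSheafData.support_comap] at hz'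
    by_contra hcon
    have h1 : ¬ (pullback.fst p q z ∈ (complIdeal u).support) := fun h ↦ hcon (.inl h)
    have h2 : ¬ (pullback.snd p q z ∈ (complIdeal v).support) := fun h ↦ hcon (.inr h)
    rw [mem_support_complIdeal, not_not] at h1 h2
    obtain ⟨x, hx⟩ := h1
    obtain ⟨y, hy⟩ := h2
    obtain ⟨⟨w, hw⟩, ⟨w', hw'⟩⟩ := hW x y ((conn_iff h).mpr ⟨z, hz, hx.symm, hy.symm⟩)
    rcases hz' with hz' | hz'
    · refine (mem_support_complIdeal (wU ≫ u)).mp hz' ⟨w, ?_⟩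
      rw [Scheme.Hom.comp_apply, hw, hx]
    · refine (mem_support_complIdeal (wV ≫ v)).mp hz' ⟨w', ?_⟩
      rw [Scheme.Hom.comp_apply, hw', hy]
  obtain ⟨n₁, hn₁, h₁⟩ : ∃ n, n ≠ 0 ∧ e ^ n ≤ a.comap (pullback.fst p q) ⊔ m := by
    refine exists_pow_le fun z hz ↦ ?_
    rw [Scheme.IdealSheafData.support_sup] at hz
    exact key z hz.2 (.inl hz.1)
  obtain ⟨n₂, hn₂, h₂⟩ : ∃ n, n ≠ 0 ∧ e ^ n ≤ c.comap (pullback.snd p q) ⊔ m := by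
    refine exists_pow_le fun z hz ↦ ?_
    rw [Scheme.IdealSheafData.support_sup] at hz
    exact key z hz.2 (.inr hz.1)
  let b := complIdeal u ^ (n₁ + n₂)
  let d := complIdeal v ^ (n₁ + n₂)
  have hb (x) : x ∈ b.support ↔ x ∉ Set.range u := by
    rw [← mem_support_complIdeal, Scheme.IdealSheafData.support_pow _ _ (by omega)]
  have hd (x) : x ∈ d.support ↔ x ∉ Set.range v := by
    rw [← mem_support_complIdeal, Scheme.IdealSheafData.support_pow _ _ (by omega)]
  obtain ⟨P₁, β, u₁, F, hβ, hu₁, hu, hF, hFu, hFa⟩ := exists_blowup_locus u a b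
    (fun x hx ↦ (hb _).mp hx ⟨x, rfl⟩)
  obtain ⟨Q₁, γ, v₁, T, hγ, hv₁, hv, hT, hTv, hTc⟩ := exists_blowup_locus v c d
    (fun x hx ↦ (hd _).mp hx ⟨x, rfl⟩)
  refine ⟨P₁, Q₁, β, γ, u₁, v₁, F, T, hβ, hγ, hu₁, hv₁, hu, hv, hF, hT, fun x ↦ ?_, fun x ↦ ?_, ?_⟩
  · rw [hFu, mem_support_complIdeal]
    exact (not_congr (mem_range_comp_iff wU u x))
  · rw [hTv, mem_support_complIdeal]
    exact (not_congr (mem_range_comp_iff wV v x))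
  intro x y hxy hc
  obtain ⟨R, _, _, _, K, _, _, _, i, α, α', h1, h2, h3, rfl, rfl⟩ := hc
  let A := pull (α ≫ β) a
  let B := pull (α ≫ β) b
  let C := pull (α' ≫ γ) c
  let D := pull (α' ≫ γ) d
  have e1 : i ≫ wU ≫ u = Spec.map (CommRingCat.ofHom (algebraMap R K)) ≫ α ≫ β := by
    rw [← hu, ← reassoc_of% h1]
  have e2 : i ≫ wV ≫ v = Spec.map (CommRingCat.ofHom (algebraMap R K)) ≫ α' ≫ γ := by
    rw [← hv, ← reassoc_of% h2]
  have hA0 : A ≠ ⊥ := by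
    refine fun h0 ↦ (mem_support_complIdeal (wU ≫ u)).mp ((pull_eq_bot_iff _ e1).mp h0)
      ⟨i (cp K), (Scheme.Hom.comp_apply ..).symm⟩
  have hC0 : C ≠ ⊥ := by
    refine fun h0 ↦ (mem_support_complIdeal (wV ≫ v)).mp ((pull_eq_bot_iff _ e2).mp h0)
      ⟨i (cp K), (Scheme.Hom.comp_apply ..).symm⟩
  have hB0 : B ≠ ⊥ := by
    refine fun h0 ↦ (hb _).mp ((pull_eq_bot_iff _ e1).mp h0) ⟨wU (i (cp K)), ?_⟩
    exact ((Scheme.Hom.comp_apply ..).trans (Scheme.Hom.comp_apply ..)).symm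
  have hD0 : D ≠ ⊥ := by
    refine fun h0 ↦ (hd _).mp ((pull_eq_bot_iff _ e2).mp h0) ⟨wV (i (cp K)), ?_⟩
    exact ((Scheme.Hom.comp_apply ..).trans (Scheme.Hom.comp_apply ..)).symm
  let π : Spec (.of R) ⟶ pullback p q := pullback.lift (α ≫ β) (α' ≫ γ) (by simpa using h3)
  have hm0 : pull π m = ⊥ := by
    have : i ≫ pullback.lift _ _ h = Spec.map (CommRingCat.ofHom (algebraMap R K)) ≫ π := by
      apply pullback.hom_ext <;> simpa only [Category.assoc, pullback.lift_fst, pullback.lift_snd, π]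
    rw [pull_eq_bot_iff π this, ← SetLike.mem_coe,
      Scheme.IdealSheafData.coe_support_vanishingIdeal]
    exact subset_closure ⟨i (cp K), (Scheme.Hom.comp_apply ..).symm⟩
  have he : pull π e ^ (n₁ + n₂) = B * D := by
    simp only [e, B, D, b, d, pull_pow, pull_mul, mul_pow, ← pull_comp, π, pullback.lift_fst,
      pullback.lift_snd]
  have hBDA : B * D ≤ A := by
    have := pull_mono π h₁
    rw [pull_sup, hm0, sup_bot_eq, pull_pow, ← pull_comp, pullback.lift_fst] at this
    exact he.ge.trans ((Ideal.pow_le_pow_right (Nat.le_add_right _ _)).trans this)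
  have hBDC : B * D ≤ C := by
    have := pull_mono π h₂
    rw [pull_sup, hm0, sup_bot_eq, pull_pow, ← pull_comp, pullback.lift_snd] at this
    exact he.ge.trans ((Ideal.pow_le_pow_right (Nat.le_add_left _ _)).trans this)
  have hBtop (h : α (cp R) ∈ Set.range u₁) : B = ⊤ := by
    refine (pull_eq_top_iff (α ≫ β)).mpr ((hb _).not.mpr (not_not.mpr ?_))
    obtain ⟨z, hz⟩ := h
    refine ⟨z, ?_⟩
    rw [← hu, Scheme.Hom.comp_apply, hz]
    exact (Scheme.Hom.comp_apply ..).symm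
  have hDtop (h : α' (cp R) ∈ Set.range v₁) : D = ⊤ := by
    refine (pull_eq_top_iff (α' ≫ γ)).mpr ((hd _).not.mpr (not_not.mpr ?_))
    obtain ⟨z, hz⟩ := h
    refine ⟨z, ?_⟩
    rw [← hv, Scheme.Hom.comp_apply, hz]
    exact (Scheme.Hom.comp_apply ..).symm
  have caseT (hT : α' (cp R) ∈ T) (hle : D ≤ B) : False :=
    false_of_le_maximalIdeal_mul (pull_fg _ _) (pull_fg _ _) (pull_fg _ _) hB0 hC0 hD0
      (hTc R α' hT) hle hBDC
  have caseF (hF : α (cp R) ∈ F) (hle : B ≤ D) : False :=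
    false_of_le_maximalIdeal_mul (pull_fg _ _) (pull_fg _ _) (pull_fg _ _) hD0 hA0 hB0
      (hFa R α hF) hle (by rwa [mul_comm])
  rcases hxy with ⟨hF, hT⟩ | ⟨hF, hy⟩ | ⟨hx, hT⟩
  · exact (le_total_ideal D B).elim (caseT hT) (caseF hF)
  · exact caseF hF (by rw [hDtop hy]; exact le_top)
  · exact caseT hT (by rw [hBtop hx]; exact le_top)

end separate

lemma exists_denominator {A B : Type*} [CommRing A] [CommRing B] (s : A)
    (ψ : B →+* Localization.Away s) (F : Finset B) :
    ∃ (c : A) (a : B → A), s ∣ c ∧ (∃ n, c ∣ s ^ n) ∧ ∀ f ∈ F, s ∣ a f ∧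
      algebraMap A (Localization.Away s) (a f) = algebraMap A _ c * ψ f := by
  classical
  obtain ⟨⟨_, n, rfl⟩, hb⟩ := IsLocalization.exist_integer_multiples_of_finset (Submonoid.powers s)
    (F.image ψ)
  have hb' (f : B) : ∃ a : A, f ∈ F → algebraMap A (Localization.Away s) a = algebraMap A _ (s ^ n) * ψ f := by
    by_cases hf : f ∈ F
    · obtain ⟨a, ha⟩ := hb _ (Finset.mem_image_of_mem ψ hf)
      exact ⟨a, fun _ ↦ by rw [ha, Algebra.smul_def]⟩
    · exact ⟨0, fun h ↦ (hf h).elim⟩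
  choose a ha using hb'
  refine ⟨s * s ^ n, fun f ↦ s * a f, dvd_mul_right _ _, ⟨n + 1, by rw [pow_succ']⟩,
    fun f hf ↦ ⟨dvd_mul_right _ _, ?_⟩⟩
  rw [map_mul, ha f hf, map_mul, mul_assoc]

lemma exists_finset_generators {A B : Type*} [CommRing A] [CommRing B] {φ : A →+* B}
    (h : φ.FiniteType) : ∃ F : Finset B, ∀ M : Subring B, (∀ a, φ a ∈ M) → (∀ f ∈ F, f ∈ M) →
      M = ⊤ := by
  algebraize [φ]
  obtain ⟨F, hF⟩ := ‹Algebra.FiniteType A B›.1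
  refine ⟨F, fun M h1 h2 ↦ ?_⟩
  let M' : Subalgebra A B := { M with algebraMap_mem' := h1 }
  have : (⊤ : Subalgebra A B) ≤ M' := hF ▸ Algebra.adjoin_le h2
  exact top_le_iff.mp fun b _ ↦ this trivial

lemma exists_lift_of_range {B C L : Type*} [CommRing B] [CommRing C] [CommRing L] (l : B →+* L)
    (i : C →+* L) (hi : Function.Injective i) (h : ∀ b, l b ∈ i.range) :
    ∃ η : B →+* C, i.comp η = l := by
  refine ⟨(RingEquiv.ofLeftInverse (Function.leftInverse_invFun hi)).symm.toRingHom.comp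
    (l.codRestrict i.range h), ?_⟩
  ext b
  have := (RingEquiv.ofLeftInverse (Function.leftInverse_invFun hi)).apply_symm_apply
    (l.codRestrict i.range h b)
  exact congrArg Subtype.val this

lemma exists_dvd_forall {R ι : Type*} [CommRing R] [IsDomain R] [ValuationRing R] (F : Finset ι)
    (hF : F.Nonempty) (r : ι → R) : ∃ i ∈ F, ∀ j ∈ F, r i ∣ r j := by
  classical
  induction hF using Finset.Nonempty.cons_induction with
  | singleton i => exact ⟨i, by simp, by simp⟩
  | cons i F hi hF ih =>
    obtain ⟨k, hk, h⟩ := ih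
    rcases ValuationRing.dvd_total (r i) (r k) with h' | h'
    · exact ⟨i, by simp, fun j hj ↦ by
        rcases Finset.mem_cons.mp hj with rfl | hj
        · exact dvd_rfl
        · exact h'.trans (h j hj)⟩
    · refine ⟨k, by simp [hk], fun j hj ↦ ?_⟩
      rcases Finset.mem_cons.mp hj with rfl | hj
      · exact h'
      · exact h j hj

lemma exists_ideal_eq [IsNoetherian X] (D : X.affineOpens) (I : Ideal Γ(X, D.1)) :
    ∃ J : X.IdealSheafData, J.ideal D = I := by
  obtain ⟨K, hK⟩ := glob_surjective I
  have := D.2.isOpenImmersion_fromSpec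
  have : IsNoetherianRing Γ(X, D.1) := IsLocallyNoetherian.component_noetherian D
  refine ⟨K.map D.2.fromSpec, ?_⟩
  rw [← glob_comap_fromSpec, comap_map_eq, hK]

section denominators

variable {A B ι : Type u} [CommRing A] [CommRing B] (φ : A →+* B) (s c : ι → A)
  (ψ : ∀ i, B →+* Localization.Away (s i)) (a : ι → B → A) (F : Finset B) (d : Ideal A)

/-- The ideal of denominators and numerators. -/
def denIdeal : Ideal A :=
  Ideal.span (Set.range c) ⊔ Ideal.span {x | ∃ i, ∃ f ∈ F, x = a i f} ⊔ d

variable {φ s c ψ a F d}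

lemma map_denIdeal_eq [Finite ι] (hsc : ∀ i, s i ∣ c i) (hcs : ∀ i, ∃ n, c i ∣ s i ^ n)
    (ha : ∀ i, ∀ f ∈ F, s i ∣ a i f ∧
      algebraMap A (Localization.Away (s i)) (a i f) = algebraMap A _ (c i) * ψ i f)
    (hd : d.map φ ≤ Ideal.span (Set.range fun i ↦ φ (c i)) ⊔ ⨅ i, RingHom.ker (ψ i))
    {R K : Type u} [CommRing R] [IsDomain R] [ValuationRing R] [Field K] [Algebra R K]
    [IsFractionRing R K] (ρ : B →+* R) (hs : ∃ i, ρ (φ (s i)) ≠ 0)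
    (hψ : ∀ i, ρ (φ (s i)) ≠ 0 → ∃ χ : Localization.Away (s i) →+* K,
      χ.comp (algebraMap A _) = (algebraMap R K).comp (ρ.comp φ) ∧
      χ.comp (ψ i) = (algebraMap R K).comp ρ) :
    ∃ i, (denIdeal c a F d).map (ρ.comp φ) = Ideal.span {ρ (φ (c i))} ∧ ρ (φ (c i)) ≠ 0 := by
  classical
  have := Fintype.ofFinite ι
  obtain ⟨i₀, hi₀⟩ := hs
  obtain ⟨i, -, hi⟩ := exists_dvd_forall Finset.univ ⟨i₀, Finset.mem_univ _⟩ fun i ↦ ρ (φ (c i))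
  have hspan : ∀ j, ρ (φ (c j)) ∈ Ideal.span {ρ (φ (c i))} := fun j ↦
    Ideal.mem_span_singleton.mpr (hi j (Finset.mem_univ _))
  have hne (j) (hj : ρ (φ (s j)) ≠ 0) : ρ (φ (c j)) ≠ 0 := by
    obtain ⟨n, hn⟩ := hcs j
    intro h0
    have := map_dvd (ρ.comp φ) hn
    rw [map_pow, RingHom.comp_apply, RingHom.comp_apply, h0, zero_dvd_iff] at this
    exact pow_ne_zero n hj this
  refine ⟨i, le_antisymm ?_ ?_, fun h0 ↦ hne i₀ hi₀ ?_⟩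
  · rw [denIdeal, Ideal.map_sup, Ideal.map_sup, Ideal.map_span, Ideal.map_span]
    refine sup_le (sup_le ?_ ?_) ?_
    · rw [Ideal.span_le]
      rintro _ ⟨_, ⟨j, rfl⟩, rfl⟩
      exact hspan j
    · rw [Ideal.span_le]
      rintro _ ⟨_, ⟨j, f, hf, rfl⟩, rfl⟩
      obtain ⟨h1, h2⟩ := ha j f hf
      have : ρ (φ (a j f)) = ρ (φ (c j)) * ρ f := by
        by_cases hj : ρ (φ (s j)) = 0
        · have h3 := map_dvd (ρ.comp φ) h1
          have h4 := map_dvd (ρ.comp φ) (hsc j)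
          rw [RingHom.comp_apply, RingHom.comp_apply, hj, zero_dvd_iff] at h3 h4
          rw [h3, h4, zero_mul]
        · obtain ⟨χ, h3, h4⟩ := hψ j hj
          apply IsFractionRing.injective R K
          have := congr(χ $h2)
          rw [map_mul] at this
          have e1 (x) := congr($h3 x)
          have e2 (x) := congr($h4 x)
          simp only [RingHom.comp_apply] at e1 e2
          rw [e1, e1, e2] at this
          rw [this, map_mul]
      rw [SetLike.mem_coe, RingHom.comp_apply, this]
      exact Ideal.mul_mem_right _ _ (hspan j)
    · rw [← Ideal.map_map]
      refine (Ideal.map_mono hd).trans ?_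
      rw [Ideal.map_sup]
      refine sup_le ?_ ?_
      · rw [Ideal.map_span, Ideal.span_le]
        rintro _ ⟨_, ⟨j, rfl⟩, rfl⟩
        exact hspan j
      · rw [Ideal.map_le_iff_le_comap]
        intro x hx
        obtain ⟨χ, h3, h4⟩ := hψ i₀ hi₀
        have hx' : ψ i₀ x = 0 := (Submodule.mem_iInf _).mp hx i₀
        have : ρ x = 0 := by
          apply IsFractionRing.injective R K
          have e2 := congr($h4 x)
          simp only [RingHom.comp_apply] at e2
          rw [← e2, hx', map_zero, map_zero]
        rw [Ideal.mem_comap, this]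
        exact zero_mem _
  · rw [Ideal.span_singleton_le_iff_mem]
    refine Ideal.mem_map_of_mem (ρ.comp φ) (Ideal.mem_sup_left (Ideal.mem_sup_left ?_))
    exact Ideal.subset_span ⟨i, rfl⟩
  · have := hspan i₀
    rwa [h0, Ideal.mem_span_singleton, zero_dvd_iff] at this

lemma exists_hom_of_map_denIdeal_eq (hsc : ∀ i, s i ∣ c i)
    (ha : ∀ i, ∀ f ∈ F, s i ∣ a i f ∧
      algebraMap A (Localization.Away (s i)) (a i f) = algebraMap A _ (c i) * ψ i f)
    (hF : ∀ M : Subring B, (∀ a, φ a ∈ M) → (∀ f ∈ F, f ∈ M) → M = ⊤)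
    (hψ : ∀ i, (ψ i).comp φ = algebraMap A _)
    {C : Type u} [CommRing C] (γ : A →+* C) (i : ι) (hi : γ (c i) ∈ C⁰)
    (h : (denIdeal c a F d).map γ = Ideal.span {γ (c i)}) :
    ∃ (η : B →+* C) (l : Localization.Away (s i) →+* Localization.Away (γ (c i))),
      η.comp φ = γ ∧ l.comp (algebraMap A _) = (algebraMap C _).comp γ ∧
      l.comp (ψ i) = (algebraMap C _).comp η := by
  have hu : IsUnit (((algebraMap C (Localization.Away (γ (c i)))).comp γ) (s i)) := by
    refine isUnit_of_dvd_unit (map_dvd _ (hsc i)) ?_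
    exact IsLocalization.Away.algebraMap_isUnit (γ (c i))
  let l := IsLocalization.Away.lift (S := Localization.Away (s i)) (s i) hu
  have hl : l.comp (algebraMap A _) = (algebraMap C _).comp γ := IsLocalization.Away.lift_comp ..
  have hinj : Function.Injective (algebraMap C (Localization.Away (γ (c i)))) :=
    IsLocalization.injective _ (Submonoid.powers_le.mpr hi)
  have e2 (x) : ψ i (φ x) = algebraMap A _ x := congr($(hψ i) x)
  have e3 (x) : l (algebraMap A _ x) = algebraMap C _ (γ x) := congr($hl x)
  have key : (algebraMap C (Localization.Away (γ (c i)))).range.comap (l.comp (ψ i)) = ⊤ := by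
    refine hF _ (fun x ↦ ⟨γ x, ?_⟩) fun f hf ↦ ?_
    · rw [RingHom.comp_apply, e2, e3]
    · have hx : γ (a i f) ∈ Ideal.span {γ (c i)} := by
        rw [← h]
        refine Ideal.mem_map_of_mem γ (Ideal.mem_sup_left (Ideal.mem_sup_right ?_))
        exact Ideal.subset_span ⟨i, f, hf, rfl⟩
      obtain ⟨y, hy⟩ := Ideal.mem_span_singleton.mp hx
      refine ⟨y, ?_⟩
      have e := congr(l $((ha i f hf).2))
      rw [map_mul, e3, e3, hy, map_mul] at e
      exact (IsLocalization.Away.algebraMap_isUnit (γ (c i))).mul_left_cancel e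
  obtain ⟨η, hη⟩ := exists_lift_of_range (l.comp (ψ i)) _ hinj fun b ↦ key.ge (Subring.mem_top b)
  refine ⟨η, l, ?_, hl, hη.symm⟩
  ext x
  apply hinj
  have e1 := congr($hη (φ x))
  rw [RingHom.comp_apply, RingHom.comp_apply] at e1
  rw [RingHom.comp_apply, e1, e2, e3]

end denominators

section section_local

variable {O N W : Scheme.{u}}

lemma ringHom_ext_fromSpec (D : O.affineOpens) {R : Type u} [CommRing R]
    {φ φ' : Γ(O, D.1) →+* R} (h : Spec.map (CommRingCat.ofHom φ) ≫ D.2.fromSpec =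
      Spec.map (CommRingCat.ofHom φ') ≫ D.2.fromSpec) : φ = φ' := by
  have := D.2.isOpenImmersion_fromSpec
  have h := Spec.map_injective ((cancel_mono _).mp h)
  exact congr(($h).hom)

lemma specMap_comp {A B C : Type u} [CommRing A] [CommRing B] [CommRing C] (φ : A →+* B)
    (ψ : B →+* C) : Spec.map (CommRingCat.ofHom (ψ.comp φ)) =
      Spec.map (CommRingCat.ofHom ψ) ≫ Spec.map (CommRingCat.ofHom φ) := by
  rw [← Spec.map_comp, CommRingCat.ofHom_comp]

lemma specMap_appLE (ν : N ⟶ O) (D : O.affineOpens) (E : N.affineOpens) (hE : E.1 ≤ ν ⁻¹ᵁ D.1) :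
    Spec.map (CommRingCat.ofHom (ν.appLE D.1 E.1 hE).hom) ≫ D.2.fromSpec = E.2.fromSpec ≫ ν := by
  exact IsAffineOpen.SpecMap_appLE_fromSpec ν D.2 E.2 hE

lemma mem_basicOpen_iff (D : O.affineOpens) (s : Γ(O, D.1)) (x : Spec Γ(O, D.1)) :
    D.2.fromSpec x ∈ O.basicOpen s ↔ s ∉ x.asIdeal := by
  have := D.2.fromSpec_preimage_basicOpen s
  exact SetLike.ext_iff.mp this x

lemma exists_basicOpen_lift [IsNoetherian O] (D : O.affineOpens) (w : W ⟶ O) [IsOpenImmersion w]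
    (W' : W.Opens) (hW' : w ''ᵁ W' ≤ D.1) : ∃ s : Finset Γ(O, D.1),
      w ''ᵁ W' = ⨆ f ∈ s, O.basicOpen f := by
  have hc : IsCompact ((w ''ᵁ W' : O.Opens) : Set O) := NoetherianSpace.isCompact _
  obtain ⟨t, ht⟩ := hc.elim_finite_subcover
    (fun f : { f : Γ(O, D.1) // O.basicOpen f ≤ w ''ᵁ W' } ↦ (O.basicOpen f.1 : Set O))
    (fun _ ↦ Opens.isOpen _) fun x hx ↦ by
      obtain ⟨f, hf, hxf⟩ := D.2.exists_basicOpen_le ⟨x, hx⟩ (hW' hx)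
      exact Set.mem_iUnion.mpr ⟨⟨f, hf⟩, hxf⟩
  classical
  refine ⟨t.image Subtype.val, le_antisymm (fun x hx ↦ ?_) (iSup₂_le fun f hf ↦ ?_)⟩
  · obtain ⟨f, hf, hxf⟩ := Set.mem_iUnion₂.mp (ht hx)
    exact Opens.mem_iSup.mpr ⟨f.1, Opens.mem_iSup.mpr ⟨Finset.mem_image_of_mem _ hf, hxf⟩⟩
  · obtain ⟨g, -, rfl⟩ := Finset.mem_image.mp hf
    exact g.2

lemma exists_hom_away (D : O.affineOpens) (E : N.affineOpens) (w : W ⟶ O) [IsOpenImmersion w]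
    (ν : N ⟶ O) (σ : W ⟶ N) (hσ : σ ≫ ν = w) (hE : E.1 ≤ ν ⁻¹ᵁ D.1) (s : Γ(O, D.1))
    (hs : O.basicOpen s ≤ w ''ᵁ (σ ⁻¹ᵁ E.1)) :
    ∃ (k : Spec (.of (Localization.Away s)) ⟶ W) (ψ : Γ(N, E.1) →+* Localization.Away s),
      k ≫ w = Spec.map (CommRingCat.ofHom (algebraMap _ _)) ≫ D.2.fromSpec ∧
      k ≫ σ = Spec.map (CommRingCat.ofHom ψ) ≫ E.2.fromSpec ∧
      ψ.comp (ν.appLE D.1 E.1 hE).hom = algebraMap _ _ := by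
  have := D.2.isOpenImmersion_fromSpec
  have := E.2.isOpenImmersion_fromSpec
  have hr : Set.range (Spec.map (CommRingCat.ofHom (algebraMap Γ(O, D.1) (Localization.Away s))) ≫
      D.2.fromSpec) ⊆ O.basicOpen s := by
    rintro _ ⟨x, rfl⟩
    rw [Scheme.Hom.comp_apply]
    refine (mem_basicOpen_iff D s _).mpr fun h ↦ ?_
    have h' : algebraMap Γ(O, D.1) (Localization.Away s) s ∈ x.asIdeal := h
    exact x.2.ne_top (Ideal.eq_top_of_isUnit_mem _ h'
      (IsLocalization.Away.algebraMap_isUnit s))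
  have hrw : Set.range (Spec.map (CommRingCat.ofHom (algebraMap Γ(O, D.1) (Localization.Away s))) ≫
      D.2.fromSpec) ⊆ Set.range w := by
    intro y hy
    obtain ⟨x, -, hx⟩ := hs (hr hy)
    exact ⟨x, hx⟩
  let k := IsOpenImmersion.lift w _ hrw
  have hk : k ≫ w = _ := IsOpenImmersion.lift_fac w _ hrw
  have hr' : Set.range (k ≫ σ) ⊆ Set.range E.2.fromSpec := by
    rw [E.2.range_fromSpec]
    rintro _ ⟨x, rfl⟩
    obtain ⟨y, hy, e⟩ := hs (hr ⟨x, rfl⟩)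
    rw [Scheme.Hom.comp_apply]
    have : y = k x := by
      apply w.isOpenEmbedding.injective
      rw [← Scheme.Hom.comp_apply, hk]
      exact e
    exact this ▸ hy
  let ψ := (Spec.preimage (IsOpenImmersion.lift E.2.fromSpec _ hr')).hom
  have hψ : k ≫ σ = Spec.map (CommRingCat.ofHom ψ) ≫ E.2.fromSpec := by
    rw [CommRingCat.ofHom_hom, Spec.map_preimage, IsOpenImmersion.lift_fac]
  refine ⟨k, ψ, hk, hψ, ringHom_ext_fromSpec D ?_⟩
  rw [specMap_comp, Category.assoc, specMap_appLE, ← reassoc_of% hψ, hσ, hk]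

end section_local

section section_local

variable {O N W : Scheme.{u}}

lemma map_complIdeal_le_radical [IsNoetherian O] (D : O.affineOpens) (E : N.affineOpens) (w : W ⟶ O)
    [IsOpenImmersion w] (ν : N ⟶ O) [IsSeparated ν] (σ : W ⟶ N) (hσ : σ ≫ ν = w)
    (hE : E.1 ≤ ν ⁻¹ᵁ D.1) {ι : Type u} [Finite ι] (s : ι → Γ(O, D.1))
    (hs : w ''ᵁ (σ ⁻¹ᵁ E.1) ≤ ⨆ i, O.basicOpen (s i))
    (k : ∀ i, Spec (.of (Localization.Away (s i))) ⟶ W)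
    (ψ : ∀ i, Γ(N, E.1) →+* Localization.Away (s i))
    (hk : ∀ i, k i ≫ σ = Spec.map (CommRingCat.ofHom (ψ i)) ≫ E.2.fromSpec)
    (c : ι → Γ(O, D.1)) (hcs : ∀ i, ∃ n, c i ∣ s i ^ n) :
    ((complIdeal w).ideal D).map (ν.appLE D.1 E.1 hE).hom ≤
      (Ideal.span (Set.range fun i ↦ (ν.appLE D.1 E.1 hE).hom (c i)) ⊔
        ⨅ i, RingHom.ker (ψ i)).radical := by
  classical
  have := Fintype.ofFinite ι
  rw [Ideal.radical_eq_sInf]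
  refine le_sInf fun 𝔮 ⟨h𝔮, h𝔮p⟩ ↦ ?_
  by_contra hcon
  obtain ⟨δ, hδ, hδ'⟩ := SetLike.not_le_iff_exists.mp hcon
  have h1 : (Finset.univ : Finset ι).inf (fun i ↦ RingHom.ker (ψ i)) ≤ 𝔮 := by
    rw [Finset.inf_univ_eq_iInf]
    exact le_sup_right.trans h𝔮
  obtain ⟨i, -, hi⟩ := h𝔮p.inf_le'.mp h1
  let y : Spec Γ(N, E.1) := ⟨𝔮, h𝔮p⟩
  have hy : y ∈ closure (Set.range (Spec.map (CommRingCat.ofHom (ψ i)))) := by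
    have := PrimeSpectrum.closure_range_comap (ψ i)
    exact this.ge hi
  have : IsNoetherianRing Γ(O, D.1) := IsLocallyNoetherian.component_noetherian D
  have : IsNoetherianRing (Localization.Away (s i)) :=
    IsLocalization.isNoetherianRing (Submonoid.powers (s i)) _ inferInstance
  obtain ⟨v, hv⟩ := exists_valuativeCommSq_of_mem_closure _ hy
  obtain ⟨R, K, i₁, i₂, ⟨e⟩⟩ := v
  have hv : i₂ (cp R) = y := hv
  let θ := (Spec.preimage i₂).hom
  have hθ : i₂ = Spec.map (CommRingCat.ofHom θ) := by
    rw [CommRingCat.ofHom_hom, Spec.map_preimage]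
  have hθ' (b) : b ∈ 𝔮 ↔ θ b ∈ maximalIdeal R := by
    have h2 : b ∈ (i₂ (cp R)).asIdeal ↔ b ∈ 𝔮 := by rw [hv]
    rw [← h2, hθ]
    rfl
  have hpull : pull (i₂ ≫ E.2.fromSpec ≫ ν) (complIdeal w) = ⊤ := by
    rw [← specMap_appLE ν D E hE, hθ, ← Category.assoc, ← specMap_comp, pull_specMap_fromSpec,
      ← Ideal.map_map]
    exact Ideal.eq_top_of_isUnit_mem _ (Ideal.mem_map_of_mem θ hδ)
      (not_not.mp fun h ↦ hδ' ((hθ' _).mpr ((mem_maximalIdeal _).mpr h)))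
  rw [pull_eq_top_iff, mem_support_complIdeal, not_not] at hpull
  have hr : Set.range (i₂ ≫ E.2.fromSpec ≫ ν) ⊆ Set.range w :=
    range_subset_of_closedPoint_mem _ (U := w.opensRange) hpull
  let b := IsOpenImmersion.lift w _ hr
  have hb : b ≫ w = _ := IsOpenImmersion.lift_fac w _ hr
  have e1 : i₁ ≫ k i ≫ σ = Spec.map (CommRingCat.ofHom (algebraMap R K)) ≫ i₂ ≫ E.2.fromSpec := by
    rw [hk, reassoc_of% e]
  have e2 : i₁ ≫ k i = Spec.map (CommRingCat.ofHom (algebraMap R K)) ≫ b := by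
    rw [← cancel_mono w, Category.assoc, Category.assoc, hb, ← reassoc_of% e1, hσ]
  have e3 : b ≫ σ = i₂ ≫ E.2.fromSpec :=
    ext_of_valuationRing ν (K := K) (by rw [Category.assoc, hσ, hb, Category.assoc])
      (by rw [← reassoc_of% e2, e1])
  have hmem : w (b (cp R)) ∈ w ''ᵁ (σ ⁻¹ᵁ E.1) := by
    refine ⟨_, ?_, rfl⟩
    change σ (b (cp R)) ∈ E.1
    rw [← Scheme.Hom.comp_apply, e3, Scheme.Hom.comp_apply]
    exact E.2.range_fromSpec.le ⟨_, rfl⟩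
  obtain ⟨j, hj⟩ := Opens.mem_iSup.mp (hs hmem)
  rw [← Scheme.Hom.comp_apply, hb, ← specMap_appLE ν D E hE, Scheme.Hom.comp_apply,
    Scheme.Hom.comp_apply, hv] at hj
  refine (mem_basicOpen_iff D _ _).mp hj ?_
  change (ν.appLE D.1 E.1 hE).hom (s j) ∈ 𝔮
  obtain ⟨n, hn⟩ := hcs j
  refine h𝔮p.mem_of_pow_mem n ?_
  rw [← map_pow]
  refine Ideal.mem_of_dvd _ (map_dvd _ hn) (h𝔮 (Ideal.mem_sup_left (Ideal.subset_span ⟨j, rfl⟩)))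

end section_local

lemma away_le_of_glob_eq {C : CommRingCat.{u}} {J : (Spec C).IdealSheafData} {s : C}
    (h : glob J = Ideal.span {s}) : away J ≤ (PrimeSpectrum.basicOpen s : (Spec C).Opens) := by
  have e : J.ideal ⟨⊤, isAffineOpen_top _⟩ = Ideal.span {(Scheme.ΓSpecIso C).inv.hom s} := by
    rw [ideal_top_eq_glob, h, Ideal.map_span, Set.image_singleton]
  have := away_inf_of_ideal_eq e
  rw [inf_top_eq] at this
  rw [this, ← basicOpen_eq_of_affine]

section section_local

variable {O N W : Scheme.{u}}

lemma agree_of_chart {O' : Scheme.{u}} (D : O.affineOpens) (E : N.affineOpens) (w : W ⟶ O)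
    [IsOpenImmersion w] (ν : N ⟶ O) [IsSeparated ν] (σ : W ⟶ N) (hσ : σ ≫ ν = w)
    {C A' : Type u} [CommRing C] [CommRing A'] (j : Spec (.of C) ⟶ O') [IsOpenImmersion j]
    (g : O' ⟶ O)
    (I : O.IdealSheafData) (hI : IsInv (I.comap g)) (γ : Γ(O, D.1) →+* C)
    (hγ : j ≫ g = Spec.map (CommRingCat.ofHom γ) ≫ D.2.fromSpec) (c : C)
    (hc : (I.ideal D).map γ = Ideal.span {c}) (η : Γ(N, E.1) →+* C)
    (hη : Spec.map (CommRingCat.ofHom η) ≫ E.2.fromSpec ≫ ν = j ≫ g)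
    (k : Spec (.of A') ⟶ W) (α : Γ(O, D.1) →+* A') (ψ : Γ(N, E.1) →+* A')
    (hkw : k ≫ w = Spec.map (CommRingCat.ofHom α) ≫ D.2.fromSpec)
    (hkσ : k ≫ σ = Spec.map (CommRingCat.ofHom ψ) ≫ E.2.fromSpec)
    (l : A' →+* Localization.Away c) (hl : l.comp α = (algebraMap C _).comp γ)
    (hl' : l.comp ψ = (algebraMap C _).comp η) (t : T ⟶ Spec (.of C)) (s : T ⟶ W)
    (hts : t ≫ j ≫ g = s ≫ w) :
    t ≫ Spec.map (CommRingCat.ofHom η) ≫ E.2.fromSpec = s ≫ σ := by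
  have hJ : IsInv ((I.comap (j ≫ g)).comap (pullback.fst (j ≫ g) w)) := by
    have h := isInv_comap_of_flat hI j
    rw [← Scheme.IdealSheafData.comap_comp] at h
    exact isInv_comap_of_flat h _
  have hgl : glob (I.comap (j ≫ g)) = Ideal.span {c} := by
    rw [hγ, Scheme.IdealSheafData.comap_comp, glob_comap_map, glob_comap_fromSpec]
    exact hc
  have key : pullback.fst (j ≫ g) w ≫ Spec.map (CommRingCat.ofHom η) ≫ E.2.fromSpec =
      pullback.snd (j ≫ g) w ≫ σ := by
    refine hJ.hom_ext ν (by
      simp only [Category.assoc, hη, hσ, pullback.condition]) (W := pullback.fst (j ≫ g) w ⁻¹ᵁ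
        (PrimeSpectrum.basicOpen c : (Spec (.of C)).Opens)) ?_ ?_
    · intro x hx
      have hx' : x ∉ ((I.comap (j ≫ g)).comap (pullback.fst (j ≫ g) w)).support := hx
      rw [Scheme.IdealSheafData.support_comap] at hx'
      exact away_le_of_glob_eq hgl hx'
    · set V := pullback.fst (j ≫ g) w ⁻¹ᵁ (PrimeSpectrum.basicOpen c : (Spec (.of C)).Opens)
      let m : Spec (.of (Localization.Away c)) ⟶ Spec (.of C) :=
        Spec.map (CommRingCat.ofHom (algebraMap C (Localization.Away c)))
      have : IsOpenImmersion m := IsOpenImmersion.of_isLocalization c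
      have hr : Set.range (V.ι ≫ pullback.fst (j ≫ g) w) ⊆ Set.range m := by
        rintro _ ⟨x, rfl⟩
        rw [Scheme.Hom.comp_apply]
        exact (PrimeSpectrum.localization_away_comap_range (Localization.Away c) c).ge x.2
      let q := IsOpenImmersion.lift m _ hr
      have hq : q ≫ m = V.ι ≫ pullback.fst (j ≫ g) w := IsOpenImmersion.lift_fac m _ hr
      have e2 : Spec.map (CommRingCat.ofHom l) ≫ Spec.map (CommRingCat.ofHom α) =
          m ≫ Spec.map (CommRingCat.ofHom γ) := by
        rw [← specMap_comp, hl, specMap_comp]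
      have e3 : Spec.map (CommRingCat.ofHom l) ≫ Spec.map (CommRingCat.ofHom ψ) =
          m ≫ Spec.map (CommRingCat.ofHom η) := by
        rw [← specMap_comp, hl', specMap_comp]
      have e1 : q ≫ Spec.map (CommRingCat.ofHom l) ≫ k = V.ι ≫ pullback.snd (j ≫ g) w := by
        rw [← cancel_mono w, Category.assoc, Category.assoc, Category.assoc, hkw,
          ← pullback.condition, ← reassoc_of% hq, reassoc_of% e2, ← hγ]
      rw [← reassoc_of% hq, ← reassoc_of% e1, hkσ, reassoc_of% e3]
  have := congr(pullback.lift t s hts ≫ $key)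
  rwa [pullback.lift_fst_assoc, pullback.lift_snd_assoc] at this

lemma exists_dom_ideal [IsNoetherian O] (D : O.affineOpens) (E : N.affineOpens) (w : W ⟶ O)
    [IsOpenImmersion w] (ν : N ⟶ O) [IsSeparated ν] [LocallyOfFiniteType ν] (σ : W ⟶ N)
    (hσ : σ ≫ ν = w) (hE : E.1 ≤ ν ⁻¹ᵁ D.1) :
    ∃ I : O.IdealSheafData, (∀ x, w x ∉ I.support) ∧
      ∀ {O' : Scheme.{u}} (g : O' ⟶ O), IsInv (I.comap g) →
      ∀ {R K : Type u} [CommRing R] [IsDomain R] [ValuationRing R] [Field K] [Algebra R K]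
        [IsFractionRing R K] (i : Spec (.of K) ⟶ W) (a : Spec (.of R) ⟶ O')
        (b : Spec (.of R) ⟶ N),
        i ≫ w = Spec.map (CommRingCat.ofHom (algebraMap R K)) ≫ a ≫ g →
        i ≫ σ = Spec.map (CommRingCat.ofHom (algebraMap R K)) ≫ b → b ≫ ν = a ≫ g →
        b (cp R) ∈ E.1 →
        ∃ (C : Type u) (_ : CommRing C) (j : Spec (.of C) ⟶ O') (_ : IsOpenImmersion j)
          (h : Spec (.of C) ⟶ N), a (cp R) ∈ j.opensRange ∧ h ≫ ν = j ≫ g ∧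
          ∀ {T : Scheme.{u}} (t : T ⟶ Spec (.of C)) (s : T ⟶ W), t ≫ j ≫ g = s ≫ w →
            t ≫ h = s ≫ σ := by
  classical
  have hW' : w ''ᵁ (σ ⁻¹ᵁ E.1) ≤ D.1 := by
    rintro _ ⟨x, hx, rfl⟩
    have := hE hx
    change w x ∈ D.1
    rw [← hσ, Scheme.Hom.comp_apply]
    exact this
  obtain ⟨S, hS⟩ := exists_basicOpen_lift D w (σ ⁻¹ᵁ E.1) hW'
  have hle (s : S) : O.basicOpen s.1 ≤ w ''ᵁ (σ ⁻¹ᵁ E.1) := by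
    rw [hS]
    exact le_iSup₂_of_le s.1 s.2 le_rfl
  choose k ψ hkw hkσ hψ using fun s : S ↦ exists_hom_away D E w ν σ hσ hE s.1 (hle s)
  obtain ⟨F, hF⟩ := exists_finset_generators (ν.finiteType_appLE D.2 E.2 hE)
  choose c a hsc hcs ha using fun s : S ↦ exists_denominator s.1 (ψ s) F
  have hrad := map_complIdeal_le_radical D E w ν σ hσ hE (fun s : S ↦ s.1) (by
    rw [hS]
    exact iSup₂_le fun s hs ↦ le_iSup (fun s : S ↦ O.basicOpen s.1) ⟨s, hs⟩) k ψ hkσ c hcs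
  have : IsNoetherianRing Γ(O, D.1) := IsLocallyNoetherian.component_noetherian D
  obtain ⟨m, hm⟩ := Ideal.exists_pow_le_of_le_radical_of_fg hrad
    (((isNoetherianRing_iff_ideal_fg _).mp ‹_› ((complIdeal w).ideal D)).map _)
  obtain ⟨J, hJ⟩ := exists_ideal_eq D (denIdeal c a F ((complIdeal w).ideal D ^ (m + 1)))
  have hI : (J ⊔ complIdeal w ^ (m + 1)).ideal D =
      denIdeal c a F ((complIdeal w).ideal D ^ (m + 1)) := by
    rw [Scheme.IdealSheafData.ideal_sup, Pi.sup_apply, hJ]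
    exact sup_eq_left.mpr le_sup_right
  refine ⟨J ⊔ complIdeal w ^ (m + 1), fun x hx ↦ ?_, ?_⟩
  · rw [Scheme.IdealSheafData.support_sup] at hx
    have hx := hx.2
    rw [Scheme.IdealSheafData.support_pow _ _ (by simp)] at hx
    exact (mem_support_complIdeal w).mp hx ⟨x, rfl⟩
  intro O' g hg R K _ _ _ _ _ _ i b₀ b hi hi' hb hbE
  obtain ⟨ρ, hρ⟩ := exists_factor b E hbE
  set φ := (ν.appLE D.1 E.1 hE).hom with hφ
  have hbg : b₀ ≫ g = Spec.map (CommRingCat.ofHom (ρ.comp φ)) ≫ D.2.fromSpec := by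
    rw [← hb, hρ, Category.assoc, specMap_comp, Category.assoc, hφ, specMap_appLE]
  have hiw : i ≫ w = Spec.map (CommRingCat.ofHom ((algebraMap R K).comp (ρ.comp φ))) ≫
      D.2.fromSpec := by
    rw [hi, hbg, specMap_comp (ρ.comp φ), Category.assoc]
  have hs : ∃ s : S, ρ (φ s.1) ≠ 0 := by
    have hmem : w (i (cp K)) ∈ w ''ᵁ (σ ⁻¹ᵁ E.1) := by
      refine ⟨_, ?_, rfl⟩
      change σ (i (cp K)) ∈ E.1
      rw [← Scheme.Hom.comp_apply, hi', hρ, Scheme.Hom.comp_apply, Scheme.Hom.comp_apply]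
      exact E.2.range_fromSpec.le ⟨_, rfl⟩
    rw [hS] at hmem
    obtain ⟨s, hs⟩ := Opens.mem_iSup.mp hmem
    obtain ⟨hsS, hs⟩ := Opens.mem_iSup.mp hs
    refine ⟨⟨s, hsS⟩, fun h0 ↦ ?_⟩
    rw [← Scheme.Hom.comp_apply, hiw, Scheme.Hom.comp_apply] at hs
    refine (mem_basicOpen_iff D s _).mp hs ?_
    change algebraMap R K (ρ (φ s)) ∈ maximalIdeal K
    rw [h0, map_zero]
    exact zero_mem _
  have hχ (s : S) (h0 : ρ (φ s.1) ≠ 0) : ∃ χ : Localization.Away s.1 →+* K,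
      χ.comp (algebraMap Γ(O, D.1) _) = (algebraMap R K).comp (ρ.comp φ) ∧
      χ.comp (ψ s) = (algebraMap R K).comp ρ := by
    have hu : IsUnit ((algebraMap R K).comp (ρ.comp φ) s.1) :=
      isUnit_iff_ne_zero.mpr fun h ↦ h0 ((FaithfulSMul.algebraMap_injective R K)
        (h.trans (map_zero _).symm))
    let χ := IsLocalization.Away.lift (S := Localization.Away s.1) s.1 hu
    have h1 : χ.comp (algebraMap Γ(O, D.1) _) = (algebraMap R K).comp (ρ.comp φ) :=
      IsLocalization.Away.lift_comp ..
    have h2 : Spec.map (CommRingCat.ofHom χ) ≫ k s = i := by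
      rw [← cancel_mono w, Category.assoc, hkw, ← Category.assoc, ← specMap_comp, h1, hiw]
    refine ⟨χ, h1, ringHom_ext_fromSpec E ?_⟩
    rw [specMap_comp, Category.assoc, ← hkσ, reassoc_of% h2, hi', specMap_comp, Category.assoc,
      ← hρ]
  obtain ⟨s, hs1, hs2⟩ := map_denIdeal_eq hsc hcs ha (by
    rw [Ideal.map_pow]
    exact (Ideal.pow_le_pow_right m.le_succ).trans hm) ρ hs hχ
  have hx : b₀ (cp R) ∈ g ⁻¹ᵁ D.1 := by
    change g (b₀ (cp R)) ∈ D.1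
    rw [← Scheme.Hom.comp_apply, hbg, Scheme.Hom.comp_apply]
    exact D.2.range_fromSpec.le ⟨_, rfl⟩
  obtain ⟨D', hxD', hD', t, ht, e⟩ := hg.exists_le hx
  have e' := e
  rw [ideal_comap g _ D D' hD', hI] at e'
  obtain ⟨r, hr⟩ := Ideal.mem_span_singleton.mp (e' ▸ Ideal.mem_map_of_mem
    (g.appLE D.1 D'.1 hD').hom (show c s ∈ denIdeal c a F _ from
      Ideal.mem_sup_left (Ideal.mem_sup_left (Ideal.subset_span ⟨s, rfl⟩))))
  obtain ⟨θ, hθ⟩ := exists_factor b₀ D' hxD'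
  have hθγ : θ.comp (g.appLE D.1 D'.1 hD').hom = ρ.comp φ := by
    refine ringHom_ext_fromSpec D ?_
    rw [specMap_comp, Category.assoc, specMap_appLE, ← hbg, hθ, Category.assoc]
  have hθr : IsUnit (θ r) := by
    have h1 : θ t * θ r = ρ (φ (c s)) := by
      rw [← map_mul, ← hr]
      exact congr($hθγ (c s))
    have h2 := congr(Ideal.map θ $e')
    rw [Ideal.map_map, hθγ, hs1, Ideal.map_span, Set.image_singleton] at h2
    obtain ⟨z, hz⟩ := Ideal.mem_span_singleton.mp (h2.ge (Ideal.mem_span_singleton_self _))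
    rw [← h1] at hz hs2
    refine IsUnit.of_mul_eq_one z (mul_left_cancel₀ (left_ne_zero_of_mul hs2) ?_)
    rw [mul_one, ← mul_assoc, ← hz]
  have hxr : b₀ (cp R) ∈ O'.basicOpen r := by
    rw [hθ, Scheme.Hom.comp_apply]
    refine (mem_basicOpen_iff D' r _).mpr fun h ↦ ?_
    exact (mem_maximalIdeal _).mp h hθr
  let D'' := O'.affineBasicOpen r
  have hle' : D'' ≤ D' := O'.affineBasicOpen_le r
  have hD'' : D''.1 ≤ g ⁻¹ᵁ D.1 := fun y hy ↦ hD' (hle' hy)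
  let γ := (g.appLE D.1 D''.1 hD'').hom
  have hγ' (x) : γ x = res hle' ((g.appLE D.1 D'.1 hD').hom x) := by
    have := g.appLE_map hD' (homOfLE hle').op (U := D.1)
    exact congr(($this).hom x).symm
  have hru : IsUnit (res hle' r) := RingedSpace.isUnit_res_basicOpen _ _
  have hγc : (denIdeal c a F ((complIdeal w).ideal D ^ (m + 1))).map γ = Ideal.span {γ (c s)} := by
    rw [← hI, ← ideal_comap g _ D D'' hD'', ideal_res hle' e, hγ', hr, map_mul,
      Ideal.span_singleton_mul_right_unit hru]
  have hnzd : γ (c s) ∈ Γ(O', D''.1)⁰ := by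
    rw [hγ', hr, map_mul]
    exact mul_mem (res_mem_nonZeroDivisors' hle' ht) hru.mem_nonZeroDivisors
  obtain ⟨η, l, hη, hl, hl'⟩ := exists_hom_of_map_denIdeal_eq hsc ha hF hψ γ s hnzd hγc
  have hην : Spec.map (CommRingCat.ofHom η) ≫ E.2.fromSpec ≫ ν = D''.2.fromSpec ≫ g := by
    rw [← specMap_appLE ν D E hE, ← Category.assoc, ← specMap_comp, hη, specMap_appLE]
  refine ⟨_, inferInstance, D''.2.fromSpec, D''.2.isOpenImmersion_fromSpec,
    Spec.map (CommRingCat.ofHom η) ≫ E.2.fromSpec, ?_, ?_, ?_⟩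
  · exact D''.2.range_fromSpec.ge hxr
  · rw [Category.assoc, hην]
  · intro T t s' hts
    have := D''.2.isOpenImmersion_fromSpec
    exact agree_of_chart D E w ν σ hσ D''.2.fromSpec g _ hg γ
      (specMap_appLE g D D'' hD'').symm (γ (c s)) (hI ▸ hγc) η hην (k s) _ (ψ s) (hkw s) (hkσ s)
      l hl hl' t s' hts

end section_local

section section_local

variable {O N W : Scheme.{u}}

lemma exists_common_ideal (w : W ⟶ O) [IsOpenImmersion w] (t : Finset O.IdealSheafData)
    (ht : ∀ J ∈ t, ∀ x, w x ∉ J.support) :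
    ∃ I : O.IdealSheafData, (∀ x, w x ∉ I.support) ∧
      ∀ {O' : Scheme.{u}} (g : O' ⟶ O), IsInv (I.comap g) → ∀ J ∈ t, IsInv (J.comap g) := by
  classical
  induction t using Finset.induction_on with
  | empty =>
    refine ⟨⊤, fun x hx ↦ ?_, fun _ _ J hJ ↦ (Finset.notMem_empty J hJ).elim⟩
    rw [Scheme.IdealSheafData.support_top] at hx
    exact hx
  | insert J t hJ IH =>
    obtain ⟨I, hI, h⟩ := IH fun J' hJ' ↦ ht J' (Finset.mem_insert_of_mem hJ')
    refine ⟨J * I, fun x hx ↦ ?_, fun g hg J' hJ' ↦ ?_⟩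
    · rw [Scheme.IdealSheafData.support_mul] at hx
      exact hx.elim (ht J (Finset.mem_insert_self _ _) x) (hI x)
    · rw [comap_mul] at hg
      obtain rfl | hJ' := Finset.mem_insert.mp hJ'
      · exact hg.of_mul_left
      · exact h g hg.of_mul_right J' hJ'

lemma exists_dominate [IsNoetherian O] [IsNoetherian N] (w : W ⟶ O)
    [IsOpenImmersion w] (ν : N ⟶ O) [IsSeparated ν] [LocallyOfFiniteType ν] (σ : W ⟶ N)
    (hσ : σ ≫ ν = w)
    (hlift : ∀ {R K : Type u} [CommRing R] [IsDomain R] [ValuationRing R] [Field K] [Algebra R K]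
      [IsFractionRing R K] (i : Spec (.of K) ⟶ W) (b : Spec (.of R) ⟶ O),
      i ≫ w = Spec.map (CommRingCat.ofHom (algebraMap R K)) ≫ b →
      ∃ c : Spec (.of R) ⟶ N, Spec.map (CommRingCat.ofHom (algebraMap R K)) ≫ c = i ≫ σ ∧
        c ≫ ν = b) :
    ∃ I : O.IdealSheafData, (∀ x, x ∈ I.support ↔ x ∉ Set.range w) ∧
      ∀ {O' : Scheme.{u}} [IsNoetherian O'] (g : O' ⟶ O), IsInv (I.comap g) →
      ∃ h : O' ⟶ N, h ≫ ν = g ∧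
        ∀ {T : Scheme.{u}} (t : T ⟶ O') (s : T ⟶ W), t ≫ g = s ≫ w → t ≫ h = s ≫ σ := by
  classical
  have hpair (y : N) : ∃ (D : O.affineOpens) (E : N.affineOpens), y ∈ E.1 ∧ E.1 ≤ ν ⁻¹ᵁ D.1 := by
    obtain ⟨D, hD⟩ := exists_affineOpen_mem (ν y)
    obtain ⟨E, hE, hyE, hED⟩ := exists_isAffineOpen_mem_and_subset
      (show y ∈ ν ⁻¹ᵁ D.1 from hD)
    exact ⟨D, ⟨E, hE⟩, hyE, hED⟩
  choose D E hyE hED using hpair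
  choose J hJ hJ' using fun y ↦ exists_dom_ideal (D y) (E y) w ν σ hσ (hED y)
  obtain ⟨t, ht⟩ := (NoetherianSpace.isCompact (Set.univ : Set N)).elim_finite_subcover
    (fun y ↦ ((E y).1 : Set N)) (fun _ ↦ Opens.isOpen _) fun y _ ↦ Set.mem_iUnion.mpr ⟨y, hyE y⟩
  obtain ⟨I, hI, hI'⟩ := exists_common_ideal w (t.image J) fun J' hJ' ↦ by
    obtain ⟨y, -, rfl⟩ := Finset.mem_image.mp hJ'
    exact hJ y
  have hsupp (x) : x ∈ (I * complIdeal w).support ↔ x ∉ Set.range w := by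
    rw [Scheme.IdealSheafData.support_mul]
    refine ⟨fun h ↦ h.elim (fun h ↦ ?_) (mem_support_complIdeal w).mp,
      fun h ↦ Or.inr ((mem_support_complIdeal w).mpr h)⟩
    rintro ⟨y, rfl⟩
    exact hI y h
  refine ⟨I * complIdeal w, hsupp, fun {O'} _ g hg ↦ ?_⟩
  have hgJ (y) (hy : y ∈ t) : IsInv ((J y).comap g) := by
    have h := hg
    rw [comap_mul] at h
    exact hI' g h.of_mul_left _ (Finset.mem_image_of_mem J hy)
  have haway (x : O') (hx : x ∈ away ((I * complIdeal w).comap g)) : g x ∈ Set.range w := by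
    rw [mem_away, Scheme.IdealSheafData.support_comap] at hx
    exact not_not.mp fun h ↦ hx ((hsupp _).mpr h)
  have hchart (x : O') : ∃ (C : Type u) (_ : CommRing C) (j : Spec (.of C) ⟶ O')
      (_ : IsOpenImmersion j) (h : Spec (.of C) ⟶ N), x ∈ j.opensRange ∧ h ≫ ν = j ≫ g ∧
        ∀ {T : Scheme.{u}} (t : T ⟶ Spec (.of C)) (s : T ⟶ W), t ≫ j ≫ g = s ≫ w →
          t ≫ h = s ≫ σ := by
    have hx : x ∈ closure (Set.range (pullback.fst g w)) := by
      refine closure_mono ?_ (hg.dense x)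
      intro y hy
      obtain ⟨z, hz⟩ := haway y hy
      obtain ⟨p, hp, -⟩ := Scheme.Pullback.exists_preimage_pullback y z hz.symm
      exact ⟨p, hp⟩
    have : NoetherianSpace ↑(pullback g w) :=
      (pullback.fst g w).isOpenEmbedding.isInducing.noetherianSpace
    obtain ⟨q, hq⟩ := exists_valuativeCommSq_of_mem_closure _ hx
    obtain ⟨R, K, i₁, i₂, ⟨e⟩⟩ := q
    have hq : i₂ (cp R) = x := hq
    have e1 : (i₁ ≫ pullback.snd g w) ≫ w =
        Spec.map (CommRingCat.ofHom (algebraMap R K)) ≫ i₂ ≫ g := by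
      rw [Category.assoc, ← pullback.condition, reassoc_of% e]
    obtain ⟨c, hc, hc'⟩ := hlift _ _ e1
    obtain ⟨y, hy, hyc⟩ := Set.mem_iUnion₂.mp (ht (Set.mem_univ (c (cp R))))
    rw [← hq]
    exact hJ' y g (hgJ y hy) _ i₂ c e1 hc.symm hc' hyc
  choose C _ j hj h hxj hν hagree using hchart
  obtain ⟨F, hF⟩ := exists_glue j hxj h fun x y ↦ by
    refine (isInv_comap_of_flat hg (pullback.fst (j x) (j y) ≫ j x)).hom_ext ν ?_ le_rfl ?_
    · rw [Category.assoc, Category.assoc, hν, hν, pullback.condition_assoc]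
    · set V := away (((I * complIdeal w).comap g).comap (pullback.fst (j x) (j y) ≫ j x))
      have hr : Set.range (V.ι ≫ pullback.fst (j x) (j y) ≫ j x ≫ g) ⊆ Set.range w := by
        rintro _ ⟨z, rfl⟩
        have hz : V.ι z ∈ V := z.2
        have : (pullback.fst (j x) (j y) ≫ j x) (V.ι z) ∈ away ((I * complIdeal w).comap g) := by
          rw [mem_away, Scheme.IdealSheafData.support_comap] at hz
          exact hz
        have := haway _ this
        rwa [← Scheme.Hom.comp_apply, ← Scheme.Hom.comp_apply, Category.assoc] at this
      let s := IsOpenImmersion.lift w _ hr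
      have hs : s ≫ w = _ := IsOpenImmersion.lift_fac w _ hr
      have h1 := hagree x (V.ι ≫ pullback.fst (j x) (j y)) s (by rw [hs, Category.assoc])
      have h2 := hagree y (V.ι ≫ pullback.snd (j x) (j y)) s (by
        rw [hs, Category.assoc, pullback.condition_assoc])
      rw [← Category.assoc, ← Category.assoc, h1, h2]
  refine ⟨F, hom_ext_of_local fun x ↦ ⟨_, j x, hj x, hxj x, ?_⟩, fun {T} t s hts ↦
    hom_ext_of_local fun z ↦ ⟨_, pullback.fst t (j (t z)), inferInstance, ?_, ?_⟩⟩
  · rw [reassoc_of% hF, hν]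
  · obtain ⟨y, hy⟩ := hxj (t z)
    obtain ⟨p, hp, -⟩ := Scheme.Pullback.exists_preimage_pullback z y hy.symm
    exact ⟨p, hp⟩
  · rw [pullback.condition_assoc, hF, hagree _ _ (pullback.fst _ _ ≫ s), Category.assoc]
    rw [← pullback.condition_assoc, hts, Category.assoc]

end section_local

/-- Two schemes glued along a common open subscheme. -/
lemma exists_pushout_open {N A B : Scheme.{u}} (f : N ⟶ A) (g : N ⟶ B) [IsOpenImmersion f]
    [IsOpenImmersion g] :
    ∃ (Y : Scheme.{u}) (a : A ⟶ Y) (b : B ⟶ Y), IsOpenImmersion a ∧ IsOpenImmersion b ∧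
      f ≫ a = g ≫ b ∧ (∀ y, y ∈ Set.range a ∨ y ∈ Set.range b) ∧
      (∀ x y, a x = b y → ∃ z, f z = x ∧ g z = y) ∧
      ∀ {T : Scheme.{u}} (α : A ⟶ T) (β : B ⟶ T), f ≫ α = g ≫ β →
        ∃ γ : Y ⟶ T, a ≫ γ = α ∧ b ≫ γ = β := by
  refine ⟨pushout f g, pushout.inl f g, pushout.inr f g,
    inferInstanceAs (IsOpenImmersion (colimit.ι (span f g) WalkingSpan.left)),
    inferInstanceAs (IsOpenImmersion (colimit.ι (span f g) WalkingSpan.right)),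
    pushout.condition, ?_, ?_, ?_⟩
  · intro y
    obtain ⟨i, x, rfl⟩ := Scheme.IsLocallyDirected.ι_jointly_surjective (span f g) y
    obtain (_ | _ | _) := i
    · left
      refine ⟨f x, ?_⟩
      have h : f ≫ pushout.inl f g = colimit.ι (span f g) WalkingSpan.zero :=
        colimit.w (span f g) WalkingSpan.Hom.fst
      exact congrArg (fun e : N ⟶ pushout f g ↦ e (show N from x)) h
    · exact .inl ⟨x, rfl⟩
    · exact .inr ⟨x, rfl⟩
  · intro x y h
    obtain ⟨k, i, j, z, h1, h2⟩ := (Scheme.IsLocallyDirected.ι_eq_ι_iff (span f g)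
      (i := WalkingSpan.left) (j := WalkingSpan.right)).1 h
    obtain (_ | _ | _) := k
    · obtain rfl : i = WalkingSpan.Hom.fst := Subsingleton.elim _ _
      obtain rfl : j = WalkingSpan.Hom.snd := Subsingleton.elim _ _
      exact ⟨z, h1, h2⟩
    · nomatch j
    · nomatch i
  · intro T α β h
    exact ⟨pushout.desc α β h, pushout.inl_desc _ _ _, pushout.inr_desc _ _ _⟩

lemma exists_factor_of_mem {R : Type u} [CommRing R] [IsLocalRing R] (b : Spec (.of R) ⟶ X)
    (j : Y ⟶ X) [IsOpenImmersion j] (h : b (cp R) ∈ Set.range j) :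
    ∃ c : Spec (.of R) ⟶ Y, c ≫ j = b := by
  have := range_subset_of_closedPoint_mem b (U := j.opensRange) h
  exact ⟨IsOpenImmersion.lift j b this, IsOpenImmersion.lift_fac ..⟩

section Glue

variable {S P Q P' Q' N : Scheme.{u}} {p : P ⟶ S} {q : Q ⟶ S} {u : P' ⟶ P} {v : Q' ⟶ Q}
  {f : N ⟶ P'} {g : N ⟶ Q'} {a : P' ⟶ Y} {b : Q' ⟶ Y} {s : Y ⟶ S} [IsOpenImmersion u]
  [IsOpenImmersion v] [IsOpenImmersion f] [IsOpenImmersion a]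

  {R K : Type u} [CommRing R] [IsDomain R] [ValuationRing R] [Field K] [Algebra R K]
  [IsFractionRing R K]

lemma exists_lift_of_glue [IsProper p] [IsProper q] (hfg : f ≫ a = g ≫ b) (ha : a ≫ s = u ≫ p)
    (hb : b ≫ s = v ≫ q) (hF : IsClosed (u '' (Set.range f)ᶜ))
    (h₁ : ∀ x y, Conn p q (f ≫ u) (g ≫ v) x y → x ∈ Set.range u ∨ y ∈ Set.range v)
    (i : Spec (.of K) ⟶ Y) (c : Spec (.of R) ⟶ S)
    (h : i ≫ s = Spec.map (CommRingCat.ofHom (algebraMap R K)) ≫ c)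
    (hi : i (cp K) ∈ Set.range a) :
    ∃ l : Spec (.of R) ⟶ Y, Spec.map (CommRingCat.ofHom (algebraMap R K)) ≫ l = i ∧ l ≫ s = c := by
  obtain ⟨i, rfl⟩ := exists_factor_of_mem _ _ hi
  rw [Category.assoc, ha, ← Category.assoc] at h
  obtain ⟨l, h2, h3⟩ := exists_lift_of_valuationRing p _ _ h
  by_cases hl : l (cp R) ∈ Set.range u
  · obtain ⟨l, rfl⟩ := exists_factor_of_mem _ _ hl
    rw [← Category.assoc, cancel_mono] at h2
    exact ⟨l ≫ a, by rw [← h2, Category.assoc], by rw [← h3, Category.assoc, ha, Category.assoc]⟩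
  have hf : i (cp K) ∈ Set.range f := by
    by_contra hf
    have hm : l (Spec.map (CommRingCat.ofHom (algebraMap R K)) (cp K)) ∈ u '' (Set.range f)ᶜ := by
      rw [← Scheme.Hom.comp_apply, h2, Scheme.Hom.comp_apply]
      exact ⟨_, hf, rfl⟩
    obtain ⟨z, -, hz⟩ := ((specializes_cp (R := R) _).map l.continuous).mem_closed hF hm
    exact hl ⟨z, hz⟩
  obtain ⟨i, rfl⟩ := exists_factor_of_mem _ _ hf
  have h' : (i ≫ g ≫ v) ≫ q = Spec.map (CommRingCat.ofHom (algebraMap R K)) ≫ c := by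
    rw [← h, Category.assoc, Category.assoc, ← hb, ← reassoc_of% hfg, ha]
    simp only [Category.assoc]
  obtain ⟨m, h4, h5⟩ := exists_lift_of_valuationRing q _ _ h'
  have hm : m (cp R) ∈ Set.range v := (h₁ _ _ ⟨R, _, ‹_›, ‹_›, K, _, _, ‹_›, i, l, m,
    by rw [h2, Category.assoc], by rw [h4], by rw [h3, h5], rfl, rfl⟩).resolve_left hl
  obtain ⟨m, rfl⟩ := exists_factor_of_mem _ _ hm
  rw [← Category.assoc, ← Category.assoc, cancel_mono] at h4
  exact ⟨m ≫ b, by rw [reassoc_of% h4, Category.assoc, hfg],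
    by rw [← h5, Category.assoc, hb, Category.assoc]⟩

lemma eq_of_glue [IsSeparated p] (ha : a ≫ s = u ≫ p) (l₁ l₂ : Spec (.of R) ⟶ Y)
    (h : Spec.map (CommRingCat.ofHom (algebraMap R K)) ≫ l₁ =
      Spec.map (CommRingCat.ofHom (algebraMap R K)) ≫ l₂) (hs : l₁ ≫ s = l₂ ≫ s)
    (h₁ : l₁ (cp R) ∈ Set.range a) (h₂ : l₂ (cp R) ∈ Set.range a) : l₁ = l₂ := by
  obtain ⟨l₁, rfl⟩ := exists_factor_of_mem _ _ h₁
  obtain ⟨l₂, rfl⟩ := exists_factor_of_mem _ _ h₂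
  congr 1
  rw [← cancel_mono u]
  refine ext_of_valuationRing p (K := K) ?_ ?_
  · simpa only [Category.assoc, ha] using hs
  · rw [← Category.assoc, ← Category.assoc, cancel_mono] at h
    rw [reassoc_of% h]

lemma eq_of_glue' [IsOpenImmersion g] [IsOpenImmersion b] [IsSeparated p] [IsSeparated q] (hfg : f ≫ a = g ≫ b) (ha : a ≫ s = u ≫ p)
    (hb : b ≫ s = v ≫ q) (hab : ∀ x y, a x = b y → ∃ z, f z = x ∧ g z = y)
    (h₂ : ∀ x y, Conn p q (f ≫ u) (g ≫ v) (u x) (v y) → x ∈ Set.range f ∨ y ∈ Set.range g)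
    (l₁ l₂ : Spec (.of R) ⟶ Y) (h : Spec.map (CommRingCat.ofHom (algebraMap R K)) ≫ l₁ =
      Spec.map (CommRingCat.ofHom (algebraMap R K)) ≫ l₂) (hs : l₁ ≫ s = l₂ ≫ s)
    (hl₁ : l₁ (cp R) ∈ Set.range a) (hl₂ : l₂ (cp R) ∈ Set.range b) : l₁ = l₂ := by
  obtain ⟨m₁, rfl⟩ := exists_factor_of_mem _ _ hl₁
  obtain ⟨m₂, rfl⟩ := exists_factor_of_mem _ _ hl₂
  have hr : (Spec.map (CommRingCat.ofHom (algebraMap R K)) ≫ m₁) (cp K) ∈ Set.range f := by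
    obtain ⟨z, hz, -⟩ := hab ((Spec.map (CommRingCat.ofHom (algebraMap R K)) ≫ m₁) (cp K))
      ((Spec.map (CommRingCat.ofHom (algebraMap R K)) ≫ m₂) (cp K)) (by
        rw [← Scheme.Hom.comp_apply, ← Scheme.Hom.comp_apply, Category.assoc, Category.assoc, h])
    exact ⟨z, hz⟩
  obtain ⟨i, hi⟩ := exists_factor_of_mem _ _ hr
  have hi' : i ≫ g = Spec.map (CommRingCat.ofHom (algebraMap R K)) ≫ m₂ := by
    rw [← cancel_mono b, Category.assoc, Category.assoc, ← h, ← hfg, reassoc_of% hi]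
  have hc : Conn p q (f ≫ u) (g ≫ v) (u (m₁ (cp R))) (v (m₂ (cp R))) :=
    ⟨R, _, ‹_›, ‹_›, K, _, _, ‹_›, i, m₁ ≫ u, m₂ ≫ v, by rw [reassoc_of% hi],
      by rw [reassoc_of% hi'], by simpa only [Category.assoc, ha, hb] using hs,
      by rw [Scheme.Hom.comp_apply], by rw [Scheme.Hom.comp_apply]⟩
  obtain hc | hc := h₂ _ _ hc
  · obtain ⟨m, rfl⟩ := exists_factor_of_mem _ _ hc
    refine eq_of_glue (K := K) hb _ _ h hs ?_ hl₂
    rw [Category.assoc, hfg, Scheme.Hom.comp_apply, Scheme.Hom.comp_apply]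
    exact ⟨_, rfl⟩
  · obtain ⟨m, rfl⟩ := exists_factor_of_mem _ _ hc
    refine eq_of_glue (K := K) ha _ _ h hs hl₁ ?_
    rw [Category.assoc, ← hfg, Scheme.Hom.comp_apply, Scheme.Hom.comp_apply]
    exact ⟨_, rfl⟩

lemma isProper_of_glue [IsOpenImmersion g] [IsOpenImmersion b] [IsNoetherian S] [IsProper p] [IsProper q] (hfg : f ≫ a = g ≫ b)
    (ha : a ≫ s = u ≫ p)
    (hb : b ≫ s = v ≫ q) (hab : ∀ x y, a x = b y → ∃ z, f z = x ∧ g z = y)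
    (hY : ∀ y, y ∈ Set.range a ∨ y ∈ Set.range b) (hF : IsClosed (u '' (Set.range f)ᶜ))
    (hG : IsClosed (v '' (Set.range g)ᶜ))
    (h₁ : ∀ x y, Conn p q (f ≫ u) (g ≫ v) x y → x ∈ Set.range u ∨ y ∈ Set.range v)
    (h₂ : ∀ x y, Conn p q (f ≫ u) (g ≫ v) (u x) (v y) → x ∈ Set.range f ∨ y ∈ Set.range g) :
    IsProper s := by
  have := isNoetherian_of_finiteType p
  have := isNoetherian_of_finiteType q
  have : LocallyOfFiniteType s := by
    choose T j hj hy hl using show ∀ y : Y, ∃ (T : Scheme.{u}) (j : T ⟶ Y) (_ : IsOpenImmersion j),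
        y ∈ j.opensRange ∧ (LocallyOfFiniteType (j ≫ s)) from fun y ↦ by
      obtain h | h := hY y
      · exact ⟨_, a, ‹_›, h, by rw [ha]; infer_instance⟩
      · exact ⟨_, b, ‹_›, h, by rw [hb]; infer_instance⟩
    have : IsZariskiLocalAtSource @LocallyOfFiniteType :=
      HasRingHomProperty.instIsZariskiLocalAtSource (Q := RingHom.FiniteType)
    exact (IsZariskiLocalAtSource.iff_of_openCover (P := @LocallyOfFiniteType)
      (.mkOfCovers Y T j fun x ↦ ⟨x, hy x⟩)).2 hl
  have := LocallyOfFiniteType.isLocallyNoetherian s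
  have : NoetherianSpace P' := u.isOpenEmbedding.isInducing.noetherianSpace
  have : NoetherianSpace Q' := v.isOpenEmbedding.isInducing.noetherianSpace
  have : CompactSpace Y := by
    rw [← isCompact_univ_iff, ← Set.univ_subset_iff.1 (fun y _ ↦ hY y)]
    exact (isCompact_range a.continuous).union (isCompact_range b.continuous)
  have : IsNoetherian Y := {}
  have : QuasiCompact s := quasiCompact_of_noetherianSpace_source s
  refine IsProper.of_valuativeCriterion s ((ValuativeCriterion.iff).2 ⟨?_, ?_⟩)
  · rintro ⟨R, K, i, c, ⟨h⟩⟩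
    suffices ∃ l : Spec (.of R) ⟶ Y, Spec.map (CommRingCat.ofHom (algebraMap R K)) ≫ l = i ∧
        l ≫ s = c by
      obtain ⟨l, h1, h2⟩ := this
      exact ⟨⟨⟨l, h1, h2⟩⟩⟩
    obtain hi | hi := hY (i (cp K))
    · exact exists_lift_of_glue hfg ha hb hF h₁ i c h hi
    · exact exists_lift_of_glue hfg.symm hb ha hG (fun x y h ↦ (h₁ y x h.symm).symm) i c h hi
  · rintro ⟨R, K, i, c, ⟨h⟩⟩
    refine ⟨fun ⟨l₁, h1, h2⟩ ⟨l₂, h3, h4⟩ ↦ ?_⟩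
    suffices l₁ = l₂ by subst this; rfl
    have e := h1.trans h3.symm
    have e' := h2.trans h4.symm
    obtain hi | hi := hY (l₁ (cp R)) <;> obtain hj | hj := hY (l₂ (cp R))
    · exact eq_of_glue (K := K) ha _ _ e e' hi hj
    · exact eq_of_glue' (K := K) hfg ha hb hab h₂ _ _ e e' hi hj
    · exact (eq_of_glue' (K := K) hfg ha hb hab h₂ _ _ e.symm e'.symm hj hi).symm
    · exact eq_of_glue (K := K) hb _ _ e e' hi hj

end Glue

/-- Morphisms out of a union of two open subschemes. -/
lemma exists_desc_of_cover {U V : Scheme.{u}} (i : U ⟶ X) (j : V ⟶ X) [IsOpenImmersion i]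
    [IsOpenImmersion j] (hX : ∀ x, x ∈ Set.range i ∨ x ∈ Set.range j) (α : U ⟶ Y) (β : V ⟶ Y)
    (h : ∀ {T : Scheme.{u}} (s : T ⟶ U) (t : T ⟶ V), s ≫ i = t ≫ j → s ≫ α = t ≫ β) :
    ∃ γ : X ⟶ Y, i ≫ γ = α ∧ j ≫ γ = β := by
  choose T k hk m hm hT using show ∀ x : X, ∃ (T : Scheme.{u}) (k : T ⟶ X) (_ : IsOpenImmersion k)
      (m : T ⟶ Y), x ∈ k.opensRange ∧ ((∃ e : T ⟶ U, e ≫ i = k ∧ e ≫ α = m) ∨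
        ∃ e : T ⟶ V, e ≫ j = k ∧ e ≫ β = m) from fun x ↦ by
    obtain hx | hx := hX x
    · exact ⟨U, i, ‹_›, α, hx, .inl ⟨𝟙 _, Category.id_comp _, Category.id_comp _⟩⟩
    · exact ⟨V, j, ‹_›, β, hx, .inr ⟨𝟙 _, Category.id_comp _, Category.id_comp _⟩⟩
  have key : ∀ {A : Scheme.{u}} (x y : X) (s : A ⟶ T x) (t : A ⟶ T y), s ≫ k x = t ≫ k y →
      s ≫ m x = t ≫ m y := by
    intro A x y s t e
    obtain ⟨a, ha, ha'⟩ | ⟨a, ha, ha'⟩ := hT x <;> obtain ⟨b, hb, hb'⟩ | ⟨b, hb, hb'⟩ := hT y <;>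
      rw [← ha, ← hb, ← Category.assoc, ← Category.assoc] at e <;> rw [← ha', ← hb', ← Category.assoc, ← Category.assoc]
    · rw [(cancel_mono i).1 e]
    · exact h _ _ e
    · exact (h _ _ e.symm).symm
    · rw [(cancel_mono j).1 e]
  obtain ⟨γ, hγ⟩ := exists_glue k hm m fun x y ↦ key x y _ _ pullback.condition
  refine ⟨γ, ?_, ?_⟩
  · refine hom_ext_of_local fun x ↦ ?_
    refine ⟨_, pullback.fst i (k (i x)), inferInstance, ?_, ?_⟩
    · obtain ⟨y, hy⟩ := hm (i x)
      obtain ⟨z, hz, -⟩ := Scheme.Pullback.exists_preimage_pullback x y hy.symm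
      exact ⟨z, hz⟩
    · rw [pullback.condition_assoc, hγ]
      obtain ⟨e, h1, h2⟩ | ⟨e, h1, h2⟩ := hT (i x)
      · rw [← h2, ← Category.assoc]
        congr 1
        rw [← cancel_mono i, Category.assoc, h1, pullback.condition]
      · rw [← h2, ← Category.assoc]
        exact (h _ _ (by rw [Category.assoc, h1, pullback.condition])).symm
  · refine hom_ext_of_local fun x ↦ ?_
    refine ⟨_, pullback.fst j (k (j x)), inferInstance, ?_, ?_⟩
    · obtain ⟨y, hy⟩ := hm (j x)
      obtain ⟨z, hz, -⟩ := Scheme.Pullback.exists_preimage_pullback x y hy.symm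
      exact ⟨z, hz⟩
    · rw [pullback.condition_assoc, hγ]
      obtain ⟨e, h1, h2⟩ | ⟨e, h1, h2⟩ := hT (j x)
      · rw [← h2, ← Category.assoc]
        exact h _ _ (by rw [Category.assoc, h1, pullback.condition])
      · rw [← h2, ← Category.assoc]
        congr 1
        rw [← cancel_mono j, Category.assoc, h1, pullback.condition]

lemma isOpenImmersion_of_local (k : X ⟶ Y) (hk : Function.Injective k)
    (h : ∀ x, ∃ (T : Scheme.{u}) (j : T ⟶ X) (_ : IsOpenImmersion j), x ∈ j.opensRange ∧
      IsOpenImmersion (j ≫ k)) : IsOpenImmersion k := by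
  have : ∀ x, IsIso (k.stalkMap x) := by
    intro x
    obtain ⟨T, j, hj, ⟨y, rfl⟩, h⟩ := h x
    have e := Scheme.Hom.stalkMap_comp j k y
    have : IsIso (k.stalkMap (j y) ≫ j.stalkMap y) := by
      have e' : IsIso ((j ≫ k).stalkMap y) := inferInstance
      rwa [e] at e'
    exact IsIso.of_isIso_comp_right _ (j.stalkMap y)
  refine IsOpenImmersion.of_isIso_stalkMap k (.of_continuous_injective_isOpenMap k.continuous hk ?_)
  intro O hO
  rw [isOpen_iff_forall_mem_open]
  rintro _ ⟨x, hx, rfl⟩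
  obtain ⟨T, j, hj, ⟨y, rfl⟩, h⟩ := h x
  refine ⟨(j ≫ k) '' (j ⁻¹' O), ?_, (j ≫ k).isOpenEmbedding.isOpenMap _ (hO.preimage j.continuous),
    ⟨y, hx, by rw [Scheme.Hom.comp_apply]⟩⟩
  rintro _ ⟨z, hz, rfl⟩
  exact ⟨j z, hz, by rw [Scheme.Hom.comp_apply]⟩

/-- Two partial compactifications of the members of an open cover glue to a compactification. -/
lemma exists_compactification_of_glue {S P Q P' Q' N U V W : Scheme.{u}} [IsNoetherian S]
    (p : P ⟶ S) (q : Q ⟶ S) [IsProper p] [IsProper q] (u : P' ⟶ P) (v : Q' ⟶ Q)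
    [IsOpenImmersion u] [IsOpenImmersion v] (f : N ⟶ P') (g : N ⟶ Q') [IsOpenImmersion f]
    [IsOpenImmersion g] (hfg : f ≫ u ≫ p = g ≫ v ≫ q)
    (hF : IsClosed (u '' (Set.range f)ᶜ)) (hG : IsClosed (v '' (Set.range g)ᶜ))
    (h₁ : ∀ x y, Conn p q (f ≫ u) (g ≫ v) x y → x ∈ Set.range u ∨ y ∈ Set.range v)
    (h₂ : ∀ x y, Conn p q (f ≫ u) (g ≫ v) (u x) (v y) → x ∈ Set.range f ∨ y ∈ Set.range g)
    (x : X ⟶ S) (i : U ⟶ X) (j : V ⟶ X) [IsOpenImmersion i] [IsOpenImmersion j]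
    (hX : ∀ x, x ∈ Set.range i ∨ x ∈ Set.range j) {a : W ⟶ U} {b : W ⟶ V}
    (hW : IsPullback a b i j) (k : U ⟶ P') (l : V ⟶ Q') [IsOpenImmersion k] [IsOpenImmersion l]
    (m : W ⟶ N) (hk : a ≫ k = m ≫ f) (hl : b ≫ l = m ≫ g)
    (hN : ∀ z s t, f z = k s → g z = l t → s ∈ Set.range a ∨ t ∈ Set.range b)
    (hi : i ≫ x = k ≫ u ≫ p) (hj : j ≫ x = l ≫ v ≫ q) :
    ∃ (Y : Scheme.{u}) (y : Y ⟶ S) (n : X ⟶ Y), IsProper y ∧ IsOpenImmersion n ∧ n ≫ y = x := by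
  obtain ⟨Y, c, d, hc, hd, hcd, hY, hab, hdesc⟩ := exists_pushout_open f g
  obtain ⟨y, h3, h4⟩ := hdesc _ _ hfg
  obtain ⟨n, h5, h6⟩ := exists_desc_of_cover i j hX (k ≫ c) (l ≫ d) (by
    intro T s t e
    obtain ⟨r, rfl, rfl⟩ := hW.exists_lift s t e
    rw [Category.assoc, Category.assoc, reassoc_of% hk, reassoc_of% hl, hcd])
  have hac : ∀ w, i (a w) = j (b w) := fun w ↦ by
    rw [← Scheme.Hom.comp_apply, ← Scheme.Hom.comp_apply, hW.w]
  have hni : ∀ s, n (i s) = c (k s) := fun s ↦ by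
    rw [← Scheme.Hom.comp_apply, ← Scheme.Hom.comp_apply, h5]
  have hnj : ∀ s, n (j s) = d (l s) := fun s ↦ by
    rw [← Scheme.Hom.comp_apply, ← Scheme.Hom.comp_apply, h6]
  have key : ∀ s t, n (i s) = n (j t) → i s = j t := by
    intro s t e
    have e' := e
    rw [hni, hnj] at e
    obtain ⟨z, hz, hz'⟩ := hab _ _ e
    obtain ⟨w, rfl⟩ | ⟨w, rfl⟩ := hN z s t hz hz'
    · rw [hac, hnj, hnj] at e'
      rw [hac, l.isOpenEmbedding.injective (d.isOpenEmbedding.injective e')]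
    · rw [← hac, hni, hni] at e'
      rw [← hac, k.isOpenEmbedding.injective (c.isOpenEmbedding.injective e')]
  refine ⟨Y, y, n, isProper_of_glue (p := p) (q := q) (u := u) (v := v) hcd h3 h4 hab hY hF hG
    h₁ h₂, isOpenImmersion_of_local n ?_ ?_, ?_⟩
  · intro s t e
    obtain ⟨s, rfl⟩ | ⟨s, rfl⟩ := hX s <;> obtain ⟨t, rfl⟩ | ⟨t, rfl⟩ := hX t
    · rw [hni, hni] at e
      rw [k.isOpenEmbedding.injective (c.isOpenEmbedding.injective e)]
    · exact key _ _ e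
    · exact (key _ _ e.symm).symm
    · rw [hnj, hnj] at e
      rw [l.isOpenEmbedding.injective (d.isOpenEmbedding.injective e)]
  · intro s
    obtain hs | hs := hX s
    · exact ⟨U, i, ‹_›, hs, by rw [h5]; infer_instance⟩
    · exact ⟨V, j, ‹_›, hs, by rw [h6]; infer_instance⟩
  · refine hom_ext_of_local fun s ↦ ?_
    obtain hs | hs := hX s
    · exact ⟨U, i, ‹_›, hs, by rw [reassoc_of% h5, h3, hi]⟩
    · exact ⟨V, j, ‹_›, hs, by rw [reassoc_of% h6, h4, hj]⟩

lemma exists_factor_openImmersion (f : T ⟶ X) (j : Y ⟶ X) [IsOpenImmersion j]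
    (h : ∀ t, f t ∈ Set.range j) : ∃ g : T ⟶ Y, g ≫ j = f := by
  have : Set.range f ⊆ Set.range j := by rintro _ ⟨t, rfl⟩; exact h t
  exact ⟨IsOpenImmersion.lift j f this, IsOpenImmersion.lift_fac ..⟩

/-- A blow-up is an isomorphism away from its centre. -/
lemma IsBlowup.mem_range {b : Y ⟶ X} {J : X.IdealSheafData} (h : IsBlowup b J) (w : Z ⟶ X)
    [IsOpenImmersion w] (hw : J.comap w = ⊤) (w' : Z ⟶ Y) (hw' : w' ≫ b = w) {y : Y}
    (hy : b y ∈ Set.range w) : y ∈ Set.range w' := by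
  obtain ⟨z, hz⟩ := hy
  obtain ⟨t, ht, ht'⟩ := Scheme.Pullback.exists_preimage_pullback y z hz.symm
  have hI : IsInv (J.comap (pullback.fst b w ≫ b)) := by
    rw [pullback.condition, Scheme.IdealSheafData.comap_comp, hw, Scheme.IdealSheafData.comap_top]
    exact .top
  have := (h.2 _ hI).unique (y₁ := pullback.fst b w) (y₂ := pullback.snd b w ≫ w') rfl
    (by rw [Category.assoc, hw', pullback.condition])
  rw [← ht, this, Scheme.Hom.comp_apply]
  exact ⟨_, rfl⟩

lemma IsBlowup.denseRange [IsLocallyNoetherian Y] {b : Y ⟶ X} {J : X.IdealSheafData}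
    (h : IsBlowup b J) (w : Z ⟶ X) [IsOpenImmersion w] (hJ : ∀ x, x ∈ J.support ↔ x ∉ Set.range w)
    (w' : Z ⟶ Y) (hw' : w' ≫ b = w) : DenseRange w' := by
  have hw : J.comap w = ⊤ := comap_eq_top _ fun x hx ↦ (hJ _).1 hx ⟨x, rfl⟩
  refine h.1.dense.mono fun y hy ↦ h.mem_range w hw w' hw' ?_
  by_contra hc
  refine mem_away.1 hy ?_
  rw [Scheme.IdealSheafData.support_comap]
  exact (hJ _).2 hc

section

variable {S P Q W G U V : Scheme.{u}} {p : P ⟶ S} {q : Q ⟶ S} {f : W ⟶ P} {g : W ⟶ Q} {x : P}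
  {y : Q}

lemma Conn.of_denseRange [NoetherianSpace W] [NoetherianSpace G] (h : f ≫ p = g ≫ q)
    (t : G ⟶ W) (ht : DenseRange t) (hc : Conn p q f g x y) : Conn p q (t ≫ f) (t ≫ g) x y := by
  rw [conn_iff h] at hc
  rw [conn_iff (by rw [Category.assoc, h, Category.assoc])]
  obtain ⟨z, hz, h1, h2⟩ := hc
  refine ⟨z, ?_, h1, h2⟩
  have e : pullback.lift (t ≫ f) (t ≫ g) (by rw [Category.assoc, h, Category.assoc]) =
      t ≫ pullback.lift f g h := by
    apply pullback.hom_ext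
    · exact (pullback.lift_fst ..).trans (by rw [Category.assoc, pullback.lift_fst])
    · exact (pullback.lift_snd ..).trans (by rw [Category.assoc, pullback.lift_snd])
  have hr : Set.range (t ≫ pullback.lift f g h) = pullback.lift f g h '' Set.range t := by
    rw [← Set.range_comp]
    congr 1
  rw [e, hr]
  refine closure_minimal ?_ isClosed_closure hz
  rintro _ ⟨w, rfl⟩
  exact image_closure_subset_closure_image (pullback.lift f g h).continuous ⟨w, ht w, rfl⟩

lemma conn_of_isSeparated (s : X ⟶ S) [IsSeparated s] (i : U ⟶ X) (j : V ⟶ X) (u : U ⟶ P)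
    (v : V ⟶ Q) [IsOpenImmersion u] [IsOpenImmersion v] (hu : u ≫ p = i ≫ s) (hv : v ≫ q = j ≫ s)
    {a : W ⟶ U} {b : W ⟶ V} (hW : a ≫ i = b ≫ j) {x : U} {y : V}
    (h : Conn p q (a ≫ u) (b ≫ v) (u x) (v y)) : i x = j y := by
  obtain ⟨R, _, _, _, K, _, _, _, t, A, B, h1, h2, h3, h4, h5⟩ := h
  obtain ⟨A, rfl⟩ := exists_factor_of_mem A u ⟨x, h4.symm⟩
  obtain ⟨B, rfl⟩ := exists_factor_of_mem B v ⟨y, h5.symm⟩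
  rw [Scheme.Hom.comp_apply] at h4 h5
  rw [← u.isOpenEmbedding.injective h4, ← v.isOpenEmbedding.injective h5]
  rw [← Category.assoc, ← Category.assoc, cancel_mono] at h1 h2
  have : A ≫ i = B ≫ j := by
    refine ext_of_valuationRing s (K := K) ?_ ?_
    · simpa only [Category.assoc, hu, hv] using h3
    · rw [← reassoc_of% h1, ← reassoc_of% h2, hW]
  rw [← Scheme.Hom.comp_apply, ← Scheme.Hom.comp_apply, this]

/-- A dense section of a separated morphism over an open subscheme is everything lying over it. -/
lemma mem_range_of_denseRange [NoetherianSpace G] [IsOpenImmersion f] (r : G ⟶ P) [IsSeparated r]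
    (w : W ⟶ G) (hw : DenseRange w) (hr : w ≫ r = f) {z : G} (hz : r z ∈ Set.range f) :
    z ∈ Set.range w := by
  have : NoetherianSpace W := by
    have : IsOpenImmersion (w ≫ r) := by rw [hr]; infer_instance
    refine (show Topology.IsInducing w from ?_).noetherianSpace
    have h : Topology.IsInducing (r ∘ w) := by
      have := (w ≫ r).isOpenEmbedding.isInducing
      rwa [Scheme.Hom.comp_base] at this
    exact .of_comp w.continuous r.continuous h
  obtain ⟨c, hc⟩ := exists_valuativeCommSq_of_mem_closure w (hw z)
  obtain ⟨R, K, i, a, ⟨e⟩⟩ := c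
  have hc : a (cp R) = z := hc
  obtain ⟨a', ha'⟩ := exists_factor_of_mem (a ≫ r) f (by rwa [Scheme.Hom.comp_apply, hc])
  have : a' ≫ w = a := by
    refine ext_of_valuationRing r (K := K) (by rw [Category.assoc, hr, ha']) ?_
    rw [← e, ← Category.assoc]
    congr 1
    rw [← cancel_mono f, Category.assoc, ha', ← reassoc_of% e, hr]
  rw [← hc, ← this, Scheme.Hom.comp_apply]
  exact ⟨_, rfl⟩

end

lemma exists_opens_compl {T : Set X} (hT : IsClosed T) : ∃ O : X.Opens,
    ∀ x, x ∈ Set.range O.ι ↔ x ∉ T :=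
  ⟨⟨Tᶜ, hT.isOpen_compl⟩, fun x ↦ by rw [Scheme.Opens.range_ι]; rfl⟩

lemma mem_range_of_isPullback {P : Scheme.{u}} {f : P ⟶ X} {g : P ⟶ Y} {h : X ⟶ Z} {k : Y ⟶ Z}
    (H : IsPullback f g h k) (x : X) : x ∈ Set.range f ↔ h x ∈ Set.range k := by
  constructor
  · rintro ⟨z, rfl⟩
    rw [← Scheme.Hom.comp_apply, H.w, Scheme.Hom.comp_apply]
    exact ⟨_, rfl⟩
  · rintro ⟨y, hy⟩
    obtain ⟨z, hz, -⟩ := Scheme.exists_preimage_of_isPullback H x y hy.symm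
    exact ⟨z, hz⟩

lemma isOpenImmersion_of_isPullback {P : Scheme.{u}} {f : P ⟶ X} {g : P ⟶ Y} {h : X ⟶ Z}
    {k : Y ⟶ Z} (H : IsPullback f g h k) [IsOpenImmersion k] : IsOpenImmersion f :=
  MorphismProperty.of_isPullback H.flip ‹_›

section

variable {S P Q W U V : Scheme.{u}}

/-- After a `V`-admissible blow-up, the rational map `Q ⇢ P` becomes a morphism on the complement
of `T`. -/
lemma exists_graph [IsNoetherian S] (p : P ⟶ S) (q : Q ⟶ S) [IsProper p] [IsProper q] (u : U ⟶ P)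
    (v : V ⟶ Q) (wU : W ⟶ U) (wV : W ⟶ V) [IsOpenImmersion u] [IsOpenImmersion v]
    [IsOpenImmersion wU] [IsOpenImmersion wV] (h : (wU ≫ u) ≫ p = (wV ≫ v) ≫ q) {T : Set Q}
    (hT : IsClosed T) (hv : ∀ b, v b ∈ T ↔ b ∉ Set.range wV) :
    ∃ (Q' G : Scheme.{u}) (γ : Q' ⟶ Q) (v' : V ⟶ Q') (j : G ⟶ Q') (r : G ⟶ P) (w : W ⟶ G),
      IsProper γ ∧ IsOpenImmersion v' ∧ v' ≫ γ = v ∧ IsOpenImmersion j ∧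
      (∀ y, y ∈ Set.range j ↔ γ y ∉ T) ∧ r ≫ p = j ≫ γ ≫ q ∧ w ≫ j = wV ≫ v' ∧
      w ≫ r = wU ≫ u ∧ DenseRange w := by
  have := isNoetherian_of_finiteType p
  have := isNoetherian_of_finiteType q
  obtain ⟨O, hO⟩ := exists_opens_compl hT
  obtain ⟨w₁, hw₁⟩ := exists_factor_openImmersion (wV ≫ v) O.ι fun t ↦ by
    rw [Scheme.Hom.comp_apply, hO, hv, not_not]
    exact ⟨t, rfl⟩
  have : IsOpenImmersion (w₁ ≫ O.ι) := by rw [hw₁]; infer_instance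
  have : IsOpenImmersion w₁ := IsOpenImmersion.of_comp w₁ O.ι
  have := isNoetherian_of_finiteType O.ι
  let ν := pullback.fst (O.ι ≫ q) p
  have := isNoetherian_of_finiteType ν
  have hσ : w₁ ≫ O.ι ≫ q = (wU ≫ u) ≫ p := by rw [reassoc_of% hw₁, h, Category.assoc]
  let σ := pullback.lift w₁ (wU ≫ u) hσ
  obtain ⟨I, hI, hdom⟩ := exists_dominate w₁ ν σ (pullback.lift_fst ..) (by
    intro R K _ _ _ _ _ _ i b hib
    exact exists_lift_of_valuationRing ν (i ≫ σ) b
      (by rw [Category.assoc, pullback.lift_fst, hib]))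
  obtain ⟨Q', G, γ, j, γ', v', hγ, hv', hvγ, hp, hbl⟩ := exists_admissible_blowup O.ι v I (by
    rintro x hx ⟨b, hb⟩
    refine (hI x).1 hx ?_
    have : v b ∉ T := by rw [hb]; exact (hO _).1 ⟨x, rfl⟩
    rw [hv, not_not] at this
    obtain ⟨z, rfl⟩ := this
    refine ⟨z, O.ι.isOpenEmbedding.injective ?_⟩
    rw [← Scheme.Hom.comp_apply, hw₁, Scheme.Hom.comp_apply, hb])
  have := isNoetherian_of_finiteType γ
  have hj := isOpenImmersion_of_isPullback hp
  have := isNoetherian_of_finiteType j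
  obtain ⟨ρ, hρ, hρ'⟩ := hdom γ' hbl.1
  obtain ⟨w, hwj, hwγ⟩ := hp.exists_lift (wV ≫ v') w₁ (by rw [Category.assoc, hvγ, hw₁])
  refine ⟨Q', G, γ, v', j, ρ ≫ pullback.snd (O.ι ≫ q) p, w, hγ, hv', hvγ, hj, ?_, ?_, hwj, ?_,
    hbl.denseRange w₁ hI w hwγ⟩
  · intro y
    rw [mem_range_of_isPullback hp, hO]
  · rw [Category.assoc, ← pullback.condition, reassoc_of% hp.w, ← hρ]
    simp only [Category.assoc, ν]
  · have := hρ' w (𝟙 _) (by rw [hwγ, Category.id_comp])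
    rw [reassoc_of% this]
    exact pullback.lift_snd ..

/-- A separated morphism `ν : N ⟶ O` which is an isomorphism over `W` becomes an isomorphism after
blowing up, if it satisfies the valuative criterion for maps which are generically in `W`. -/
lemma exists_common_blowup {O N : Scheme.{u}} [IsNoetherian P] [IsNoetherian Q] (w : W ⟶ O)
    (ν : N ⟶ O) (w' : W ⟶ N) [IsOpenImmersion w] [IsOpenImmersion w'] [IsSeparated ν]
    [LocallyOfFiniteType ν] (hw : w' ≫ ν = w)
    (hlift : ∀ {R K : Type u} [CommRing R] [IsDomain R] [ValuationRing R] [Field K] [Algebra R K]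
      [IsFractionRing R K] (i : Spec (.of K) ⟶ W) (b : Spec (.of R) ⟶ O),
      i ≫ w = Spec.map (CommRingCat.ofHom (algebraMap R K)) ≫ b →
      ∃ c : Spec (.of R) ⟶ N, Spec.map (CommRingCat.ofHom (algebraMap R K)) ≫ c = i ≫ w' ∧
        c ≫ ν = b)
    (hmem : ∀ z, ν z ∈ Set.range w → z ∈ Set.range w') (o : O ⟶ P) (n : N ⟶ Q)
    [IsOpenImmersion o] [IsOpenImmersion n] (u : U ⟶ P) (v : V ⟶ Q) [IsOpenImmersion u]
    [IsOpenImmersion v] (hu : ∀ x, o x ∈ Set.range u → x ∈ Set.range w)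
    (hv : ∀ x, n x ∈ Set.range v → x ∈ Set.range w') (wU : W ⟶ U) (wV : W ⟶ V)
    (hwU : wU ≫ u = w ≫ o) (hwV : wV ≫ v = w' ≫ n) :
    ∃ (P' Q' M : Scheme.{u}) (β : P' ⟶ P) (γ : Q' ⟶ Q) (u' : U ⟶ P') (v' : V ⟶ Q') (a : M ⟶ P')
      (b : M ⟶ Q') (c : M ⟶ O) (d : M ⟶ N) (m : W ⟶ M), IsProper β ∧ IsProper γ ∧
      IsOpenImmersion u' ∧ IsOpenImmersion v' ∧ u' ≫ β = u ∧ v' ≫ γ = v ∧ IsOpenImmersion a ∧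
      IsOpenImmersion b ∧ (∀ x, x ∈ Set.range a ↔ β x ∈ Set.range o) ∧
      (∀ y, y ∈ Set.range b ↔ γ y ∈ Set.range n) ∧ a ≫ β = c ≫ o ∧ b ≫ γ = d ≫ n ∧ d ≫ ν = c ∧
      DenseRange m ∧ m ≫ c = w ∧ m ≫ a = wU ≫ u' ∧ m ≫ b = wV ≫ v' := by
  have := isNoetherian_of_finiteType o
  have := isNoetherian_of_finiteType n
  obtain ⟨I, hI, hdom⟩ := exists_dominate w ν w' hw hlift
  have hIw : I.comap w = ⊤ := comap_eq_top _ fun x hx ↦ (hI _).1 hx ⟨x, rfl⟩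
  obtain ⟨P', M, β, a, c, u', hβ, hu', huβ, hp, hb⟩ := exists_admissible_blowup o u I
    fun x hx hx' ↦ (hI x).1 hx (hu x hx')
  obtain ⟨Q', M', γ, b, d, v', hγ, hv', hvγ, hq, hd⟩ :=
    exists_admissible_blowup n v (I.comap ν) (by
      intro x hx hx'
      rw [Scheme.IdealSheafData.support_comap] at hx
      refine (hI (ν x)).1 hx ?_
      obtain ⟨z, rfl⟩ := hv x hx'
      rw [← Scheme.Hom.comp_apply, hw]
      exact ⟨z, rfl⟩)
  have := isNoetherian_of_finiteType β
  have := isNoetherian_of_finiteType γ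
  have ha := isOpenImmersion_of_isPullback hp
  have hb' := isOpenImmersion_of_isPullback hq
  have := isNoetherian_of_finiteType a
  have := isNoetherian_of_finiteType b
  obtain ⟨h, hh, hh'⟩ := hdom c hb.1
  have h1 : IsInv ((I.comap ν).comap h) := by
    rw [← Scheme.IdealSheafData.comap_comp, hh]
    exact hb.1
  have h2 : IsInv (I.comap (d ≫ ν)) := by
    rw [Scheme.IdealSheafData.comap_comp]
    exact hd.1
  obtain ⟨e, he : e ≫ d = h, -⟩ := hd.2 h h1
  obtain ⟨e', he' : e' ≫ c = d ≫ ν, -⟩ := hb.2 _ h2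
  have hee' : e ≫ e' = 𝟙 _ := (hb.2 _ hb.1).unique
    (show (e ≫ e') ≫ c = c by rw [Category.assoc, he', reassoc_of% he, hh]) (Category.id_comp _)
  have hdh : e' ≫ h = d := by
    refine h2.hom_ext ν (by rw [Category.assoc, hh, he']) le_rfl ?_
    obtain ⟨s, hs⟩ := exists_factor_openImmersion ((away (I.comap (d ≫ ν))).ι ≫ d) w' fun t ↦ by
      refine hmem _ ?_
      by_contra hc
      refine mem_away.1 t.2 ?_
      rw [Scheme.IdealSheafData.support_comap]
      refine (hI _).2 ?_
      rw [Scheme.Hom.comp_apply] at hc ⊢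
      exact hc
    have h3 := hh' ((away (I.comap (d ≫ ν))).ι ≫ e') s (by
      rw [Category.assoc, he', ← reassoc_of% hs, hw])
    rw [Category.assoc] at h3
    rw [h3, hs]
  have hee : e' ≫ e = 𝟙 _ := (hd.2 _ hd.1).unique
    (show (e' ≫ e) ≫ d = d by rw [Category.assoc, he, hdh]) (Category.id_comp _)
  have : IsIso e := ⟨e', hee', hee⟩
  obtain ⟨m, hma, hmc⟩ := hp.exists_lift (wU ≫ u') w (by rw [Category.assoc, huβ, hwU])
  obtain ⟨m', hmb, hmd⟩ := hq.exists_lift (wV ≫ v') w' (by rw [Category.assoc, hvγ, hwV])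
  have hme : m ≫ e = m' := by
    have h3 : IsInv ((I.comap ν).comap w') := by
      rw [← Scheme.IdealSheafData.comap_comp, hw, hIw]
      exact .top
    refine (hd.2 _ h3).unique ?_ hmd
    have := hh' m (𝟙 _) (by rw [hmc, Category.id_comp])
    change (m ≫ e) ≫ d = w'
    rw [Category.assoc, he, this, Category.id_comp]
  refine ⟨P', Q', M, β, γ, u', v', a, e ≫ b, c, h, m, hβ, hγ, hu', hv', huβ, hvγ, ha,
    inferInstance, fun x ↦ mem_range_of_isPullback hp x, fun y ↦ ?_, hp.w, ?_, hh,
    hb.denseRange w hI m hmc, hmc, hma, ?_⟩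
  · rw [← mem_range_of_isPullback hq]
    constructor
    · rintro ⟨x, rfl⟩
      rw [Scheme.Hom.comp_apply]
      exact ⟨_, rfl⟩
    · rintro ⟨x, rfl⟩
      refine ⟨e' x, ?_⟩
      rw [← Scheme.Hom.comp_apply, reassoc_of% hee]
  · rw [Category.assoc, hq.w, reassoc_of% he]
  · rw [reassoc_of% hme, hmb]

end

lemma exists_compactification_of_graph {S P Q W G U V : Scheme.{u}} [IsNoetherian S] (p : P ⟶ S)
    (q : Q ⟶ S) [IsProper p] [IsProper q] (s : X ⟶ S) (i : U ⟶ X) (j : V ⟶ X)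
    [IsOpenImmersion i] [IsOpenImmersion j] (hX : ∀ x, x ∈ Set.range i ∨ x ∈ Set.range j)
    {a : W ⟶ U} {b : W ⟶ V} (hW : IsPullback a b i j) (u : U ⟶ P) (v : V ⟶ Q)
    [IsOpenImmersion u] [IsOpenImmersion v] (hu : u ≫ p = i ≫ s) (hv : v ≫ q = j ≫ s) {F : Set P}
    (hF : IsClosed F) (hUF : ∀ x, u x ∈ F ↔ x ∉ Set.range a) (k : G ⟶ Q) [IsOpenImmersion k]
    (r : G ⟶ P) (hr : r ≫ p = k ≫ q) (w : W ⟶ G) (hwk : w ≫ k = b ≫ v) (hwr : w ≫ r = a ≫ u)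
    (hw : DenseRange w) (hVG : ∀ y, v y ∈ Set.range k → y ∈ Set.range b)
    (hno : ∀ x y, (x ∈ F ∧ y ∉ Set.range k ∨ x ∈ F ∧ y ∈ Set.range v ∨
      x ∈ Set.range u ∧ y ∉ Set.range k) → ¬ Conn p q (a ≫ u) (b ≫ v) x y) :
    ∃ (Y : Scheme.{u}) (y : Y ⟶ S) (n : X ⟶ Y), IsProper y ∧ IsOpenImmersion n ∧ n ≫ y = s := by
  have := isNoetherian_of_finiteType p
  have := isNoetherian_of_finiteType q
  have := isNoetherian_of_finiteType k
  have ha : IsOpenImmersion a := isOpenImmersion_of_isPullback hW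
  have hb : IsOpenImmersion b := isOpenImmersion_of_isPullback hW.flip
  have := isNoetherian_of_finiteType (a ≫ u)
  have hcomp : (a ≫ u) ≫ p = (b ≫ v) ≫ q := by
    rw [Category.assoc, Category.assoc, hu, hv, reassoc_of% hW.w]
  let C := Conn p q (a ≫ u) (b ≫ v)
  have hgraph (z : G) : C (r z) (k z) :=
    (conn_of_mem_closure (p := q) (q := p) k r hr hwk hwr (hw z)).symm
  have hgraph' (x : P) (z : G) (h : C x (k z)) : r z = x :=
    Conn.eq_of_graph (p := q) (q := p) k r hr hwk hwr h.symm
  have hk : IsClosed (Set.range k)ᶜ := k.isOpenEmbedding.isOpen_range.isClosed_compl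
  let A : Set P := { x | ∃ y ∈ (Set.range k)ᶜ, C x y }
  have hA : IsClosed A := isClosed_conn hcomp hk
  let B : Set Q := { y | ∃ x ∈ F, Conn q p (b ≫ v) (a ≫ u) y x }
  have hB : IsClosed B := isClosed_conn hcomp.symm hF
  let B' : Set Q := { y | ∃ x ∈ A, Conn q p (b ≫ v) (a ≫ u) y x }
  have hB' : IsClosed B' := isClosed_conn hcomp.symm hA
  have hAF (x : P) (hx : x ∈ A) (hx' : x ∈ F) : False := by
    obtain ⟨y, hy, h⟩ := hx
    exact hno x y (.inl ⟨hx', hy⟩) h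
  have hAu (x : U) (hx : u x ∈ A) : False := by
    obtain ⟨y, hy, h⟩ := hx
    exact hno _ y (.inr (.inr ⟨⟨x, rfl⟩, hy⟩)) h
  have hBk (y : Q) (hy : y ∈ B) : y ∈ Set.range k := by
    by_contra hc
    obtain ⟨x, hx, h⟩ := hy
    exact hno x y (.inl ⟨hx, hc⟩) h.symm
  have hBv (y : V) (hy : v y ∈ B) : False := by
    obtain ⟨x, hx, h⟩ := hy
    exact hno x _ (.inr (.inl ⟨hx, ⟨y, rfl⟩⟩)) h.symm
  have hBF (z : G) : k z ∈ B ↔ r z ∈ F := by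
    constructor
    · rintro ⟨x, hx, h⟩
      rwa [hgraph' x z h.symm]
    · exact fun h ↦ ⟨_, h, (hgraph z).symm⟩
  have hBA (z : G) : k z ∈ B' ↔ r z ∈ A := by
    constructor
    · rintro ⟨x, hx, h⟩
      rwa [hgraph' x z h.symm]
    · exact fun h ↦ ⟨_, h, (hgraph z).symm⟩
  obtain ⟨O, hO⟩ := exists_opens_compl (hF.union hA)
  have hO (x : P) : x ∈ Set.range O.ι ↔ x ∉ F ∧ x ∉ A := by
    rw [hO, Set.mem_union, not_or]
  have hua (z : W) : u (a z) ∉ F := fun h ↦ (hUF _).1 h ⟨z, rfl⟩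
  obtain ⟨wO, hwO⟩ := exists_factor_openImmersion (a ≫ u) O.ι fun t ↦ by
    rw [Scheme.Hom.comp_apply, hO]
    exact ⟨hua t, hAu _⟩
  have : IsOpenImmersion (wO ≫ O.ι) := by rw [hwO]; infer_instance
  have : IsOpenImmersion wO := IsOpenImmersion.of_comp wO O.ι
  have hN := (IsPullback.of_hasPullback r O.ι)
  let κ := pullback.fst r O.ι
  let ν := pullback.snd r O.ι
  have hκ (z : G) : z ∈ Set.range κ ↔ r z ∈ Set.range O.ι := mem_range_of_isPullback hN z
  obtain ⟨w', hw', hw''⟩ := hN.exists_lift w wO (by rw [hwr, hwO])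
  have : IsOpenImmersion (w' ≫ κ ≫ k) := by
    rw [reassoc_of% hw', hwk]
    infer_instance
  have : IsOpenImmersion w' := IsOpenImmersion.of_comp w' (κ ≫ k)
  have hr' : IsSeparated (r ≫ p) := by rw [hr]; infer_instance
  have : IsSeparated r := IsSeparated.of_comp r p
  have hr'' : LocallyOfFiniteType (r ≫ p) := by rw [hr]; infer_instance
  have : LocallyOfFiniteType r := locallyOfFiniteType_of_comp r p
  have hu' (x) (hx : O.ι x ∈ Set.range u) : x ∈ Set.range wO := by
    obtain ⟨y, hy⟩ := hx
    have h := ((hO _).1 ⟨x, rfl⟩).1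
    rw [← hy, hUF, not_not] at h
    obtain ⟨z, rfl⟩ := h
    refine ⟨z, O.ι.isOpenEmbedding.injective ?_⟩
    rw [← Scheme.Hom.comp_apply, hwO, Scheme.Hom.comp_apply, hy]
  have hv' (x) (hx : (κ ≫ k) x ∈ Set.range v) : x ∈ Set.range w' := by
    obtain ⟨y, hy⟩ := hx
    have h : v y ∈ Set.range k := by
      rw [hy, Scheme.Hom.comp_apply]
      exact ⟨_, rfl⟩
    obtain ⟨z, rfl⟩ := hVG _ h
    refine ⟨z, (κ ≫ k).isOpenEmbedding.injective ?_⟩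
    rw [← hy, ← Scheme.Hom.comp_apply, reassoc_of% hw', hwk, Scheme.Hom.comp_apply]
  have hmem (z) (hz : ν z ∈ Set.range wO) : z ∈ Set.range w' := by
    have h : r (κ z) ∈ Set.range (a ≫ u) := by
      obtain ⟨t, ht⟩ := hz
      refine ⟨t, ?_⟩
      rw [← hwO, Scheme.Hom.comp_apply, ht, ← Scheme.Hom.comp_apply, ← Scheme.Hom.comp_apply, hN.w]
    obtain ⟨t, ht⟩ := mem_range_of_denseRange r w hw hwr h
    refine ⟨t, κ.isOpenEmbedding.injective ?_⟩
    rw [← ht, ← Scheme.Hom.comp_apply, hw']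
  obtain ⟨P', Q', M, β, γ, u', v', a', b', c, d, m, hβ, hγ, _, _, huβ, hvγ, _, _, hra, hrb, haβ,
      hbγ, hdν, hm, hmc, hma, hmb⟩ := exists_common_blowup wO ν w' hw'' (by
    intro R K _ _ _ _ _ _ t l htl
    obtain ⟨l', h1, h2⟩ := exists_lift_of_valuationRing q (t ≫ b ≫ v) (l ≫ O.ι ≫ p) (by
      rw [← reassoc_of% htl, reassoc_of% hwO]
      simpa only [Category.assoc] using (congrArg (t ≫ ·) hcomp).symm)
    have hc : C ((l ≫ O.ι) (cp R)) (l' (cp R)) := ⟨R, _, ‹_›, ‹_›, K, _, _, ‹_›, t, l ≫ O.ι, l',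
      by rw [← reassoc_of% htl, hwO], h1.symm, by rw [h2, Category.assoc], rfl, rfl⟩
    have hOl := (hO ((l ≫ O.ι) (cp R))).1 ⟨l (cp R), (Scheme.Hom.comp_apply ..).symm⟩
    have hl' : l' (cp R) ∈ Set.range k := by
      by_contra hcon
      exact hOl.2 ⟨_, hcon, hc⟩
    obtain ⟨l', rfl⟩ := exists_factor_of_mem _ _ hl'
    have h3 : l' ≫ r = l ≫ O.ι := by
      refine ext_of_valuationRing p (K := K) ?_ ?_
      · rw [Category.assoc, hr, Category.assoc, ← h2, Category.assoc]
      · rw [← hwk, ← Category.assoc, ← Category.assoc, cancel_mono] at h1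
        rw [reassoc_of% h1, hwr, ← reassoc_of% htl, hwO]
    obtain ⟨l'', h4, h5⟩ := hN.exists_lift l' l h3
    refine ⟨l'', ?_, h5⟩
    rw [← cancel_mono (κ ≫ k), Category.assoc, Category.assoc, reassoc_of% hw', reassoc_of% h4, h1,
      hwk]) hmem O.ι (κ ≫ k) u v hu' hv' a b hwO.symm (by rw [reassoc_of% hw', hwk])
  obtain ⟨PA, hPA⟩ := exists_opens_compl (hA.preimage β.continuous)
  obtain ⟨QB, hQB⟩ := exists_opens_compl (hB.preimage γ.continuous)
  have hPA (x) : x ∈ Set.range PA.ι ↔ β x ∉ A := hPA x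
  have hQB (x) : x ∈ Set.range QB.ι ↔ γ x ∉ B := hQB x
  have hN' (y : Q) : y ∈ Set.range (κ ≫ k) ↔ y ∈ Set.range k ∧ y ∉ B ∧ y ∉ B' := by
    constructor
    · rintro ⟨z, rfl⟩
      rw [Scheme.Hom.comp_apply, hBF, hBA, ← hO, ← hκ]
      exact ⟨⟨_, rfl⟩, ⟨_, rfl⟩⟩
    · rintro ⟨⟨z, rfl⟩, h⟩
      rw [hBF, hBA, ← hO, ← hκ] at h
      obtain ⟨t, rfl⟩ := h
      exact ⟨t, Scheme.Hom.comp_apply ..⟩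
  obtain ⟨f, hf⟩ := exists_factor_openImmersion a' PA.ι fun t ↦
    (hPA _).2 ((hO _).1 ((hra _).1 ⟨t, rfl⟩)).2
  obtain ⟨g, hg⟩ := exists_factor_openImmersion b' QB.ι fun t ↦
    (hQB _).2 ((hN' _).1 ((hrb _).1 ⟨t, rfl⟩)).2.1
  obtain ⟨u₁, hu₁⟩ := exists_factor_openImmersion u' PA.ι fun t ↦ by
    rw [hPA, ← Scheme.Hom.comp_apply, huβ]
    exact hAu t
  obtain ⟨v₁, hv₁⟩ := exists_factor_openImmersion v' QB.ι fun t ↦ by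
    rw [hQB, ← Scheme.Hom.comp_apply, hvγ]
    exact hBv t
  have h₁ : IsOpenImmersion (f ≫ PA.ι) := by rw [hf]; infer_instance
  have h₂ : IsOpenImmersion (g ≫ QB.ι) := by rw [hg]; infer_instance
  have h₃ : IsOpenImmersion (u₁ ≫ PA.ι) := by rw [hu₁]; infer_instance
  have h₄ : IsOpenImmersion (v₁ ≫ QB.ι) := by rw [hv₁]; infer_instance
  have := IsOpenImmersion.of_comp f PA.ι
  have := IsOpenImmersion.of_comp g QB.ι
  have := IsOpenImmersion.of_comp u₁ PA.ι
  have := IsOpenImmersion.of_comp v₁ QB.ι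
  have := isNoetherian_of_finiteType β
  have := isNoetherian_of_finiteType γ
  have := isNoetherian_of_finiteType a'
  have hfg : f ≫ PA.ι ≫ β ≫ p = g ≫ QB.ι ≫ γ ≫ q := by
    rw [reassoc_of% hf, reassoc_of% hg, reassoc_of% haβ, reassoc_of% hbγ, ← hdν, Category.assoc,
      ← hN.w_assoc, hr]
  have hC (x y) (h : Conn (β ≫ p) (γ ≫ q) (f ≫ PA.ι) (g ≫ QB.ι) x y) : C (β x) (γ y) := by
    have h' := Conn.of_denseRange (by simpa only [Category.assoc] using hfg) m hm h
    refine h'.map β γ rfl rfl ?_ ?_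
    · rw [hf, hma, Category.assoc, huβ]
    · rw [hg, hmb, Category.assoc, hvγ]
  have hrf (x) : x ∈ Set.range f ↔ PA.ι x ∈ Set.range a' := by
    rw [← hf, mem_range_comp_iff]
  have hrg (x) : x ∈ Set.range g ↔ QB.ι x ∈ Set.range b' := by
    rw [← hg, mem_range_comp_iff]
  refine exists_compactification_of_glue (β ≫ p) (γ ≫ q) PA.ι QB.ι f g hfg ?_ ?_ ?_ ?_ s i j hX hW
    u₁ v₁ m ?_ ?_ ?_ ?_ ?_
  · convert hF.preimage β.continuous using 1
    ext x
    constructor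
    · rintro ⟨z, hz, rfl⟩
      by_contra hc
      refine hz ((hrf _).2 ((hra _).2 ((hO _).2 ⟨hc, (hPA _).1 ⟨z, rfl⟩⟩)))
    · intro hx
      obtain ⟨z, rfl⟩ := (hPA x).2 fun h ↦ hAF _ h hx
      refine ⟨z, fun hz ↦ ?_, rfl⟩
      exact ((hO _).1 ((hra _).1 ((hrf _).1 hz))).1 hx
  · convert (hk.union hB').preimage γ.continuous using 1
    ext y
    constructor
    · rintro ⟨z, hz, rfl⟩
      by_contra hc
      rw [Set.mem_preimage, Set.mem_union, not_or, Set.mem_compl_iff, not_not] at hc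
      exact hz ((hrg _).2 ((hrb _).2 ((hN' _).2 ⟨hc.1, (hQB _).1 ⟨z, rfl⟩, hc.2⟩)))
    · intro hy
      have hy' : γ y ∉ B := by
        intro h
        obtain ⟨z, hz⟩ := hBk _ h
        rw [Set.mem_preimage, ← hz] at hy
        rw [← hz] at h
        obtain hy | hy := hy
        · exact hy ⟨z, rfl⟩
        · exact hAF _ ((hBA z).1 hy) ((hBF z).1 h)
      obtain ⟨z, rfl⟩ := (hQB y).2 hy'
      refine ⟨z, fun hz ↦ ?_, rfl⟩
      have h := (hN' _).1 ((hrb _).1 ((hrg _).1 hz))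
      obtain hy | hy := hy
      · exact hy h.1
      · exact h.2.2 hy
  · intro x y h
    rw [hPA, hQB]
    by_contra! hc
    have h := hC x y h
    obtain ⟨z, hz⟩ := hBk _ hc.2
    rw [← hz] at h
    rw [← hz, hBF, hgraph' _ _ h] at hc
    exact hAF _ hc.1 hc.2
  · intro x y h
    by_contra! hc
    have h := hC _ _ h
    have hx := (hPA _).1 ⟨x, rfl⟩
    have hy := (hQB _).1 ⟨y, rfl⟩
    have hx' : β (PA.ι x) ∈ F := by
      by_contra h'
      exact hc.1 ((hrf _).2 ((hra _).2 ((hO _).2 ⟨h', hx⟩)))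
    exact hy ⟨_, hx', h.symm⟩
  · rw [← cancel_mono PA.ι, Category.assoc, Category.assoc, hu₁, hf, hma]
  · rw [← cancel_mono QB.ι, Category.assoc, Category.assoc, hv₁, hg, hmb]
  · intro z x y h h'
    left
    by_contra hc
    rw [← hUF, ← huβ, Scheme.Hom.comp_apply, ← hu₁, Scheme.Hom.comp_apply, ← h,
      ← Scheme.Hom.comp_apply f, hf] at hc
    exact ((hO _).1 ((hra _).1 ⟨z, rfl⟩)).1 hc
  · rw [reassoc_of% hu₁, reassoc_of% huβ, hu]
  · rw [reassoc_of% hv₁, reassoc_of% hvγ, hv]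

lemma exists_compactification_of_union {S P Q U V : Scheme.{u}} [IsNoetherian S] (p : P ⟶ S)
    (q : Q ⟶ S) [IsProper p] [IsProper q] (s : X ⟶ S) [IsSeparated s] (i : U ⟶ X) (j : V ⟶ X)
    [IsOpenImmersion i] [IsOpenImmersion j] (hX : ∀ x, x ∈ Set.range i ∨ x ∈ Set.range j)
    (u : U ⟶ P) (v : V ⟶ Q) [IsOpenImmersion u] [IsOpenImmersion v] (hu : u ≫ p = i ≫ s)
    (hv : v ≫ q = j ≫ s) :
    ∃ (Y : Scheme.{u}) (y : Y ⟶ S) (n : X ⟶ Y), IsProper y ∧ IsOpenImmersion n ∧ n ≫ y = s := by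
  have hW := IsPullback.of_hasPullback i j
  have hcomp : (pullback.fst i j ≫ u) ≫ p = (pullback.snd i j ≫ v) ≫ q := by
    rw [Category.assoc, Category.assoc, hu, hv, reassoc_of% hW.w]
  obtain ⟨P₁, Q₁, β, γ, u₁, v₁, F, T, hβ, hγ, _, _, rfl, rfl, hF, hT, hUF, hVT, hno⟩ :=
    exists_separate p q u v (pullback.fst i j) (pullback.snd i j) hcomp fun x y h ↦ by
      have h := conn_of_isSeparated s i j u v hu hv hW.w h
      obtain ⟨t, rfl, rfl⟩ := Scheme.Pullback.exists_preimage_pullback x y h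
      exact ⟨⟨t, rfl⟩, ⟨t, rfl⟩⟩
  have hcomp' : (pullback.fst i j ≫ u₁) ≫ β ≫ p = (pullback.snd i j ≫ v₁) ≫ γ ≫ q := by
    simpa only [Category.assoc] using hcomp
  obtain ⟨Q', G, γ', v', k, r, w, hγ', _, rfl, _, hk, hr, hwk, hwr, hw⟩ :=
    exists_graph (β ≫ p) (γ ≫ q) u₁ v₁ (pullback.fst i j) (pullback.snd i j) hcomp' hT hVT
  refine exists_compactification_of_graph (β ≫ p) (γ' ≫ γ ≫ q) s i j hX hW u₁ v'
    (by simpa only [Category.assoc] using hu) (by simpa only [Category.assoc] using hv) hF hUF k r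
    hr w hwk hwr hw ?_ ?_
  · intro y hy
    rw [hk, ← Scheme.Hom.comp_apply, hVT, not_not] at hy
    exact hy
  · intro x y h hC
    refine hno x (γ' y) ?_ (hC.map (𝟙 _) γ' (Category.id_comp _) rfl (Category.comp_id _)
      (Category.assoc ..))
    rw [hk, not_not] at h
    obtain h | ⟨h, y, rfl⟩ | h := h
    · exact .inl h
    · exact .inr (.inl ⟨h, y, Scheme.Hom.comp_apply ..⟩)
    · exact .inr (.inr h)

lemma isClosedImmersion_lift {A B C : CommRingCat.{u}} {S : Scheme.{u}} [IsAffine S]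
    (f : Spec A ⟶ S) (g : Spec B ⟶ S) (χ : A ⟶ C) (φ : B ⟶ C)
    (h : Spec.map χ ≫ f = Spec.map φ ≫ g)
    (hC : ∀ K : Subring C, χ.hom.range ≤ K → φ.hom.range ≤ K → K = ⊤) :
    IsClosedImmersion (pullback.lift (Spec.map χ) (Spec.map φ) h) := by
  set l := pullback.lift (Spec.map χ) (Spec.map φ) h
  let e := (Scheme.ΓSpecIso C).commRingCatIsoToRingEquiv
  have hχ (a : A) : ∃ x, e (l.appTop x) = χ a := by
    refine ⟨(pullback.fst f g).appTop ((Scheme.ΓSpecIso A).inv a), ?_⟩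
    have h1 : l ≫ pullback.fst f g = Spec.map χ := pullback.lift_fst ..
    change (Scheme.ΓSpecIso C).hom.hom (l.appTop.hom ((pullback.fst f g).appTop.hom
      ((Scheme.ΓSpecIso A).inv.hom a))) = _
    rw [← CommRingCat.comp_apply, ← CommRingCat.comp_apply, ← CommRingCat.comp_apply]
    congr 2
    rw [← Scheme.Hom.comp_appTop_assoc, h1, Scheme.ΓSpecIso_naturality, Iso.inv_hom_id_assoc]
  have hφ (a : B) : ∃ x, e (l.appTop x) = φ a := by
    refine ⟨(pullback.snd f g).appTop ((Scheme.ΓSpecIso B).inv a), ?_⟩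
    have h1 : l ≫ pullback.snd f g = Spec.map φ := pullback.lift_snd ..
    change (Scheme.ΓSpecIso C).hom.hom (l.appTop.hom ((pullback.snd f g).appTop.hom
      ((Scheme.ΓSpecIso B).inv.hom a))) = _
    rw [← CommRingCat.comp_apply, ← CommRingCat.comp_apply, ← CommRingCat.comp_apply]
    congr 2
    rw [← Scheme.Hom.comp_appTop_assoc, h1, Scheme.ΓSpecIso_naturality, Iso.inv_hom_id_assoc]
  apply IsClosedImmersion.of_surjective_of_isAffine
  intro y
  have hK := hC (e.toRingHom.comp l.appTop.hom).range
    (by rintro _ ⟨a, rfl⟩; exact hχ a) (by rintro _ ⟨a, rfl⟩; exact hφ a)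
  obtain ⟨x, hx⟩ : e y ∈ (e.toRingHom.comp l.appTop.hom).range := hK ▸ Subring.mem_top _
  exact ⟨x, e.injective hx⟩

lemma exists_immersion_spec_of_algebra (A : Type u) {R B : Type u} [CommRing A] [CommRing R]
    [CommRing B] [Algebra A B] [Algebra R B] [Algebra.FiniteType R B] {S : Scheme.{u}}
    (j : Spec (.of R) ⟶ S) [IsOpenImmersion j] (t : S ⟶ Spec (.of A))
    (ht : Spec.map (CommRingCat.ofHom (algebraMap R B)) ≫ j ≫ t =
      Spec.map (CommRingCat.ofHom (algebraMap A B))) :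
    ∃ (P : Scheme.{u}) (p : P ⟶ S) (u : Spec (.of B) ⟶ P), IsProper p ∧ IsImmersion u ∧
      u ≫ p = Spec.map (CommRingCat.ofHom (algebraMap R B)) ≫ j := by
  classical
  obtain ⟨s, hs⟩ := ‹Algebra.FiniteType R B›.out
  let M : Submodule A B := Submodule.span A (insert 1 s : Finset B)
  have hM : M.FG := ⟨_, rfl⟩
  have h1 : (1 : B) ∈ M ^ 1 := by
    rw [pow_one]
    exact Submodule.subset_span (by simp)
  have hsM (b : B) (hb : b ∈ s) : b ∈ M ^ 1 := by
    rw [pow_one]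
    exact Submodule.subset_span (by simp [hb])
  obtain ⟨χ, hχ⟩ := exists_chartRing_hom (M := M) (RingHom.id B) h1 (one_mem _)
    fun c _ ↦ ⟨c, by simp⟩
  simp only [RingHom.id_apply, one_pow, one_mul] at hχ
  have := isProper_projBase hM
  let χ' : ChartRing h1 ⟶ .of B := CommRingCat.ofHom χ
  have hl : Spec.map χ' ≫ chart h1 ≫ projBase M =
      Spec.map (CommRingCat.ofHom (algebraMap R B)) ≫ j ≫ t := by
    rw [chart_projBase, ht, ← Spec.map_comp]
    congr 1
    ext r
    change χ ((chartBase h1).hom r) = _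
    rw [chartBase_apply]
    exact hχ 0 _ _
  have hcl := isClosedImmersion_lift _ _ χ' _ hl fun K h₁ h₂ ↦ by
    refine top_le_iff.1 fun x _ ↦ ?_
    have hx : x ∈ Algebra.adjoin R (s : Set B) := hs ▸ Algebra.mem_top
    induction hx using Algebra.adjoin_induction with
    | mem b hb => exact h₁ ⟨fr h1 1 b (hsM b hb), hχ 1 b (hsM b hb)⟩
    | algebraMap r => exact h₂ ⟨r, rfl⟩
    | add x y _ _ hx hy => exact add_mem (hx trivial) (hy trivial)
    | mul x y _ _ hx hy => exact mul_mem (hx trivial) (hy trivial)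
  let m : pullback (chart h1 ≫ projBase M) (j ≫ t) ⟶ pullback (projBase M) t :=
    pullback.map _ _ _ _ (chart h1) j (𝟙 _) (by rw [Category.comp_id]) (by rw [Category.comp_id])
  have hm : m ≫ pullback.snd (projBase M) t = pullback.snd _ _ ≫ j := pullback.lift_snd ..
  have : IsOpenImmersion m := inferInstanceAs (IsOpenImmersion (pullback.map ..))
  refine ⟨_, pullback.snd (projBase M) t, pullback.lift _ _ hl ≫ m, inferInstance,
    inferInstance, ?_⟩
  rw [Category.assoc, hm, pullback.lift_snd_assoc]

lemma exists_immersion_spec {S : Scheme.{u}} {R B : CommRingCat.{u}} (φ : R ⟶ B)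
    (hφ : φ.hom.FiniteType) (j : Spec R ⟶ S) [IsOpenImmersion j] :
    ∃ (P : Scheme.{u}) (p : P ⟶ S) (u : Spec B ⟶ P),
      IsProper p ∧ IsImmersion u ∧ u ≫ p = Spec.map φ ≫ j := by
  algebraize [φ.hom]
  let : Algebra (ULift.{u} ℤ) B :=
    ((Int.castRingHom B).comp ULift.ringEquiv.toRingHom).toAlgebra
  exact exists_immersion_spec_of_algebra (ULift.{u} ℤ) (R := R) (B := B) j
    (specULiftZIsTerminal.from S) (specULiftZIsTerminal.hom_ext _ _)

lemma exists_compactification_of_isAffine {S U O : Scheme.{u}} [IsNoetherian S] [IsAffine U]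
    [IsAffine O] (f : U ⟶ O) [LocallyOfFiniteType f] (j : O ⟶ S) [IsOpenImmersion j] :
    ∃ (Y : Scheme.{u}) (y : Y ⟶ S) (n : U ⟶ Y), IsProper y ∧ IsOpenImmersion n ∧ n ≫ y = f ≫ j := by
  have hf : f.appTop.hom.FiniteType :=
    (HasRingHomProperty.iff_of_isAffine (P := @LocallyOfFiniteType)).1 ‹_›
  obtain ⟨P, p, u, hp, hu, h⟩ := exists_immersion_spec f.appTop hf (O.isoSpec.inv ≫ j)
  have := isNoetherian_of_finiteType p
  have := isNoetherian_of_finiteType j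
  have := isNoetherian_of_finiteType f
  have : QuasiCompact (U.isoSpec.hom ≫ u) := quasiCompact_of_noetherianSpace_source _
  refine ⟨_, (U.isoSpec.hom ≫ u).imageι ≫ p, (U.isoSpec.hom ≫ u).toImage, inferInstance,
    inferInstance, ?_⟩
  rw [Scheme.Hom.toImage_imageι_assoc, Category.assoc, h, Scheme.isoSpec_inv_naturality_assoc,
    Iso.hom_inv_id_assoc]

lemma exists_compactification_of_opens {S : Scheme.{u}} [IsNoetherian S] (s : X ⟶ S)
    [LocallyOfFiniteType s] (x : X) : ∃ (D : X.Opens) (_ : x ∈ D) (Y : Scheme.{u}) (y : Y ⟶ S)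
      (n : D.toScheme ⟶ Y), IsProper y ∧ IsOpenImmersion n ∧ n ≫ y = D.ι ≫ s := by
  obtain ⟨O, hO⟩ := exists_affineOpen_mem (s x)
  obtain ⟨D, hD, hx, hDO⟩ := exists_isAffineOpen_mem_and_subset (U := s ⁻¹ᵁ O.1) (x := x) hO
  have : IsAffine D.toScheme := hD
  have : IsAffine O.1.toScheme := O.2
  obtain ⟨f, hf⟩ := exists_factor_openImmersion (D.ι ≫ s) O.1.ι fun t ↦ by
    rw [Scheme.Opens.range_ι, Scheme.Hom.comp_apply]
    exact hDO t.2
  have h : LocallyOfFiniteType (f ≫ O.1.ι) := by rw [hf]; infer_instance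
  have := locallyOfFiniteType_of_comp f O.1.ι
  obtain ⟨Y, y, n, hy, hn, h⟩ := exists_compactification_of_isAffine f O.1.ι
  exact ⟨D, hx, Y, y, n, hy, hn, h.trans hf⟩

theorem exists_compactification {S : Scheme.{u}} [IsNoetherian S] (s : X ⟶ S) [IsSeparated s]
    [LocallyOfFiniteType s] [QuasiCompact s] :
    ∃ (Y : Scheme.{u}) (y : Y ⟶ S) (n : X ⟶ Y), IsProper y ∧ IsOpenImmersion n ∧ n ≫ y = s := by
  have := isNoetherian_of_finiteType s
  let R (D : X.Opens) : Prop := ∃ (Y : Scheme.{u}) (y : Y ⟶ S) (n : D.toScheme ⟶ Y),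
    IsProper y ∧ IsOpenImmersion n ∧ n ≫ y = D.ι ≫ s
  have hR : ∃ D : X.Opens, Set.univ ⊆ (D : Set X) ∧ R D := by
    refine isCompact_univ.induction_on (p := fun A : Set X ↦ ∃ D : X.Opens, A ⊆ D ∧ R D) ?_ ?_ ?_ ?_
    · have : IsEmpty (⊥ : X.Opens).toScheme := ⟨fun x ↦ x.2⟩
      exact ⟨⊥, Set.empty_subset _, _, (⊥ : X.Opens).ι ≫ s, 𝟙 _, inferInstance,
        inferInstance, Category.id_comp _⟩
    · rintro A B h ⟨D, hD, h'⟩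
      exact ⟨D, h.trans hD, h'⟩
    · rintro A B ⟨D, hD, P, p, u, hp, hu, h⟩ ⟨E, hE, Q, q, v, hq, hv, h'⟩
      refine ⟨D ⊔ E, by rw [Opens.coe_sup]; exact Set.union_subset_union hD hE, ?_⟩
      refine exists_compactification_of_union p q ((D ⊔ E).ι ≫ s) (X.homOfLE le_sup_left)
        (X.homOfLE le_sup_right) ?_ u v ?_ ?_
      · intro x
        obtain hx | hx := x.2
        · exact .inl ⟨⟨x.1, hx⟩, Subtype.ext (by simp)⟩
        · exact .inr ⟨⟨x.1, hx⟩, Subtype.ext (by simp)⟩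
      · rw [Scheme.homOfLE_ι_assoc, h]
      · rw [Scheme.homOfLE_ι_assoc, h']
    · intro x _
      obtain ⟨D, hx, h⟩ := exists_compactification_of_opens s x
      exact ⟨D, mem_nhdsWithin_of_mem_nhds (D.isOpen.mem_nhds hx), D, subset_rfl, h⟩
  obtain ⟨D, hD, Y, y, n, hy, hn, h⟩ := hR
  obtain rfl : D = ⊤ := by
    ext x
    simpa using hD (Set.mem_univ x)
  exact ⟨Y, y, X.topIso.inv ≫ n, hy, inferInstance, by
    rw [Category.assoc, h]
    exact X.topIso.inv_hom_id_assoc s⟩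

lemma ker_toImage (f : X ⟶ Y) : f.toImage.ker = ⊥ := by
  let g := f.toImage.ker.subschemeι
  have hg : f.toImage.toImage ≫ g = f.toImage := Scheme.Hom.toImage_imageι _
  have h : (g ≫ f.imageι).ker ≤ f.imageι.ker := by
    have h := Scheme.Hom.le_ker_comp f.toImage.toImage (g ≫ f.imageι)
    rwa [reassoc_of% hg, f.toImage_imageι, ← Scheme.IdealSheafData.ker_subschemeι f.ker] at h
  have hl := IsClosedImmersion.lift_fac (g ≫ f.imageι) f.imageι h
  have hl' : IsClosedImmersion.lift (g ≫ f.imageι) f.imageι h ≫ g = 𝟙 _ := by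
    rw [← cancel_mono f.imageι, Category.assoc, hl, Category.id_comp]
  have h' := Scheme.Hom.le_ker_comp (IsClosedImmersion.lift (g ≫ f.imageι) f.imageι h) g
  rw [hl', Scheme.IdealSheafData.ker_subschemeι] at h'
  rw [← le_bot_iff]
  refine h'.trans (le_of_eq ?_)
  simp

lemma isReduced_vanishingIdeal (F : Closeds X) :
    IsReduced (Scheme.IdealSheafData.vanishingIdeal F).subscheme := by
  set I := Scheme.IdealSheafData.vanishingIdeal F
  have (U : I.subschemeCover.openCover.I₀) : IsReduced (I.subschemeCover.openCover.X U) := by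
    let V : X.affineOpens := U
    refine (affine_isReduced_iff (.of (Γ(X, V) ⧸ I.ideal V))).2 ?_
    change _root_.IsReduced (Γ(X, V) ⧸ I.ideal V)
    rw [← Ideal.isRadical_iff_quotient_reduced]
    exact PrimeSpectrum.isRadical_vanishingIdeal _
  exact IsReduced.of_openCover _ I.subschemeCover.openCover

lemma exists_factor_closedImmersion [IsReduced T] (f : T ⟶ X) (j : Y ⟶ X) [IsClosedImmersion j]
    (h : ∀ t, f t ∈ Set.range j) : ∃ g : T ⟶ Y, g ≫ j = f := by
  have : Surjective (pullback.fst f j) := ⟨fun t ↦ by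
    obtain ⟨y, hy⟩ := h t
    obtain ⟨z, hz, -⟩ := Scheme.Pullback.exists_preimage_pullback t y hy.symm
    exact ⟨z, hz⟩⟩
  have := isIso_of_isClosedImmersion_of_surjective (pullback.fst f j)
  exact ⟨inv (pullback.fst f j) ≫ pullback.snd f j, by
    rw [Category.assoc, ← pullback.condition, IsIso.inv_hom_id_assoc]⟩

lemma isPullback_of_openImmersion {P Q : Scheme.{u}} (j : X ⟶ P) (g : P ⟶ Q) (k : X ⟶ Q)
    [IsOpenImmersion j] [IsOpenImmersion k] (hg : j ≫ g = k)
    (h : ∀ x, g x ∈ Set.range k → x ∈ Set.range j) : IsPullback j (𝟙 X) g k := by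
  refine ⟨⟨by rw [hg, Category.id_comp]⟩, ⟨PullbackCone.IsLimit.mk _ (fun s ↦ s.snd) ?_ ?_ ?_⟩⟩
  · intro s
    obtain ⟨c, hc⟩ := exists_factor_openImmersion s.fst j fun t ↦ h _ ⟨s.snd t, by
      rw [← Scheme.Hom.comp_apply, ← Scheme.Hom.comp_apply, s.condition]⟩
    have : c = s.snd := by
      rw [← cancel_mono k, ← s.condition, ← hc, Category.assoc, hg]
    rw [← this, hc]
  · exact fun s ↦ Category.comp_id _
  · intro s m _ h
    exact (Category.comp_id _).symm.trans h

section Compactification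

variable {S : Scheme.{0}} {X : Over S}

/-- The reduced complement of an open subscheme. -/
noncomputable def complι {P X : Scheme.{u}} (j : X ⟶ P) [IsOpenImmersion j] :
    (Scheme.IdealSheafData.vanishingIdeal
      ⟨(Set.range j)ᶜ, j.isOpenEmbedding.isOpen_range.isClosed_compl⟩).subscheme ⟶ P :=
  Scheme.IdealSheafData.subschemeι _

/-- The compactification with the reduced complement as boundary. -/
noncomputable def ofOpen (P : Over S) [IsProper P.hom] (j : X ⟶ P) [IsOpenImmersion j.left] :
    Compactification X where
  Z := Over.mk (complι j.left ≫ P.hom)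
  P := P
  properZ := by
    dsimp [complι]
    infer_instance
  properP := ‹_›
  i := Over.homMk (complι j.left) rfl
  closed_i := by
    change IsClosedImmersion (complι j.left)
    unfold complι
    infer_instance
  j := j
  open_j := ‹_›
  compl := by
    change _ = (Set.range (complι j.left))ᶜ
    rw [complι, Scheme.IdealSheafData.range_subschemeι,
      Scheme.IdealSheafData.coe_support_vanishingIdeal]
    exact (compl_compl _).symm

lemma mem_range_i_iff (C : Compactification X) (x : C.P.left) :
    x ∈ Set.range C.i.left ↔ x ∉ Set.range C.j.left := by
  have h := C.compl
  change Set.range C.j.left = (Set.range C.i.left)ᶜ at h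
  rw [h, Set.mem_compl_iff, not_not]

lemma exists_compMor (C D : Compactification X) [IsReduced C.Z.left] [IsNoetherian C.P.left]
    (hj : DenseRange C.j.left) (g : C.P ⟶ D.P) (hg : C.j ≫ g = D.j) :
    ∃ m : CompMor C D, m.g = g ∧ IsBaseChangeOf C D m.g (𝟙 X) := by
  have := C.closed_i
  have := C.open_j
  have := C.properP
  have := D.closed_i
  have := D.open_j
  have := D.properP
  have hg' : C.j.left ≫ g.left = D.j.left := by rw [← hg, Over.comp_left]
  have hs : IsSeparated (g.left ≫ D.P.hom) := by rw [Over.w]; infer_instance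
  have : IsSeparated g.left := IsSeparated.of_comp g.left D.P.hom
  have hmem (x) (hx : g.left x ∈ Set.range D.j.left) : x ∈ Set.range C.j.left :=
    mem_range_of_denseRange g.left C.j.left hj hg' hx
  obtain ⟨f, hf⟩ := exists_factor_closedImmersion (C.i.left ≫ g.left) D.i.left fun t ↦ by
    rw [mem_range_i_iff, Scheme.Hom.comp_apply]
    intro h
    exact (mem_range_i_iff C _).1 ⟨t, rfl⟩ (hmem _ h)
  refine ⟨⟨Over.homMk f ?_, g, hf.symm, ?_⟩, rfl, ?_⟩
  · rw [← Over.w D.i, reassoc_of% hf, Over.w g, Over.w C.i]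
  · intro t
    let fs := pullback.fst D.i.left g.left
    let sn := pullback.snd D.i.left g.left
    have hsn : sn t ∈ Set.range C.i.left := by
      rw [mem_range_i_iff]
      rintro ⟨y, hy⟩
      refine (mem_range_i_iff D (D.i.left (fs t))).1 ⟨_, rfl⟩ ⟨y, ?_⟩
      rw [← Scheme.Hom.comp_apply, pullback.condition, Scheme.Hom.comp_apply]
      change _ = g.left (sn t)
      rw [← hy, ← hg', Scheme.Hom.comp_apply]
    obtain ⟨z, hz⟩ := hsn
    refine ⟨z, sn.isClosedEmbedding.injective ?_⟩
    refine Eq.trans ?_ hz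
    change sn (pullback.lift f C.i.left hf z) = _
    rw [← Scheme.Hom.comp_apply]
    exact congr($(pullback.lift_snd f C.i.left hf) z)
  · exact isPullback_of_openImmersion C.j.left g.left D.j.left hg' hmem

/-- The scheme-theoretic image of an immersion into a proper scheme is a compactification. -/
lemma exists_compactification_of_isImmersion [IsNoetherian S] [IsNoetherian X.left] (P : Over S)
    [IsProper P.hom] (j : X ⟶ P) [IsImmersion j.left] :
    ∃ (C : Compactification X) (g : C.P ⟶ P), IsReduced C.Z.left ∧ IsNoetherian C.P.left ∧
      DenseRange C.j.left ∧ C.j.left.ker = ⊥ ∧ C.j ≫ g = j := by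
  have := isNoetherian_of_finiteType P.hom
  let P' : Over S := Over.mk (j.left.imageι ≫ P.hom)
  have : IsProper P'.hom := by
    dsimp [P']
    infer_instance
  have : QuasiCompact j.left := quasiCompact_of_noetherianSpace_source _
  have hN : IsNoetherian P'.left := isNoetherian_of_finiteType P'.hom
  let j' : X ⟶ P' := Over.homMk j.left.toImage (by simp [P'])
  have : IsOpenImmersion j'.left := inferInstanceAs (IsOpenImmersion j.left.toImage)
  refine ⟨ofOpen P' j', Over.homMk j.left.imageι rfl, isReduced_vanishingIdeal _,
    hN, j.left.toImage.denseRange, ker_toImage _, ?_⟩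
  ext1
  exact j.left.toImage_imageι

end Compactification

end NagataAux

theorem statement3
    (S : Scheme.{0}) [IsNoetherian S] [S.IsSeparated]
    (X : Over S)
    [IsNoetherian X.left] [X.left.IsSeparated]
    [LocallyOfFiniteType X.hom] [QuasiCompact X.hom] :
    -- the category of compactifications of x is nonempty ...
    Nonempty (Compactification X) ∧
    -- ... every pair of objects admits a span over them ...
    (∀ C₀ C₁ : Compactification X,
      ∃ (C : Compactification X) (m₀ : CompMor C C₀) (m₁ : CompMor C C₁),
        IsBaseChangeOf C C₀ m₀.g (𝟙 X) ∧ IsBaseChangeOf C C₁ m₁.g (𝟙 X)) ∧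
    -- ... and every parallel pair of morphisms admits an equalizing morphism.
    (∀ (C₀ C₁ : Compactification X) (m₀ m₁ : CompMor C₀ C₁),
      IsBaseChangeOf C₀ C₁ m₀.g (𝟙 X) → IsBaseChangeOf C₀ C₁ m₁.g (𝟙 X) →
      ∃ (C : Compactification X) (m : CompMor C C₀),
        IsBaseChangeOf C C₀ m.g (𝟙 X) ∧
        m.f ≫ m₀.f = m.f ≫ m₁.f ∧ m.g ≫ m₀.g = m.g ≫ m₁.g) := by
  refine ⟨?_, fun C₀ C₁ ↦ ?_, fun C₀ C₁ m₀ m₁ h₀ h₁ ↦ ?_⟩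
  · have h : IsSeparated (X.hom ≫ terminal.from S) := by
      rw [Subsingleton.elim (X.hom ≫ terminal.from S) (terminal.from X.left)]
      infer_instance
    have : IsSeparated X.hom := IsSeparated.of_comp X.hom (terminal.from S)
    obtain ⟨Y, y, n, _, _, h⟩ := NagataAux.exists_compactification X.hom
    have : IsProper (Over.mk y).hom := ‹IsProper y›
    have : IsImmersion (Over.homMk n h : X ⟶ Over.mk y).left :=
      inferInstanceAs (IsImmersion n)
    obtain ⟨C, -⟩ := NagataAux.exists_compactification_of_isImmersion (Over.mk y) (Over.homMk n h)
    exact ⟨C⟩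
  · have := C₀.properP
    have := C₁.properP
    have := C₀.open_j
    let P : Over S := Over.mk (pullback.fst C₀.P.hom C₁.P.hom ≫ C₀.P.hom)
    have : IsProper P.hom := by
      dsimp [P]
      infer_instance
    let pr₀ : P ⟶ C₀.P := Over.homMk (pullback.fst C₀.P.hom C₁.P.hom) rfl
    let pr₁ : P ⟶ C₁.P := Over.homMk (pullback.snd C₀.P.hom C₁.P.hom) pullback.condition.symm
    have hw : C₀.j.left ≫ C₀.P.hom = C₁.j.left ≫ C₁.P.hom := by rw [Over.w, Over.w]
    let j : X ⟶ P := Over.homMk (pullback.lift C₀.j.left C₁.j.left hw)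
      ((pullback.lift_fst_assoc ..).trans (Over.w C₀.j))
    have hj₀ : j ≫ pr₀ = C₀.j := by
      ext1
      exact pullback.lift_fst ..
    have hj₁ : j ≫ pr₁ = C₁.j := by
      ext1
      exact pullback.lift_snd ..
    have h : IsImmersion (j.left ≫ pr₀.left) := by
      rw [← Over.comp_left, hj₀]
      infer_instance
    have : IsImmersion j.left := IsImmersion.of_comp j.left pr₀.left
    obtain ⟨C, g, _, _, hd, -, hg⟩ := NagataAux.exists_compactification_of_isImmersion P j
    obtain ⟨m₀, -, h₀⟩ := NagataAux.exists_compMor C C₀ hd (g ≫ pr₀) (by rw [reassoc_of% hg, hj₀])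
    obtain ⟨m₁, -, h₁⟩ := NagataAux.exists_compMor C C₁ hd (g ≫ pr₁) (by rw [reassoc_of% hg, hj₁])
    exact ⟨C, m₀, m₁, h₀, h₁⟩
  · have := C₀.properP
    have := C₁.properP
    have := C₀.open_j
    have := C₁.closed_i
    obtain ⟨C, g, _, _, hd, hk, hg⟩ :=
      NagataAux.exists_compactification_of_isImmersion C₀.P C₀.j
    obtain ⟨m, rfl, h⟩ := NagataAux.exists_compMor C C₀ hd g hg
    have hg : m.g ≫ m₀.g = m.g ≫ m₁.g := by
      ext1
      refine NagataAux.ext_of_ker_eq_bot C₁.P.hom ?_ C.j.left hk ?_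
      · rw [Over.w, Over.w]
      · have e : C₀.j.left ≫ m₀.g.left = C₀.j.left ≫ m₁.g.left := h₀.w.trans h₁.w.symm
        rw [← hg] at e
        simpa only [Over.comp_left, Category.assoc] using e
    refine ⟨C, m, h, ?_, hg⟩
    ext1
    rw [← cancel_mono C₁.i.left, Over.comp_left, Over.comp_left, Category.assoc, Category.assoc,
      ← m₀.comm, ← m₁.comm, ← reassoc_of% m.comm, ← reassoc_of% m.comm, ← Over.comp_left, hg,
      Over.comp_left]
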